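/- Let s ≥ 1 and 2 ≤ r ≤ k, and let F be a graph consisting of exactly s connected components of chromatic number k+1, each of which contains a color-critical edge, together with any number of components of chromatic number at most k. Then for all sufficiently large n, ex_r(n, F^{(r)+}) = |E(T_r(n, k, s−1))|. -/

import Mathlib

open Finset
open scoped Classical

/-- An `r`-uniform hypergraph on vertex type `V`: a finite set of `r`-element
vertex subsets, the hyperedges. -/
structure HyperGraph (V : Type*) (r : ℕ) where
  edges : Finset (Finset V)
  uniform : ∀ e ∈ edges, e.card = r

namespace HyperGraph

variable {V α : Type*}

/-- A witness that the `r`-graph `G` contains a copy of the `r`-uniform expansion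
`F^{(r)+}` of the graph `F`, with core embedding `φ` and, for each edge of `F`, a set
of `r - 2` expansion vertices given by `S`.  The expansion vertices avoid the core and
are pairwise disjoint over distinct edges. -/
def IsExpansionWitness [DecidableEq V] {r : ℕ} (G : HyperGraph V r) (F : SimpleGraph α)
    (φ : α ↪ V) (S : Sym2 α → Finset V) : Prop :=
  (∀ a b, F.Adj a b → (S s(a, b)).card = r - 2) ∧
  (∀ a b, F.Adj a b → ∀ x ∈ S s(a, b), x ∉ Set.range φ) ∧
  (∀ e ∈ F.edgeSet, ∀ e' ∈ F.edgeSet, e ≠ e' → Disjoint (S e) (S e')) ∧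
  (∀ a b, F.Adj a b → insert (φ a) (insert (φ b) (S s(a, b))) ∈ G.edges)

/-- The `r`-graph `G` contains a copy of the expansion `F^{(r)+}` (i.e. a subhypergraph
isomorphic to it). -/
def ContainsExpansion [DecidableEq V] {r : ℕ} (G : HyperGraph V r) (F : SimpleGraph α) : Prop :=
  ∃ φ S, G.IsExpansionWitness F φ S

end HyperGraph

/-- `ex_r(n, F^{(r)+})`: the maximum number of hyperedges in an `n`-vertex
`F^{(r)+}`-free `r`-graph. -/
noncomputable def exExpansion (r n : ℕ) {α : Type*} (F : SimpleGraph α) : ℕ :=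
  sSup {m | ∃ G : HyperGraph (Fin n) r, ¬ G.ContainsExpansion F ∧ G.edges.card = m}

/-- `F` is contained in `G` as a (not necessarily induced) subgraph. -/
def GraphContains {α β : Type*} (F : SimpleGraph α) (G : SimpleGraph β) : Prop :=
  ∃ f : α ↪ β, ∀ a b, F.Adj a b → G.Adj (f a) (f b)

/-- The number of copies of `K_r` (i.e. `r`-cliques) in the graph `G`. -/
noncomputable def cliqueCount {V : Type*} [Fintype V] (G : SimpleGraph V) (r : ℕ) : ℕ :=
  Nat.card {s : Finset V // G.IsNClique r s}

/-- The generalized Turán number `ex(n, K_r, F)`: the maximum number of `r`-cliques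
in an `n`-vertex `F`-free graph. -/
noncomputable def exClique (n r : ℕ) {α : Type*} (F : SimpleGraph α) : ℕ :=
  sSup {m | ∃ G : SimpleGraph (Fin n), ¬ GraphContains F G ∧ cliqueCount G r = m}

/-- The number of copies of the complete `p`-uniform hypergraph `K_r^p` in a `p`-graph `G`:
the number of `r`-element vertex sets all of whose `p`-subsets are hyperedges. -/
noncomputable def hyperCliqueCount {V : Type*} [Fintype V] {p : ℕ} (G : HyperGraph V p)
    (r : ℕ) : ℕ :=
  Nat.card {R : Finset V // R.card = r ∧ ∀ e ⊆ R, e.card = p → e ∈ G.edges}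

/-- `ex_p(n, K_r^p, F^{(p)+})`: the maximum number of copies of `K_r^p` in an `n`-vertex
`F^{(p)+}`-free `p`-graph. -/
noncomputable def exHyperClique (p r n : ℕ) {α : Type*} (F : SimpleGraph α) : ℕ :=
  sSup {m | ∃ G : HyperGraph (Fin n) p, ¬ G.ContainsExpansion F ∧ hyperCliqueCount G r = m}

/-- `G` contains (a subgraph isomorphic to) a member of the decomposition family `D(F)`:
a bipartite graph obtained from a proper `(k+1)`-coloring of `F` by deleting `k - 1`
color classes. -/
def ContainsDecompMember {α β : Type*} (F : SimpleGraph α) (k : ℕ) (G : SimpleGraph β) : Prop :=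
  ∃ c : α → Fin (k + 1), (∀ a b, F.Adj a b → c a ≠ c b) ∧
    ∃ i j : Fin (k + 1), i ≠ j ∧ GraphContains (F.induce {a | c a = i ∨ c a = j}) G

/-- `biex(n, F)`: the maximum number of edges of an `n`-vertex graph containing no member
of the decomposition family `D(F)` (for a graph `F` of chromatic number `k+1`). -/
noncomputable def biex (n : ℕ) {α : Type*} (F : SimpleGraph α) (k : ℕ) : ℕ :=
  sSup {m | ∃ G : SimpleGraph (Fin n), ¬ ContainsDecompMember F k G ∧ Nat.card G.edgeSet = m}

/-- `t_r(n,k)`: the number of hyperedges of the complete balanced `k`-partite `r`-graph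
`T_r(n,k)` (realized on `Fin n` with the balanced partition `v ↦ v % k`). -/
noncomputable def turanHyperCount (r n k : ℕ) : ℕ :=
  Nat.card {e : Finset (Fin n) // e.card = r ∧
    Set.InjOn (fun v : Fin n => v.val % k) ↑e}

/-- `|E(T_r(n,k,i))|`: the number of hyperedges of the `r`-graph obtained from `T_r(n-i,k)`
by adding `i` new vertices (here the vertices with value `< i`) and all `r`-sets containing
at least one of them. -/
noncomputable def turanPlusCount (r n k i : ℕ) : ℕ :=
  Nat.card {e : Finset (Fin n) // e.card = r ∧
    ((∃ v ∈ e, v.val < i) ∨ Set.InjOn (fun v : Fin n => (v.val - i) % k) ↑e)}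

/-- `G` has a color-critical edge: an edge whose deletion decreases the chromatic number. -/
def HasColorCriticalEdge {β : Type*} (G : SimpleGraph β) : Prop :=
  ∃ a b, G.Adj a b ∧ (G.deleteEdges {s(a, b)}).chromaticNumber < G.chromaticNumber

/-- `B_{k+1,1}`: two copies of `K_{k+1}` sharing exactly one vertex (the vertex `k`). -/
def bowtie (k : ℕ) : SimpleGraph (Fin (2 * k + 1)) :=
  SimpleGraph.fromRel (fun a b => (a.val ≤ k ∧ b.val ≤ k) ∨ (k ≤ a.val ∧ k ≤ b.val))

/-- The `r`-graph `H'(m)` on `n` vertices: a complete `k`-partite `r`-graph with one part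
`V_1` of size `m` (the vertices with value `< m`) and `k-1` balanced parts on the remaining
vertices, together with all `r`-sets containing both `u` (the vertex `0`) and `v` (the
vertex `1`), and all `r`-sets containing `u` and `r-1` vertices outside `V_1`. -/
noncomputable def HprimeGraph (r n k m : ℕ) : HyperGraph (Fin n) r :=
  ⟨Finset.univ.filter (fun e : Finset (Fin n) => e.card = r ∧
      (Set.InjOn (fun v : Fin n => if v.val < m then 0 else (v.val - m) % (k - 1) + 1) ↑e
        ∨ ((∃ a ∈ e, a.val = 0) ∧ (∃ b ∈ e, b.val = 1))
        ∨ ((∃ a ∈ e, a.val = 0) ∧ ∀ w ∈ e, w.val ≠ 0 → m ≤ w.val))),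
    fun e he => ((Finset.mem_filter.mp he).2).1⟩

/-- `Δ*(t)G`: the `(r-1)`-graph of `t`-heavy `(r-1)`-sets, i.e. the `(r-1)`-element
vertex sets contained in at least `t` hyperedges of `G`. -/
noncomputable def shadowOp {V : Type*} [Fintype V] [DecidableEq V] {r : ℕ} (t : ℕ)
    (G : HyperGraph V r) : HyperGraph V (r - 1) :=
  ⟨Finset.univ.filter (fun A : Finset V =>
      A.card = r - 1 ∧ t ≤ (G.edges.filter (fun e => A ⊆ e)).card),
    fun A hA => ((Finset.mem_filter.mp hA).2).1⟩

/-- Iterated shadow operator: `iterShadow t G j = (Δ*(t))^j G`, a `(r-j)`-graph. -/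
noncomputable def iterShadow {V : Type*} [Fintype V] [DecidableEq V] (t : ℕ) {r : ℕ}
    (G : HyperGraph V r) : (j : ℕ) → HyperGraph V (r - j)
  | 0 => G
  | j + 1 => shadowOp t (iterShadow t G j)

/-- A vertex set `A` is `t`-fat with respect to `G`: there are at least `t` hyperedges
of `G` whose pairwise intersections all equal `A`. -/
def TFat {V : Type*} [DecidableEq V] {r : ℕ} (t : ℕ) (G : HyperGraph V r)
    (A : Finset V) : Prop :=
  ∃ E : Finset (Finset V), E ⊆ G.edges ∧ t ≤ E.card ∧
    ∀ e ∈ E, ∀ e' ∈ E, e ≠ e' → e ∩ e' = A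

/-- The graph `G(𝒢)` of `t`-fat pairs of the `r`-graph `G`. -/
def fatGraph {V : Type*} [DecidableEq V] {r : ℕ} (t : ℕ) (G : HyperGraph V r) :
    SimpleGraph V :=
  SimpleGraph.fromRel (fun x y => TFat t G {x, y})

/-- The `i`-graph whose hyperedges are the `t`-fat `i`-element vertex sets of `G`. -/
noncomputable def fatHyper {V : Type*} [Fintype V] [DecidableEq V] {r : ℕ} (t i : ℕ)
    (G : HyperGraph V r) : HyperGraph V i :=
  ⟨Finset.univ.filter (fun A : Finset V => A.card = i ∧ TFat t G A),
    fun A hA => ((Finset.mem_filter.mp hA).2).1⟩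

/-- The `r`-graph whose hyperedges are the vertex sets of the `r`-cliques of `G`. -/
noncomputable def cliqueHyper {V : Type*} [Fintype V] (G : SimpleGraph V) (r : ℕ) :
    HyperGraph V r :=
  ⟨Finset.univ.filter (fun e : Finset V => G.IsNClique r e),
    fun e he => ((Finset.mem_filter.mp he).2).card_eq⟩

/-- The `r`-graph on `n` vertices whose hyperedges are all `r`-sets containing the
fixed vertex `0`. -/
noncomputable def starHyper (n r : ℕ) : HyperGraph (Fin n) r :=
  ⟨Finset.univ.filter (fun e : Finset (Fin n) => e.card = r ∧ ∃ a ∈ e, a.val = 0),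
    fun e he => ((Finset.mem_filter.mp he).2).1⟩

/-- `σ(F)`: the minimum size of a color class over all proper `(k+1)`-colorings of `F`. -/
noncomputable def sigmaF {α : Type*} (F : SimpleGraph α) (k : ℕ) : ℕ :=
  sInf {m | ∃ c : α → Fin (k + 1), (∀ a b, F.Adj a b → c a ≠ c b) ∧
    ∃ i, m = Nat.card {a // c a = i}}

/-- The number of neighbors of `v` (in the graph `G`) lying in the part `i` of the
partition `P`. -/
noncomputable def nbrCount {n k : ℕ} (G : SimpleGraph (Fin n)) (P : Fin n → Fin k)
    (v : Fin n) (i : Fin k) : ℕ :=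
  (Finset.univ.filter (fun w => G.Adj v w ∧ P w = i)).card

/-- The size of the part `i` of the partition `P`. -/
noncomputable def partSize {n k : ℕ} (P : Fin n → Fin k) (i : Fin k) : ℕ :=
  (Finset.univ.filter (fun v => P v = i)).card

/-- Every copy (in the graph `G`) of a member of the decomposition family `D(F)` that lies
inside a single part of the partition `P` has at least two vertices in `B`. -/
def DecompInB {α : Type*} {n k : ℕ} (F : SimpleGraph α) (G : SimpleGraph (Fin n))
    (P : Fin n → Fin k) (B : Finset (Fin n)) : Prop :=
  ∀ c : α → Fin (k + 1), (∀ a b, F.Adj a b → c a ≠ c b) →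
    ∀ i j : Fin (k + 1), i ≠ j →
      ∀ ψ : {a : α // c a = i ∨ c a = j} ↪ Fin n,
        (∀ a b : {a : α // c a = i ∨ c a = j}, F.Adj a.1 b.1 → G.Adj (ψ a) (ψ b)) →
        (∀ a b : {a : α // c a = i ∨ c a = j}, P (ψ a) = P (ψ b)) →
        ∃ a b : {a : α // c a = i ∨ c a = j}, a ≠ b ∧ ψ a ∈ B ∧ ψ b ∈ B

/-- An ordered power-mean count: many pairs `(x, q)` in a relation force many
pairs `(x₁, …, x_t, q)` with all `(x_i, q)` related. -/
lemma sum_pow_card_ge {ι : Type*} (s : Finset ι) (f : ι → ℝ) (hf : ∀ i ∈ s, 0 ≤ f i)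
    (t : ℕ) {a : ℝ} (ha : 0 ≤ a) (h : a * s.card ≤ ∑ i ∈ s, f i) :
    a ^ t * s.card ≤ ∑ i ∈ s, f i ^ t := by
  cases t with
  | zero => simp
  | succ t =>
    rcases s.eq_empty_or_nonempty with rfl | hs
    · simp
    have hc : (0 : ℝ) < s.card := by exact_mod_cast hs.card_pos
    have := pow_sum_div_card_le_sum_pow hf t
    refine le_trans ?_ this
    rw [le_div_iff₀ (by positivity)]
    calc a ^ (t + 1) * s.card * s.card ^ t = (a * s.card) ^ (t + 1) := by ring
      _ ≤ _ := by gcongr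

/-- There are few non-injective tuples. -/
lemma card_not_injective_le (V : Type) [Fintype V] (t : ℕ) :
    (Fintype.card V) * #{x : Fin t → V | ¬ Function.Injective x} ≤
      t ^ 2 * (Fintype.card V) ^ t := by
  have key : ∀ p : Fin t × Fin t, p.1 ≠ p.2 →
      (Fintype.card V) * #{x : Fin t → V | x p.1 = x p.2} ≤ (Fintype.card V) ^ t := by
    rintro ⟨a, b⟩ hab
    rw [← Finset.card_univ (α := V), ← Finset.card_product,
      show #(univ : Finset V) ^ t = #(univ : Finset (Fin t → V)) by simp]
    refine Finset.card_le_card_of_injOn (fun p => Function.update p.2 a p.1)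
      (fun _ _ => by simp) ?_
    rintro ⟨v, x⟩ hx ⟨w, y⟩ hy hxy
    simp only [coe_product, coe_univ, coe_filter, mem_univ, true_and, Set.mem_prod,
      Set.mem_univ, Set.mem_ofPred_eq] at hx hy hxy
    have h1 : v = w := by simpa using congrFun hxy a
    have h2 : ∀ c, c ≠ a → x c = y c := fun c hc => by
      simpa [Function.update_of_ne hc] using congrFun hxy c
    refine Prod.ext h1 (funext fun c => ?_)
    by_cases hc : c = a
    · subst hc; simp only; rw [hx, hy]; exact h2 b (Ne.symm hab)
    · exact h2 c hc
  have hsub : ({x : Fin t → V | ¬ Function.Injective x} : Finset _) ⊆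
      ({p : Fin t × Fin t | p.1 ≠ p.2} : Finset _).biUnion
        fun p => {x : Fin t → V | x p.1 = x p.2} := by
    intro x hx
    simp only [mem_filter, mem_univ, true_and, Function.Injective, not_forall] at hx
    obtain ⟨a, b, h, hab⟩ := hx
    simp only [mem_biUnion, mem_filter, mem_univ, true_and]
    exact ⟨(a, b), hab, h⟩
  calc _ ≤ (Fintype.card V) * ∑ p ∈ ({p : Fin t × Fin t | p.1 ≠ p.2} : Finset _),
        #{x : Fin t → V | x p.1 = x p.2} :=
        Nat.mul_le_mul_left _ ((card_le_card hsub).trans card_biUnion_le)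
    _ ≤ ∑ p ∈ ({p : Fin t × Fin t | p.1 ≠ p.2} : Finset _), (Fintype.card V) ^ t := by
        rw [Finset.mul_sum]
        exact sum_le_sum fun p hp => key p (by simpa using hp)
    _ ≤ ∑ p : Fin t × Fin t, (Fintype.card V) ^ t :=
        sum_le_sum_of_subset (subset_univ _)
    _ = _ := by simp [sq]

/-- Erdős: a `p`-ary relation with a positive density of tuples contains a complete
`p`-partite relation with parts of size `t`. -/
theorem exists_complete_partite (t p : ℕ) : ∀ η : ℝ, 0 < η → ∃ n₀ : ℕ, ∀ (V : Type) [Fintype V],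
    n₀ ≤ Fintype.card V → ∀ R : Finset (Fin p → V), η * (Fintype.card V : ℝ) ^ p ≤ R.card →
    ∃ f : Fin p → Fin t → V, (∀ i, Function.Injective (f i)) ∧
      ∀ g : Fin p → Fin t, (fun i => f i (g i)) ∈ R := by
  induction p with
  | zero =>
    intro η hη
    refine ⟨0, fun V _ _ R hR => ⟨fun i => i.elim0, fun i => i.elim0, fun g => ?_⟩⟩
    have : 0 < (R.card : ℝ) := lt_of_lt_of_le (by simpa using hη) hR
    obtain ⟨q, hq⟩ := card_pos.mp (by exact_mod_cast this)
    convert hq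
  | succ p ih =>
    intro η hη
    obtain ⟨n₁, hn₁⟩ := ih (η ^ t / 2) (by positivity)
    obtain ⟨n₂, hn₂⟩ := exists_nat_gt (2 * t ^ 2 / η ^ t)
    refine ⟨max n₁ (n₂ + 1), fun V _ hV R hR => ?_⟩
    have hV1 : n₁ ≤ Fintype.card V := (le_max_left _ _).trans hV
    have hV2 : n₂ + 1 ≤ Fintype.card V := (le_max_right _ _).trans hV
    set n := Fintype.card V with hn
    have hn0 : (0 : ℝ) < n := by exact_mod_cast (by omega : 0 < n)
    let deg : (Fin p → V) → Finset V := fun q => {x | Fin.cons x q ∈ R}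
    have hdeg : ∑ q, ((deg q).card : ℝ) = R.card := by
      have : R.card = ∑ q : Fin p → V, (deg q).card := by
        rw [Finset.card_eq_sum_card_fiberwise (f := fun r : Fin (p + 1) → V => Fin.tail r)
          (t := univ) (fun _ _ => by simp)]
        refine sum_congr rfl fun q _ => ?_
        refine card_bij' (fun r _ => r 0) (fun x _ => Fin.cons x q) ?_ ?_ ?_ ?_
        · intro r hr
          simp only [mem_filter] at hr
          simp only [deg, mem_filter, mem_univ, true_and, ← hr.2, Fin.cons_self_tail]
          exact hr.1
        · intro x hx
          simp only [deg, mem_filter, mem_univ, true_and] at hx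
          simp [hx]
        · intro r hr
          simp only [mem_filter] at hr
          simp [← hr.2]
        · intro x hx; simp
      rw [this]; push_cast; rfl
    have hpow := sum_pow_card_ge (univ : Finset (Fin p → V)) (fun q => ((deg q).card : ℝ))
      (fun _ _ => by positivity) t (a := η * n) (by positivity) (by
        rw [hdeg]; refine le_trans (le_of_eq ?_) hR
        simp [← hn]; ring)
    let com : (Fin t → V) → Finset (Fin p → V) := fun x => {q | ∀ i, Fin.cons (x i) q ∈ R}
    have hcom : ∑ q, ((deg q).card : ℝ) ^ t = ∑ x : Fin t → V, ((com x).card : ℝ) := by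
      have h1 : ∀ q, (deg q).card ^ t = #{x : Fin t → V | ∀ i, x i ∈ deg q} := by
        intro q
        have : ({x : Fin t → V | ∀ i, x i ∈ deg q} : Finset _) =
            Fintype.piFinset fun _ => deg q := by ext x; simp
        rw [this]; simp
      have h2 := Finset.sum_card_bipartiteAbove_eq_sum_card_bipartiteBelow
        (s := (univ : Finset (Fin p → V))) (t := (univ : Finset (Fin t → V)))
        (fun q x => ∀ i, x i ∈ deg q)
      have h3 : ∑ q, (deg q).card ^ t = ∑ x : Fin t → V, (com x).card := by
        simp only [h1]
        refine h2.trans (sum_congr rfl fun x _ => ?_)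
        simp [bipartiteBelow, com, deg]
      exact_mod_cast h3
    by_contra hcon
    have hsmall : ∀ x : Fin t → V, Function.Injective x →
        ((com x).card : ℝ) ≤ η ^ t / 2 * (n : ℝ) ^ p := by
      intro x hx
      by_contra hlt
      obtain ⟨f, hf, hfR⟩ := hn₁ V hV1 (com x) (not_le.mp hlt).le
      refine hcon ⟨Fin.cons x f, ?_, fun g => ?_⟩
      · intro i
        refine Fin.cases ?_ (fun j => ?_) i
        · simpa using hx
        · simpa using hf j
      · have := hfR (Fin.tail g)
        simp only [com, mem_filter, mem_univ, true_and] at this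
        convert this (g 0) using 1
        funext i
        refine Fin.cases ?_ (fun j => ?_) i <;> simp [Fin.tail]
    have hbig : ∀ x : Fin t → V, ((com x).card : ℝ) ≤ (n : ℝ) ^ p := by
      intro x
      have : (com x).card ≤ n ^ p := by
        refine (card_le_univ _).trans ?_
        simp [hn]
      exact_mod_cast this
    have hni : (n : ℝ) * (#{x : Fin t → V | ¬ Function.Injective x} : ℝ) ≤ t ^ 2 * n ^ t := by
      exact_mod_cast card_not_injective_le V t
    have hsplit : ∑ x : Fin t → V, ((com x).card : ℝ) ≤
        (n : ℝ) ^ t * (η ^ t / 2 * (n : ℝ) ^ p) +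
          #{x : Fin t → V | ¬ Function.Injective x} * (n : ℝ) ^ p := by
      rw [← Finset.sum_filter_add_sum_filter_not univ (fun x : Fin t → V => Function.Injective x)]
      refine add_le_add ?_ ?_
      · refine (sum_le_card_nsmul _ _ _ fun x hx => hsmall x (by simpa using hx)).trans ?_
        rw [nsmul_eq_mul]
        gcongr
        have : #{x : Fin t → V | Function.Injective x} ≤ n ^ t := by
          refine (card_le_univ _).trans ?_
          simp [hn]
        exact_mod_cast this
      · refine (sum_le_card_nsmul _ _ _ fun x _ => hbig x).trans ?_
        rw [nsmul_eq_mul]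
    rw [hcom] at hpow
    have h4 := hpow.trans hsplit
    have hcard : ((univ : Finset (Fin p → V)).card : ℝ) = (n : ℝ) ^ p := by simp [hn]
    rw [hcard, mul_pow] at h4
    have hnp : (0 : ℝ) < (n : ℝ) ^ p := by positivity
    have hnt : (0 : ℝ) < (n : ℝ) ^ t := by positivity
    have h5 : η ^ t * (n : ℝ) ^ t ≤ (n : ℝ) ^ t * (η ^ t / 2) +
        #{x : Fin t → V | ¬ Function.Injective x} := by
      refine le_of_mul_le_mul_right ?_ hnp
      linarith
    have h6 : (n : ℝ) * (η ^ t / 2 * n ^ t) ≤ t ^ 2 * n ^ t := by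
      refine le_trans ?_ hni
      gcongr
      linarith
    have h7 : (n : ℝ) * (η ^ t / 2) ≤ t ^ 2 := by
      refine le_of_mul_le_mul_right ?_ hnt
      linarith
    have h8 : 2 * (t : ℝ) ^ 2 / η ^ t < n := by
      refine hn₂.trans ?_
      exact_mod_cast (by omega : n₂ < n)
    rw [div_lt_iff₀ (by positivity)] at h8
    linarith

/-- The ordered `m`-cliques of `H`. -/
noncomputable def cliqueTuples {V : Type} [Fintype V] (H : SimpleGraph V) (m : ℕ) :
    Finset (Fin m → V) :=
  {q | ∀ a b, a ≠ b → H.Adj (q a) (q b)}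

/-- The common neighbourhood of a tuple of vertices. -/
noncomputable def extSet {V : Type} [Fintype V] (H : SimpleGraph V) {m : ℕ} (R : Fin m → V) :
    Finset V :=
  {y | ∀ a, H.Adj y (R a)}

section
variable {V : Type} [Fintype V] (H : SimpleGraph V)

lemma insertNth_mem_cliqueTuples {m : ℕ} (j : Fin (m + 1)) (x : V) (R : Fin m → V) :
    (Fin.insertNth j x R : Fin (m + 1) → V) ∈ cliqueTuples H (m + 1) ↔
      R ∈ cliqueTuples H m ∧ x ∈ extSet H R := by
  simp only [cliqueTuples, extSet, mem_filter, mem_univ, true_and]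
  constructor
  · intro h
    refine ⟨fun a b hab => ?_, fun a => ?_⟩
    · simpa using h (j.succAbove a) (j.succAbove b) (by simpa using hab)
    · simpa using h j (j.succAbove a) (Fin.succAbove_ne j a).symm
  · rintro ⟨h1, h2⟩ a b
    refine Fin.succAboveCases j ?_ (fun a' => ?_) a <;>
      refine Fin.succAboveCases j ?_ (fun b' => ?_) b
    · simp
    · intro _; simpa using h2 b'
    · intro _; simpa using (h2 a').symm
    · intro h; simpa using h1 a' b' (by rintro rfl; exact h rfl)

lemma sum_cliqueTuples_succ {m : ℕ} (j : Fin (m + 1)) (f : (Fin m → V) → V → ℝ) :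
    ∑ A ∈ cliqueTuples H (m + 1), f (j.removeNth A) (A j) =
      ∑ R ∈ cliqueTuples H m, ∑ x ∈ extSet H R, f R x := by
  rw [Finset.sum_sigma']
  refine sum_bij' (fun A _ => ⟨j.removeNth A, A j⟩) (fun p _ => j.insertNth p.2 p.1) ?_ ?_ ?_ ?_ ?_
  · intro A hA
    rw [← Fin.insertNth_self_removeNth j A, insertNth_mem_cliqueTuples] at hA
    simpa using hA
  · rintro ⟨R, x⟩ h
    rw [insertNth_mem_cliqueTuples]
    simpa using h
  · intro A _; simp
  · rintro ⟨R, x⟩ _; simp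
  · intro A _; rfl

lemma sum_card_extSet (m : ℕ) :
    ∑ R ∈ cliqueTuples H m, ((extSet H R).card : ℝ) = (cliqueTuples H (m + 1)).card := by
  have := sum_cliqueTuples_succ H (0 : Fin (m + 1)) (fun _ _ => 1)
  simpa using this.symm

lemma mem_extSet_of_two {m : ℕ} {A : Fin (m + 1) → V} {i j : Fin (m + 1)} (hij : i ≠ j) {y : V}
    (hi : y ∈ extSet H (i.removeNth A)) (hj : y ∈ extSet H (j.removeNth A)) :
    y ∈ extSet H A := by
  simp only [extSet, mem_filter, mem_univ, true_and] at hi hj ⊢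
  intro a
  by_cases ha : a = i
  · obtain ⟨b, hb⟩ := Fin.exists_succAbove_eq (x := a) (y := j) (by rw [ha]; exact hij)
    rw [← hb]; exact hj b
  · obtain ⟨b, hb⟩ := Fin.exists_succAbove_eq (x := a) (y := i) ha
    rw [← hb]; exact hi b

lemma sum_card_extSet_removeNth_le {m : ℕ} (A : Fin (m + 1) → V) :
    ∑ j : Fin (m + 1), ((extSet H (j.removeNth A)).card : ℝ) ≤ Fintype.card V + m * (extSet H A).card := by
  have h1 : ∑ j : Fin (m + 1), (extSet H (j.removeNth A)).card =
      ∑ y : V, #{j : Fin (m + 1) | y ∈ extSet H (j.removeNth A)} := by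
    have := Finset.sum_card_bipartiteAbove_eq_sum_card_bipartiteBelow
      (s := (univ : Finset (Fin (m + 1)))) (t := (univ : Finset V))
      (fun j y => y ∈ extSet H (j.removeNth A))
    simpa [bipartiteAbove, bipartiteBelow] using this
  have h2 : ∀ y : V, #{j : Fin (m + 1) | y ∈ extSet H (j.removeNth A)} ≤
      1 + if y ∈ extSet H A then m else 0 := by
    intro y
    split_ifs with hy
    · refine (card_le_univ _).trans ?_
      simp [add_comm]
    · rw [add_zero, card_le_one]
      intro a ha b hb
      by_contra hab
      exact hy (mem_extSet_of_two H hab (by simpa using ha) (by simpa using hb))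
  have h3 : ∑ j : Fin (m + 1), (extSet H (j.removeNth A)).card ≤ Fintype.card V + m * (extSet H A).card := by
    rw [h1]
    refine (sum_le_sum fun y _ => h2 y).trans ?_
    rw [sum_add_distrib, ← sum_filter]
    simp [mul_comm]
  exact_mod_cast h3

/-- The Moon–Moser inequality for ordered cliques. -/
theorem moon_moser (m : ℕ) :
    (m + 1) * ∑ R ∈ cliqueTuples H m, ((extSet H R).card : ℝ) ^ 2 ≤
      Fintype.card V * (cliqueTuples H (m + 1)).card + m * (cliqueTuples H (m + 2)).card := by
  have h1 : ∀ j : Fin (m + 1), ∑ A ∈ cliqueTuples H (m + 1), ((extSet H (j.removeNth A)).card : ℝ)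
      = ∑ R ∈ cliqueTuples H m, ((extSet H R).card : ℝ) ^ 2 := by
    intro j
    rw [sum_cliqueTuples_succ H j (fun R _ => ((extSet H R).card : ℝ))]
    simp [sq]
  calc _ = ∑ j : Fin (m + 1), ∑ A ∈ cliqueTuples H (m + 1),
        ((extSet H (j.removeNth A)).card : ℝ) := by simp [h1]
    _ = ∑ A ∈ cliqueTuples H (m + 1), ∑ j : Fin (m + 1), ((extSet H (j.removeNth A)).card : ℝ) := sum_comm
    _ ≤ ∑ A ∈ cliqueTuples H (m + 1), ((Fintype.card V : ℝ) + m * (extSet H A).card) :=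
        sum_le_sum fun A _ => sum_card_extSet_removeNth_le H A
    _ = _ := by
        rw [sum_add_distrib, ← mul_sum, sum_card_extSet]
        simp [mul_comm]

/-- The surplus of ordered `(m+1)`-cliques over the value predicted from the `m`-cliques by
the Turán graph with `k` parts. -/
noncomputable def cliqueSurplus (k m : ℕ) : ℝ :=
  (cliqueTuples H (m + 1)).card -
    ((k : ℝ) - m) / k * Fintype.card V * (cliqueTuples H m).card

lemma sum_sq_extSet_sub (m : ℕ) (c : ℝ) :
    ∑ R ∈ cliqueTuples H m, (((extSet H R).card : ℝ) - c) ^ 2 =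
      ∑ R ∈ cliqueTuples H m, ((extSet H R).card : ℝ) ^ 2
        - 2 * c * (cliqueTuples H (m + 1)).card + c ^ 2 * (cliqueTuples H m).card := by
  have h : ∀ R ∈ cliqueTuples H m, (((extSet H R).card : ℝ) - c) ^ 2 =
      ((extSet H R).card : ℝ) ^ 2 - 2 * c * (extSet H R).card + c ^ 2 := fun R _ => by ring
  rw [sum_congr rfl h, sum_add_distrib, sum_sub_distrib, ← mul_sum, sum_card_extSet, sum_const,
    nsmul_eq_mul, mul_comm (c ^ 2)]

lemma cliqueSurplus_succ {k : ℕ} (hk : 0 < k) (m : ℕ) :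
    (m + 1) * (((k : ℝ) - m) / k * Fintype.card V) * cliqueSurplus H k m ≤
      m * cliqueSurplus H k (m + 1) := by
  have hk' : (k : ℝ) ≠ 0 := by positivity
  set c : ℝ := ((k : ℝ) - m) / k * Fintype.card V with hc
  have h1 := sum_sq_extSet_sub H m c
  have h2 : 0 ≤ ∑ R ∈ cliqueTuples H m, (((extSet H R).card : ℝ) - c) ^ 2 :=
    sum_nonneg fun _ _ => sq_nonneg _
  have h3 := moon_moser H m
  rw [h1] at h2
  have h4 : (m + 1) * c - Fintype.card V =
      m * (((k : ℝ) - (m + 1 : ℕ)) / k * Fintype.card V) := by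
    rw [hc]; push_cast; field_simp; ring
  unfold cliqueSurplus
  rw [← hc]
  have h5 : (0:ℝ) ≤ (m + 1) * (∑ R ∈ cliqueTuples H m, ((extSet H R).card : ℝ) ^ 2
        - 2 * c * (cliqueTuples H (m + 1)).card + c ^ 2 * (cliqueTuples H m).card) := by positivity
  have h6 : (m : ℝ) * (((k : ℝ) - (m + 1 : ℕ)) / k * Fintype.card V *
      (cliqueTuples H (m + 1)).card) = ((m + 1) * c - Fintype.card V) *
      (cliqueTuples H (m + 1)).card := by rw [h4]; ring
  rw [mul_sub (m : ℝ), h6, show m + 1 + 1 = m + 2 from rfl]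
  linarith

lemma cliqueTuples_zero : (cliqueTuples H 0).card = 1 := by
  simp [cliqueTuples]

lemma cliqueTuples_one : (cliqueTuples H 1).card = Fintype.card V := by
  have : cliqueTuples H 1 = univ := by
    ext q
    simp only [cliqueTuples, mem_filter, mem_univ, true_and, iff_true]
    exact fun a b h => absurd (Subsingleton.elim a b) h
  rw [this]; simp

lemma cliqueSurplus_le_of_lt {k i : ℕ} (hi : i < k) {ε : ℝ} (hε : 0 < ε)
    (hV : 0 < Fintype.card V)
    (h : cliqueSurplus H k i < -(i * ε) * (Fintype.card V : ℝ) ^ (i + 1)) :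
    ∀ m, 1 ≤ m → m ≤ i →
      cliqueSurplus H k m < -(m * ε) * (Fintype.card V : ℝ) ^ (m + 1) := by
  intro m hm hmi
  induction hmi using Nat.decreasingInduction with
  | self => exact h
  | of_succ m hmi ih =>
    have ih := ih (by omega)
    by_contra hcon
    push Not at hcon
    have hn : (0 : ℝ) < Fintype.card V := by exact_mod_cast hV
    have hk : (0 : ℝ) < k := by exact_mod_cast (by omega : 0 < k)
    have hmk : (m : ℝ) < k := by exact_mod_cast (by omega : m < k)
    have h1 := cliqueSurplus_succ H (k := k) (by omega) m
    have hm0 : (0 : ℝ) < m := by exact_mod_cast hm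
    set n : ℝ := (Fintype.card V : ℝ)
    have hc : ((k : ℝ) - m) / k * n ≤ n := by
      have : ((k : ℝ) - m) / k ≤ 1 := by rw [div_le_one hk]; linarith
      nlinarith
    have hc0 : 0 < ((k : ℝ) - m) / k * n := by
      have : 0 < (k : ℝ) - m := by linarith
      positivity
    have h2 : (m + 1) * (((k : ℝ) - m) / k * n) * (-(m * ε) * n ^ (m + 1)) ≤
        (m + 1) * (((k : ℝ) - m) / k * n) * cliqueSurplus H k m := by gcongr
    have h3 : (m + 1) * n * (-(m * ε) * n ^ (m + 1)) ≤
        (m + 1) * (((k : ℝ) - m) / k * n) * (-(m * ε) * n ^ (m + 1)) := by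
      have : 0 ≤ (m * ε) * n ^ (m + 1) := by positivity
      nlinarith [mul_le_mul_of_nonneg_left (mul_le_mul_of_nonneg_right hc this)
        (by positivity : (0:ℝ) ≤ m + 1)]
    have h4 : m * cliqueSurplus H k (m + 1) < m * (-((m + 1 : ℕ) * ε) * n ^ (m + 1 + 1)) := by
      gcongr
    push_cast at h4
    have : (m + 1) * n * (-(m * ε) * n ^ (m + 1)) = m * (-((m + 1) * ε) * n ^ (m + 1 + 1)) := by
      ring
    linarith

lemma cliqueSurplus_ge {k r i : ℕ} (hr : 2 ≤ r) (hri : r ≤ i + 1) (hi : i < k) {ε : ℝ} (hε : 0 < ε)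
    (hV : 0 < Fintype.card V)
    (h : (∏ a ∈ range r, ((k : ℝ) - a) / k) * (Fintype.card V : ℝ) ^ r
      - ε * (Fintype.card V : ℝ) ^ r ≤ (cliqueTuples H r).card) :
    -(i * ε) * (Fintype.card V : ℝ) ^ (i + 1) ≤ cliqueSurplus H k i := by
  by_contra hcon
  push Not at hcon
  have hlow := cliqueSurplus_le_of_lt H hi hε hV hcon
  have hn : (0 : ℝ) < Fintype.card V := by exact_mod_cast hV
  have hk : (0 : ℝ) < k := by exact_mod_cast (by omega : 0 < k)
  set n : ℝ := (Fintype.card V : ℝ) with hnd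
  have hup : ∀ m, m ≤ i → ((cliqueTuples H m).card : ℝ) ≤
      (∏ a ∈ range m, ((k : ℝ) - a) / k) * n ^ m := by
    intro m
    induction m with
    | zero => intro _; simp [cliqueTuples_zero]
    | succ m ih =>
      intro hm
      rcases Nat.eq_zero_or_pos m with rfl | hm0
      · rw [cliqueTuples_one]; simp [hk.ne', hnd]
      have ih := ih (by omega)
      have h1 := hlow m hm0 (by omega)
      unfold cliqueSurplus at h1
      have h2 : 0 ≤ (m * ε) * n ^ (m + 1) := by positivity
      have hmk : (m : ℝ) < k := by exact_mod_cast (by omega : m < k)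
      have hc0 : 0 ≤ ((k : ℝ) - m) / k * n := by
        have : 0 < (k : ℝ) - m := by linarith
        positivity
      rw [prod_range_succ, pow_succ]
      nlinarith [mul_le_mul_of_nonneg_left ih hc0]
  obtain ⟨m, rfl⟩ : ∃ m, r = m + 1 := ⟨r - 1, by omega⟩
  have h1 := hlow m (by omega) (by omega)
  have h2 := hup m (by omega)
  unfold cliqueSurplus at h1
  have hmk : (m : ℝ) < k := by exact_mod_cast (by omega : m < k)
  have hc0 : 0 ≤ ((k : ℝ) - m) / k * n := by
    have : 0 < (k : ℝ) - m := by linarith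
    positivity
  rw [prod_range_succ] at h
  have hm1 : (1 : ℝ) ≤ m := by exact_mod_cast (by omega : 1 ≤ m)
  have h3 : ε * n ^ (m + 1) ≤ m * ε * n ^ (m + 1) := by
    have : 0 ≤ ε * n ^ (m + 1) := by positivity
    nlinarith
  rw [← hnd] at h1
  have h4 := mul_le_mul_of_nonneg_left h2 hc0
  have h5 : ((k : ℝ) - m) / k * n * ((∏ a ∈ range m, ((k : ℝ) - a) / k) * n ^ m) =
    (∏ a ∈ range m, ((k : ℝ) - a) / k) * (((k : ℝ) - m) / k) * n ^ (m + 1) := by ring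
  nlinarith

lemma card_cliqueTuples_ge {k r : ℕ} (hr : 2 ≤ r) (hrk : r ≤ k) {ε : ℝ} (hε : 0 < ε)
    (hV : 0 < Fintype.card V)
    (h : (∏ a ∈ range r, ((k : ℝ) - a) / k) * (Fintype.card V : ℝ) ^ r
      - ε * (Fintype.card V : ℝ) ^ r ≤ (cliqueTuples H r).card) (j : ℕ) (hj : r + j ≤ k) :
    (1 / (k : ℝ) ^ (r + j) - (j + 1) * k * ε) * (Fintype.card V : ℝ) ^ (r + j) ≤
      (cliqueTuples H (r + j)).card := by
  have hn : (0 : ℝ) < Fintype.card V := by exact_mod_cast hV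
  have hk : (0 : ℝ) < k := by exact_mod_cast (by omega : 0 < k)
  have hk1 : (1 : ℝ) ≤ k := by exact_mod_cast (by omega : 1 ≤ k)
  set n : ℝ := (Fintype.card V : ℝ) with hnd
  induction j with
  | zero =>
    refine le_trans ?_ h
    have : 1 / (k : ℝ) ^ r ≤ ∏ a ∈ range r, ((k : ℝ) - a) / k := by
      rw [one_div, ← inv_pow, ← card_range r, ← prod_const, card_range]
      refine prod_le_prod (fun _ _ => by positivity) fun a ha => ?_
      rw [inv_eq_one_div]
      have : (a : ℝ) + 1 ≤ k := by
        exact_mod_cast (by have := mem_range.mp ha; omega : a + 1 ≤ k)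
      gcongr
      linarith
    have h2 : ε ≤ k * ε := by nlinarith
    have h3 : (1 / (k : ℝ) ^ r - k * ε) ≤ (∏ a ∈ range r, ((k : ℝ) - a) / k) - ε := by linarith
    have := mul_le_mul_of_nonneg_right h3 (by positivity : (0:ℝ) ≤ n ^ r)
    simp only [add_zero, Nat.cast_zero, zero_add, one_mul]
    linarith
  | succ j ih =>
    have ih := ih (by omega)
    have h1 := cliqueSurplus_ge H (i := r + j) hr (by omega) (by omega) hε hV h
    unfold cliqueSurplus at h1
    rw [← hnd] at h1
    have hrj : ((r + j : ℕ) : ℝ) + 1 ≤ k := by exact_mod_cast hj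
    have hc : n / k ≤ ((k : ℝ) - (r + j : ℕ)) / k * n := by
      rw [div_mul_eq_mul_div]
      gcongr
      nlinarith
    have h2 : n / k * (cliqueTuples H (r + j)).card ≤
        ((k : ℝ) - (r + j : ℕ)) / k * n * (cliqueTuples H (r + j)).card := by gcongr
    have h3 : n / k * ((1 / (k : ℝ) ^ (r + j) - (j + 1) * k * ε) * n ^ (r + j)) ≤
      n / k * (cliqueTuples H (r + j)).card := by gcongr
    have h4 : n / k * ((1 / (k : ℝ) ^ (r + j) - (j + 1) * k * ε) * n ^ (r + j)) =
      (1 / (k : ℝ) ^ (r + j + 1)) * n ^ (r + j + 1) - (j + 1) * ε * n ^ (r + j + 1) := by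
      field_simp
      ring
    have hp : 0 < ε * n ^ (r + j + 1) := by positivity
    have h5 : (j + 1) * ε * n ^ (r + j + 1) ≤ (j + 1) * k * ε * n ^ (r + j + 1) := by
      have : (0:ℝ) ≤ (j + 1) * (k - 1) := by
        have : (0:ℝ) ≤ k - 1 := by linarith
        positivity
      nlinarith
    have h6 : (r + j : ℕ) * ε * n ^ (r + j + 1) ≤ k * ε * n ^ (r + j + 1) := by
      have : ((r + j : ℕ) : ℝ) ≤ k := by linarith
      gcongr
    rw [← add_assoc]
    push_cast at *
    nlinarith

end

section
variable {V : Type} [Fintype V] (H : SimpleGraph V)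

/-- The number of ordered adjacent pairs inside a common neighbourhood. -/
noncomputable def extPairs {m : ℕ} (R : Fin m → V) : ℕ :=
  ∑ x ∈ extSet H R, #{y ∈ extSet H R | H.Adj y x}

lemma sum_extPairs (m : ℕ) :
    ∑ R ∈ cliqueTuples H m, (extPairs H R : ℝ) = (cliqueTuples H (m + 2)).card := by
  have h := sum_cliqueTuples_succ H (m := m) 0
    (fun R x => ((extSet H (Fin.insertNth 0 x R : Fin (m + 1) → V)).card : ℝ))
  simp only [Fin.insertNth_self_removeNth] at h
  rw [sum_card_extSet] at h
  rw [h]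
  refine sum_congr rfl fun R _ => ?_
  unfold extPairs
  push_cast
  refine sum_congr rfl fun x _ => ?_
  congr 2
  ext y
  simp only [extSet, mem_filter, mem_univ, true_and, Fin.insertNth_zero', Fin.forall_fin_succ,
    Fin.cons_zero, Fin.cons_succ]
  tauto

lemma sum_cliqueTuples_removeNth_le {m : ℕ} (j : Fin (m + 1)) (g : (Fin m → V) → ℝ)
    (hg : ∀ R, 0 ≤ g R) :
    ∑ A ∈ cliqueTuples H (m + 1), g (j.removeNth A) ≤
      Fintype.card V * ∑ R ∈ cliqueTuples H m, g R := by
  rw [sum_cliqueTuples_succ H j (fun R _ => g R), mul_sum]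
  refine sum_le_sum fun R _ => ?_
  rw [sum_const, nsmul_eq_mul]
  have : ((extSet H R).card : ℝ) ≤ Fintype.card V := by exact_mod_cast card_le_univ _
  exact mul_le_mul_of_nonneg_right this (hg R)

lemma sum_sq_extSet_sub_le {m : ℕ} :
    ((m : ℝ) + 1) * ∑ R ∈ cliqueTuples H m,
        (((extSet H R).card : ℝ) - Fintype.card V / ((m : ℝ) + 1)) ^ 2 ≤
      m * (cliqueTuples H (m + 2)).card - Fintype.card V * cliqueSurplus H (m + 1) m := by
  have h1 := sum_sq_extSet_sub H m (Fintype.card V / ((m : ℝ) + 1))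
  have h2 := moon_moser H m
  rw [h1]
  unfold cliqueSurplus
  have h0 : (m : ℝ) + 1 ≠ 0 := by positivity
  push_cast
  have h3 : ((m : ℝ) + 1) * (2 * (Fintype.card V / ((m : ℝ) + 1)) * (cliqueTuples H (m + 1)).card)
     = 2 * Fintype.card V * (cliqueTuples H (m + 1)).card := by field_simp
  have h4 : ((m : ℝ) + 1) * ((Fintype.card V / ((m : ℝ) + 1)) ^ 2 * (cliqueTuples H m).card)
     = Fintype.card V * (((m : ℝ) + 1 - m) / (m + 1) * Fintype.card V *
       (cliqueTuples H m).card) := by field_simp; ring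
  linarith

/-- The defect of a `k`-clique, controlling how far its common neighbourhoods are from a
balanced partition into independent sets. -/
noncomputable def cliqueCost {m : ℕ} (A : Fin (m + 1) → V) : ℝ :=
  ∑ j : Fin (m + 1), (((extSet H (j.removeNth A)).card : ℝ) - Fintype.card V / ((m : ℝ) + 1)) ^ 2
    + ∑ j : Fin (m + 1), (extPairs H (j.removeNth A) : ℝ)
    + Fintype.card V * (extSet H A).card

lemma sum_cliqueCost_le {m r : ℕ} (hr : 2 ≤ r) (hrm : r ≤ m + 1) {ε : ℝ} (hε : 0 < ε)
    (hV : 0 < Fintype.card V)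
    (hu : ((cliqueTuples H (m + 2)).card : ℝ) ≤ ε * (Fintype.card V : ℝ) ^ (m + 2))
    (h : (∏ a ∈ range r, (((m + 1 : ℕ) : ℝ) - a) / (m + 1 : ℕ)) * (Fintype.card V : ℝ) ^ r
      - ε * (Fintype.card V : ℝ) ^ r ≤ (cliqueTuples H r).card) :
    ∑ A ∈ cliqueTuples H (m + 1), cliqueCost H A ≤
      4 * (m + 1) * ε * (Fintype.card V : ℝ) ^ (m + 3) := by
  have hs := cliqueSurplus_ge H (k := m + 1) (i := m) hr hrm (by omega) hε hV h
  have hn : (0 : ℝ) < Fintype.card V := by exact_mod_cast hV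
  set n : ℝ := (Fintype.card V : ℝ) with hnd
  have h1 := sum_sq_extSet_sub_le H (m := m)
  rw [← hnd] at h1
  set S := ∑ R ∈ cliqueTuples H m, (((extSet H R).card : ℝ) - n / ((m : ℝ) + 1)) ^ 2 with hS
  set u := ((cliqueTuples H (m + 2)).card : ℝ) with hud
  unfold cliqueCost
  rw [sum_add_distrib, sum_add_distrib, sum_comm, ← mul_sum, sum_card_extSet,
    sum_comm (s := cliqueTuples H (m + 1)) (t := univ)
      (f := fun A (j : Fin (m + 1)) => (extPairs H (j.removeNth A) : ℝ))]
  have h2 : ∑ j : Fin (m + 1), ∑ A ∈ cliqueTuples H (m + 1),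
      (((extSet H (j.removeNth A)).card : ℝ) - n / ((m : ℝ) + 1)) ^ 2 ≤ (m + 1) * (n * S) := by
    refine (sum_le_card_nsmul _ _ _ fun j _ => sum_cliqueTuples_removeNth_le H j
      (fun R => (((extSet H R).card : ℝ) - n / ((m : ℝ) + 1)) ^ 2) fun R => sq_nonneg _).trans ?_
    simp [hS, hnd]
  have h3 : ∑ j : Fin (m + 1), ∑ A ∈ cliqueTuples H (m + 1),
      (extPairs H (j.removeNth A) : ℝ) ≤ (m + 1) * (n * u) := by
    refine (sum_le_card_nsmul _ _ _ fun j _ => sum_cliqueTuples_removeNth_le H j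
      (fun R => (extPairs H R : ℝ)) fun R => by positivity).trans ?_
    rw [sum_extPairs]
    simp [hud, hnd]
  rw [← hud, ← hnd]
  have h4 : n * (-(m * ε) * n ^ (m + 1)) ≤ n * cliqueSurplus H (m + 1) m := by gcongr
  have h5 : (m : ℝ) * u ≤ m * (ε * n ^ (m + 2)) := by gcongr
  have h6 : n * ((m + 1) * S) ≤ n * (2 * m * ε * n ^ (m + 2)) := by
    refine mul_le_mul_of_nonneg_left ?_ hn.le
    have : n * (-(m * ε) * n ^ (m + 1)) = - (m * ε * n ^ (m + 2)) := by ring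
    linarith
  have h7 : (m + 1) * (n * u) ≤ (m + 1) * (n * (ε * n ^ (m + 2))) := by gcongr
  have h8 : n * u ≤ n * (ε * n ^ (m + 2)) := by gcongr
  have h9 : 0 ≤ ε * n ^ (m + 3) := by positivity
  have h10 : n * (2 * m * ε * n ^ (m + 2)) = 2 * m * (ε * n ^ (m + 3)) := by ring
  have h11 : n * (ε * n ^ (m + 2)) = ε * n ^ (m + 3) := by ring
  rw [h11] at h7 h8
  have h12 : 0 ≤ m * (ε * n ^ (m + 3)) := by positivity
  nlinarith

lemma exists_partition_of_cost {m : ℕ} {A : Fin (m + 1) → V} {δ : ℝ} (hδ : 0 < δ) (hδ1 : δ ≤ 1)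
    (hV : 0 < Fintype.card V)
    (hA : cliqueCost H A ≤ δ ^ 2 * (Fintype.card V : ℝ) ^ 2) :
    ∃ P : V → Fin (m + 1),
      (∀ j, (1 / ((m : ℝ) + 1) - 2 * δ) * Fintype.card V ≤ (#{v | P v = j} : ℝ)) ∧
      (#{p : V × V | H.Adj p.1 p.2 ∧ P p.1 = P p.2} : ℝ) ≤
        5 * (m + 1) * δ * (Fintype.card V : ℝ) ^ 2 := by
  have hn : (0 : ℝ) < Fintype.card V := by exact_mod_cast hV
  set n : ℝ := (Fintype.card V : ℝ) with hnd
  let W : Fin (m + 1) → Finset V := fun j => extSet H (j.removeNth A)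
  unfold cliqueCost at hA
  rw [← hnd] at hA
  have hp1 : 0 ≤ ∑ j : Fin (m + 1), (((W j).card : ℝ) - n / ((m : ℝ) + 1)) ^ 2 :=
    sum_nonneg fun _ _ => sq_nonneg _
  have hp2 : 0 ≤ ∑ j : Fin (m + 1), (extPairs H (j.removeNth A) : ℝ) :=
    sum_nonneg fun _ _ => by positivity
  have hp3 : 0 ≤ n * (extSet H A).card := by positivity
  have hsz : ∀ j, (1 / ((m : ℝ) + 1) - δ) * n ≤ (W j).card := by
    intro j
    have h1 : (((W j).card : ℝ) - n / ((m : ℝ) + 1)) ^ 2 ≤ (δ * n) ^ 2 := by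
      refine (single_le_sum (f := fun j : Fin (m + 1) =>
        (((W j).card : ℝ) - n / ((m : ℝ) + 1)) ^ 2) (fun _ _ => sq_nonneg _)
        (mem_univ j)).trans ?_
      rw [mul_pow]; linarith
    have h2 := (abs_le_of_sq_le_sq' h1 (by positivity)).1
    have : (1 / ((m : ℝ) + 1) - δ) * n = n / ((m : ℝ) + 1) - δ * n := by ring
    linarith
  have hext : ((extSet H A).card : ℝ) ≤ δ * n := by
    have h1 : n * (extSet H A).card ≤ n * (δ ^ 2 * n) := by nlinarith
    have h2 := le_of_mul_le_mul_left h1 hn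
    have h3 : δ ^ 2 * n ≤ δ * n := by
      have : δ ^ 2 ≤ δ := by nlinarith
      gcongr
    linarith
  let P : V → Fin (m + 1) := fun y => if h : ∃ j, y ∈ W j then h.choose else 0
  have hP : ∀ y, (∃ j, y ∈ W j) → y ∈ W (P y) := by
    intro y h
    simp only [P, dif_pos h]
    exact h.choose_spec
  have hPeq : ∀ y j, y ∈ W j → y ∉ extSet H A → P y = j := by
    intro y j hy hyA
    by_contra hne
    exact hyA (mem_extSet_of_two H hne (hP y ⟨j, hy⟩) hy)
  have hsz' : ∀ j, (1 / ((m : ℝ) + 1) - 2 * δ) * n ≤ ((W j \ extSet H A).card : ℝ) := by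
    intro j
    have h1 : (W j).card ≤ (W j \ extSet H A).card + (extSet H A).card := by
      exact card_le_card_sdiff_add_card
    have h2 : ((W j).card : ℝ) ≤ (W j \ extSet H A).card + (extSet H A).card := by
      exact_mod_cast h1
    have h3 := hsz j
    nlinarith
  refine ⟨P, fun j => (hsz' j).trans ?_, ?_⟩
  · have : (W j \ extSet H A).card ≤ #{v | P v = j} := by
      refine card_le_card fun y hy => ?_
      rw [mem_sdiff] at hy
      simpa using hPeq y j hy.1 hy.2
    exact_mod_cast this
  let Z : Finset V := {y | ∀ j, y ∉ W j}
  have hZ : (Z.card : ℝ) ≤ 2 * (m + 1) * δ * n := by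
    have h1 : Z.card + ∑ j, (W j \ extSet H A).card ≤ Fintype.card V := by
      rw [← card_biUnion, ← card_union_of_disjoint]
      · exact card_le_univ _
      · rw [Finset.disjoint_left]
        intro y hy hy'
        simp only [mem_biUnion, mem_univ, true_and, mem_sdiff] at hy'
        obtain ⟨j, hj, _⟩ := hy'
        exact (by simpa [Z] using hy : ∀ j, y ∉ W j) j hj
      · intro i _ j _ hij
        rw [Function.onFun, Finset.disjoint_left]
        intro y hy hy'
        rw [mem_sdiff] at hy hy'
        exact hij ((hPeq y i hy.1 hy.2).symm.trans (hPeq y j hy'.1 hy'.2))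
    have h2 : (Z.card : ℝ) + ∑ j, ((W j \ extSet H A).card : ℝ) ≤ n := by rw [hnd]; exact_mod_cast h1
    have h3 : ((m : ℝ) + 1) * ((1 / ((m : ℝ) + 1) - 2 * δ) * n) ≤
        ∑ j, ((W j \ extSet H A).card : ℝ) := by
      have := card_nsmul_le_sum univ (fun j => ((W j \ extSet H A).card : ℝ)) _
        (fun j _ => hsz' j)
      simpa using this
    have h4 : ((m : ℝ) + 1) * ((1 / ((m : ℝ) + 1) - 2 * δ) * n) = n - 2 * (m + 1) * δ * n := by
      field_simp
    linarith
  have hsub : ({p : V × V | H.Adj p.1 p.2 ∧ P p.1 = P p.2} : Finset _) ⊆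
      (Z ×ˢ univ ∪ univ ×ˢ Z) ∪ univ.biUnion fun j =>
        (W j).biUnion fun x => ({y ∈ W j | H.Adj y x} : Finset V).image fun y => (x, y) := by
    rintro ⟨x, y⟩ hxy
    simp only [mem_filter, mem_univ, true_and] at hxy
    by_cases hx : ∃ j, x ∈ W j
    · by_cases hy : ∃ j, y ∈ W j
      · refine mem_union_right _ ?_
        simp only [mem_biUnion, mem_univ, true_and, mem_image, mem_filter]
        exact ⟨P x, x, hP x hx, y, ⟨hxy.2 ▸ hP y hy, hxy.1.symm⟩, rfl⟩
      · push Not at hy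
        refine mem_union_left _ (mem_union_right _ ?_)
        simpa [Z] using hy
    · push Not at hx
      refine mem_union_left _ (mem_union_left _ ?_)
      simpa [Z] using hx
  have hcard : #{p : V × V | H.Adj p.1 p.2 ∧ P p.1 = P p.2} ≤
      2 * (Fintype.card V * Z.card) + ∑ j : Fin (m + 1), extPairs H (j.removeNth A) := by
    refine (card_le_card hsub).trans ((card_union_le _ _).trans (Nat.add_le_add ?_ ?_))
    · refine (card_union_le _ _).trans ?_
      rw [card_product, card_product, card_univ]
      apply le_of_eq; ring
    · refine card_biUnion_le.trans (sum_le_sum fun j _ => ?_)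
      refine card_biUnion_le.trans (sum_le_sum fun x _ => card_image_le)
  have hcard' : (#{p : V × V | H.Adj p.1 p.2 ∧ P p.1 = P p.2} : ℝ) ≤
      2 * (n * Z.card) + ∑ j : Fin (m + 1), (extPairs H (j.removeNth A) : ℝ) := by
    rw [hnd]; exact_mod_cast hcard
  have h1 : n * Z.card ≤ n * (2 * (m + 1) * δ * n) := by gcongr
  have h2 : δ ^ 2 * n ^ 2 ≤ (m + 1) * δ * n ^ 2 := by
    have : δ ^ 2 ≤ (m + 1) * δ := by
      have : (0 : ℝ) ≤ m * δ := by positivity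
      nlinarith
    gcongr
  nlinarith

end

/-- Stability for cliques: a graph with few `(k+1)`-cliques and nearly as many `r`-cliques as
possible is close to the balanced complete `k`-partite graph. -/
theorem clique_stability {k r : ℕ} (hr : 2 ≤ r) (hrk : r ≤ k) {γ : ℝ} (hγ : 0 < γ) :
    ∃ ε : ℝ, 0 < ε ∧ ∀ (V : Type) [Fintype V] (H : SimpleGraph V), 0 < Fintype.card V →
      ((cliqueTuples H (k + 1)).card : ℝ) ≤ ε * (Fintype.card V : ℝ) ^ (k + 1) →
      (∏ a ∈ range r, ((k : ℝ) - a) / k) * (Fintype.card V : ℝ) ^ r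
        - ε * (Fintype.card V : ℝ) ^ r ≤ (cliqueTuples H r).card →
      ∃ P : V → Fin k, (∀ j, (1 / (k : ℝ) - γ) * Fintype.card V ≤ (#{v | P v = j} : ℝ)) ∧
        (#{p : V × V | H.Adj p.1 p.2 ∧ P p.1 = P p.2} : ℝ) ≤ γ * (Fintype.card V : ℝ) ^ 2 := by
  obtain ⟨m, rfl⟩ : ∃ m, k = m + 1 := ⟨k - 1, by omega⟩
  have hm1 : (1 : ℝ) ≤ (m : ℝ) + 1 := by
    have : (0 : ℝ) ≤ m := by positivity
    linarith
  set δ : ℝ := min γ 1 / (5 * (m + 1)) with hδd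
  have hmin : 0 < min γ 1 := lt_min hγ one_pos
  have hδ : 0 < δ := by positivity
  have hδγ : 5 * (m + 1) * δ ≤ γ := by
    rw [hδd]
    have : 5 * ((m : ℝ) + 1) * (min γ 1 / (5 * (m + 1))) = min γ 1 := by field_simp
    rw [this]; exact min_le_left _ _
  have hδ1 : δ ≤ 1 := by
    rw [hδd, div_le_one (by positivity)]
    have := min_le_right γ 1
    linarith
  have h2δ : 2 * δ ≤ γ := by nlinarith
  set K : ℝ := (m : ℝ) + 1 with hK
  refine ⟨δ ^ 2 / (8 * K ^ (m + 3)), by positivity, fun V _ H hV hu h => ?_⟩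
  set ε : ℝ := δ ^ 2 / (8 * K ^ (m + 3)) with hεd
  have hε : 0 < ε := by positivity
  have hn : (0 : ℝ) < Fintype.card V := by exact_mod_cast hV
  have hcost := sum_cliqueCost_le H hr hrk hε hV hu h
  have hcl := card_cliqueTuples_ge H hr hrk hε hV h (m + 1 - r) (by omega)
  rw [show r + (m + 1 - r) = m + 1 by omega] at hcl
  push_cast [← hK] at hcl
  set n : ℝ := (Fintype.card V : ℝ) with hnd
  have hε1 : K ^ (m + 3) * ε = δ ^ 2 / 8 := by rw [hεd]; field_simp
  have hcl2 : 1 / (2 * K ^ (m + 1)) * n ^ (m + 1) ≤ (cliqueTuples H (m + 1)).card := by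
    refine le_trans ?_ hcl
    have h1 : (((m + 1 - r : ℕ) : ℝ) + 1) ≤ K := by
      rw [hK]; exact_mod_cast (by omega : (m + 1 - r) + 1 ≤ m + 1)
    have h2 : (((m + 1 - r : ℕ) : ℝ) + 1) * K * ε ≤ K * K * ε := by gcongr
    have h3 : K * K * ε ≤ 1 / (2 * K ^ (m + 1)) := by
      rw [le_div_iff₀ (by positivity)]
      have : K * K * ε * (2 * K ^ (m + 1)) = 2 * (K ^ (m + 3) * ε) := by ring
      rw [this, hε1]
      nlinarith
    have h4 : 1 / K ^ (m + 1) = 1 / (2 * K ^ (m + 1)) + 1 / (2 * K ^ (m + 1)) := by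
      field_simp; norm_num
    gcongr
    linarith
  have hex : ∃ A ∈ cliqueTuples H (m + 1), cliqueCost H A ≤ δ ^ 2 * n ^ 2 := by
    by_contra hcon
    push Not at hcon
    have h1 := card_nsmul_le_sum (cliqueTuples H (m + 1)) (fun A => cliqueCost H A) (δ ^ 2 * n ^ 2)
      fun A hA => (hcon A hA).le
    rw [nsmul_eq_mul] at h1
    have h2 : 1 / (2 * K ^ (m + 1)) * n ^ (m + 1) * (δ ^ 2 * n ^ 2) ≤
        (cliqueTuples H (m + 1)).card * (δ ^ 2 * n ^ 2) := by gcongr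
    by_cases hK2 : K = 1
    · rw [hK] at hK2
      have : (m : ℝ) + 1 ≥ 2 := by exact_mod_cast (by omega : m + 1 ≥ 2)
      linarith
    have hK3 : 1 < K := lt_of_le_of_ne hm1 (Ne.symm hK2)
    have h3 : 1 / (2 * K ^ (m + 1)) * n ^ (m + 1) * (δ ^ 2 * n ^ 2) ≤ 4 * K * ε * n ^ (m + 3) := by
      linarith
    have h4 : 1 / (2 * K ^ (m + 1)) * n ^ (m + 1) * (δ ^ 2 * n ^ 2) =
      (δ ^ 2 / (2 * K ^ (m + 1))) * n ^ (m + 3) := by ring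
    rw [h4] at h3
    have h5 := le_of_mul_le_mul_right h3 (by positivity)
    rw [div_le_iff₀ (by positivity)] at h5
    have h6 : K * (4 * K * ε * (2 * K ^ (m + 1))) = δ ^ 2 := by
      have : K * (4 * K * ε * (2 * K ^ (m + 1))) = 8 * (K ^ (m + 3) * ε) := by ring
      rw [this, hε1]; ring
    have h7 : 0 < δ ^ 2 := by positivity
    nlinarith
  obtain ⟨A, -, hA⟩ := hex
  obtain ⟨P, hP1, hP2⟩ := exists_partition_of_cost H hδ hδ1 hV hA
  refine ⟨P, fun j => le_trans ?_ (hP1 j), hP2.trans ?_⟩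
  · push_cast
    rw [← hK]
    gcongr
  · gcongr

/-- The edge set `E` contains an expansion of `F` all of whose vertices lie in `X`. -/
def CopyIn {V β : Type} [DecidableEq V] (F : SimpleGraph β) (E : Finset (Finset V))
    (X : Finset V) : Prop :=
  ∃ (φ : β ↪ V) (S : Sym2 β → Finset V), (∀ a, φ a ∈ X) ∧ (∀ e ∈ F.edgeSet, S e ⊆ X) ∧
    (∀ e ∈ F.edgeSet, ∀ a, φ a ∉ S e) ∧
    (∀ e ∈ F.edgeSet, ∀ e' ∈ F.edgeSet, e ≠ e' → Disjoint (S e) (S e')) ∧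
    ∀ a b, F.Adj a b → insert (φ a) (insert (φ b) (S s(a, b))) ∈ E

/-- Two vertices are adjacent if every set of at most `M` other vertices is avoided by some
hyperedge containing both. -/
def heavyGraph {V : Type} (E : Finset (Finset V)) (M : ℕ) : SimpleGraph V where
  Adj x y := x ≠ y ∧ ∀ Y : Finset V, Y.card ≤ M → x ∉ Y → y ∉ Y →
    ∃ e ∈ E, x ∈ e ∧ y ∈ e ∧ Disjoint e Y
  symm.symm x y h := ⟨h.1.symm, fun Y hY hy hx => by
    obtain ⟨e, he, h1, h2, h3⟩ := h.2 Y hY hx hy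
    exact ⟨e, he, h2, h1, h3⟩⟩
  loopless.irrefl x h := h.1 rfl

/-- The complete `k`-partite graph with parts of size `t` plus one edge in the first part. -/
def turanPlusEdge (k t : ℕ) : SimpleGraph (Fin k × Fin t) where
  Adj p q := p.1 ≠ q.1 ∨
    (p ≠ q ∧ p.1.val = 0 ∧ q.1.val = 0 ∧ p.2.val < 2 ∧ q.2.val < 2)
  symm.symm p q h := by
    rcases h with h | ⟨h1, h2, h3, h4, h5⟩
    · exact Or.inl h.symm
    · exact Or.inr ⟨h1.symm, h3, h2, h5, h4⟩
  loopless.irrefl p h := by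
    rcases h with h | ⟨h, _⟩ <;> exact h rfl

section
variable {V : Type} [DecidableEq V]

lemma CopyIn.mono {β : Type} {F : SimpleGraph β} {E E' : Finset (Finset V)} {X X' : Finset V}
    (hE : E ⊆ E') (hX : X ⊆ X') (h : CopyIn F E X) : CopyIn F E' X' := by
  obtain ⟨φ, S, h1, h2, h3, h4, h5⟩ := h
  exact ⟨φ, S, fun a => hX (h1 a), fun e he => (h2 e he).trans hX, h3, h4,
    fun a b hab => hE (h5 a b hab)⟩

lemma CopyIn.filter {β : Type} {F : SimpleGraph β} {E : Finset (Finset V)} {X : Finset V}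
    (h : CopyIn F E X) : CopyIn F (E.filter (· ⊆ X)) X := by
  obtain ⟨φ, S, h1, h2, h3, h4, h5⟩ := h
  refine ⟨φ, S, h1, h2, h3, h4, fun a b hab => mem_filter.mpr ⟨h5 a b hab, ?_⟩⟩
  exact insert_subset (h1 a) (insert_subset (h1 b) (h2 _ hab))

/-- A copy lives on boundedly many vertices. -/
lemma CopyIn.exists_small {β : Type} [Fintype β] {F : SimpleGraph β} {E : Finset (Finset V)}
    {X : Finset V} {r : ℕ} (hE : ∀ e ∈ E, e.card = r) (h : CopyIn F E X) :
    ∃ X' ⊆ X, X'.card ≤ Fintype.card β + Fintype.card (Sym2 β) * r ∧ CopyIn F E X' := by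
  obtain ⟨φ, S, h1, h2, h3, h4, h5⟩ := h
  have hS : ∀ e ∈ F.edgeFinset, (S e).card ≤ r := by
    intro e he
    rw [SimpleGraph.mem_edgeFinset] at he
    induction e with | _ a b
    rw [← hE _ (h5 a b he)]
    exact card_le_card fun x hx => mem_insert_of_mem (mem_insert_of_mem hx)
  refine ⟨univ.image φ ∪ F.edgeFinset.biUnion S, ?_, ?_, φ, S, ?_, ?_, h3, h4, h5⟩
  · refine union_subset (fun x hx => ?_) (biUnion_subset.mpr fun e he => h2 e (by simpa using he))
    obtain ⟨a, -, rfl⟩ := mem_image.mp hx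
    exact h1 a
  · refine (card_union_le _ _).trans (Nat.add_le_add card_image_le ?_)
    refine card_biUnion_le.trans ((sum_le_card_nsmul _ _ _ hS).trans ?_)
    rw [smul_eq_mul]
    exact Nat.mul_le_mul_right _ (card_le_univ _)
  · intro a; exact mem_union_left _ (mem_image_of_mem _ (mem_univ _))
  · intro e he
    exact (subset_biUnion_of_mem S (by simpa using he)).trans subset_union_right

lemma exists_disjoint_choice {ι : Type} (I : Finset ι) (Q : ι → Finset V → Prop) (r M : ℕ)
    (B : Finset V) (hM : B.card + I.card * r ≤ M)
    (h : ∀ i ∈ I, ∀ Y : Finset V, B ⊆ Y → Y.card ≤ M → ∃ T, T.card ≤ r ∧ Disjoint T Y ∧ Q i T) :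
    ∃ S : ι → Finset V, (∀ i ∈ I, Q i (S i) ∧ (S i).card ≤ r ∧ Disjoint (S i) B) ∧
      ∀ i ∈ I, ∀ j ∈ I, i ≠ j → Disjoint (S i) (S j) := by
  induction I using Finset.induction_on with
  | empty => exact ⟨fun _ => ∅, by simp, by simp⟩
  | insert i I hi ih =>
    rw [card_insert_of_notMem hi, add_mul, one_mul] at hM
    obtain ⟨S, hS1, hS2⟩ := ih (by omega) fun j hj => h j (mem_insert_of_mem hj)
    have hY : (B ∪ I.biUnion S).card ≤ M := by
      refine (card_union_le _ _).trans ?_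
      have : (I.biUnion S).card ≤ I.card * r :=
        card_biUnion_le.trans ((sum_le_card_nsmul _ _ _ fun j hj => (hS1 j hj).2.1))
      omega
    obtain ⟨T, hT1, hT2, hT3⟩ := h i (mem_insert_self _ _) _ subset_union_left hY
    rw [disjoint_union_right, disjoint_biUnion_right] at hT2
    have hne : ∀ j ∈ I, j ≠ i := fun j hj hji => hi (hji ▸ hj)
    refine ⟨Function.update S i T, ?_, ?_⟩
    · intro j hj
      rcases mem_insert.mp hj with rfl | hj
      · simpa using ⟨hT3, hT1, hT2.1⟩
      · rw [Function.update_of_ne (hne j hj)]; exact hS1 j hj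
    · intro a ha b hb hab
      rcases mem_insert.mp ha with ha' | ha' <;> rcases mem_insert.mp hb with hb' | hb'
      · exact absurd (ha'.trans hb'.symm) hab
      · rw [ha', Function.update_self, Function.update_of_ne (hne b hb')]; exact hT2.2 b hb'
      · rw [hb', Function.update_self, Function.update_of_ne (hne a ha')]
        exact (hT2.2 a ha').symm
      · rw [Function.update_of_ne (hne a ha'), Function.update_of_ne (hne b hb')]
        exact hS2 a ha' b hb' hab

lemma insert_insert_sdiff_pair {x y : V} {e : Finset V} (hx : x ∈ e) (hy : y ∈ e) :
    insert x (insert y (e \ {x, y})) = e := by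
  ext z
  simp only [mem_insert, mem_sdiff, mem_singleton]
  constructor
  · rintro (rfl | rfl | h)
    exacts [hx, hy, h.1]
  · tauto

/-- An embedding of `F` whose edges are heavy, except possibly for one edge lying in a
hyperedge avoiding the rest of the embedding, extends to a copy of the expansion. -/
lemma copyIn_of_heavy [Fintype V] {β : Type} [Fintype β] {F : SimpleGraph β}
    {E : Finset (Finset V)} {r M : ℕ}
    (hE : ∀ e ∈ E, e.card = r) (hM : Fintype.card β + r + Fintype.card (Sym2 β) * r ≤ M)
    (φ : β ↪ V) {a₀ b₀ : β} {f₀ : Finset V} (hf₀ : f₀ ∈ E) (ha₀ : φ a₀ ∈ f₀) (hb₀ : φ b₀ ∈ f₀)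
    (hc : ∀ c, φ c ∈ f₀ → c = a₀ ∨ c = b₀)
    (h : ∀ a b, F.Adj a b → s(a, b) ≠ s(a₀, b₀) → (heavyGraph E M).Adj (φ a) (φ b)) :
    CopyIn F E univ := by
  set B : Finset V := univ.image φ ∪ f₀ with hB
  have hM' : B.card + (F.edgeFinset.erase s(a₀, b₀)).card * r ≤ M := by
    have h1 : B.card ≤ Fintype.card β + r := by
      refine (card_union_le _ _).trans (Nat.add_le_add card_image_le (hE _ hf₀).le)
    have h2 : (F.edgeFinset.erase s(a₀, b₀)).card * r ≤ Fintype.card (Sym2 β) * r :=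
      Nat.mul_le_mul_right _ (card_le_univ _)
    omega
  obtain ⟨S, hS1, hS2⟩ := exists_disjoint_choice (F.edgeFinset.erase s(a₀, b₀))
    (fun e T => ∀ a b, e = s(a, b) → insert (φ a) (insert (φ b) T) ∈ E) r M B hM' (by
      intro e he Y hBY hY
      rw [mem_erase, SimpleGraph.mem_edgeFinset] at he
      induction e with | _ a b
      have hadj := h a b he.2 he.1
      obtain ⟨f, hf, h1, h2, h3⟩ := hadj.2 (Y \ {φ a, φ b}) ((card_le_card sdiff_subset).trans hY)
        (by simp) (by simp)
      refine ⟨f \ {φ a, φ b}, (card_le_card sdiff_subset).trans (hE f hf).le, ?_, ?_⟩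
      · rw [Finset.disjoint_left] at h3 ⊢
        intro x hx hxY
        rw [mem_sdiff] at hx
        exact h3 hx.1 (mem_sdiff.mpr ⟨hxY, hx.2⟩)
      · intro a' b' hab
        rcases Sym2.eq_iff.mp hab with ⟨rfl, rfl⟩ | ⟨rfl, rfl⟩
        · rwa [insert_insert_sdiff_pair h1 h2]
        · rwa [Finset.pair_comm, insert_insert_sdiff_pair h2 h1])
  refine ⟨φ, Function.update S s(a₀, b₀) (f₀ \ {φ a₀, φ b₀}), by simp, by simp, ?_, ?_, ?_⟩
  · intro e he a
    by_cases h0 : e = s(a₀, b₀)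
    · subst h0
      rw [Function.update_self]
      intro hmem
      rw [mem_sdiff] at hmem
      rcases hc a hmem.1 with rfl | rfl
      · exact hmem.2 (by simp)
      · exact hmem.2 (by simp)
    · rw [Function.update_of_ne h0]
      intro hmem
      refine Finset.disjoint_left.mp (hS1 e (mem_erase.mpr ⟨h0, by simpa using he⟩)).2.2 hmem ?_
      exact mem_union_left _ (mem_image_of_mem _ (mem_univ _))
  · intro e he e' he' hne
    by_cases h0 : e = s(a₀, b₀)
    · have h0' : e' ≠ s(a₀, b₀) := fun h' => hne (h0.trans h'.symm)
      rw [h0, Function.update_self, Function.update_of_ne h0']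
      refine (hS1 e' (mem_erase.mpr ⟨h0', by simpa using he'⟩)).2.2.symm.mono_left ?_
      exact sdiff_subset.trans subset_union_right
    · by_cases h0' : e' = s(a₀, b₀)
      · rw [h0', Function.update_self, Function.update_of_ne h0]
        refine (hS1 e (mem_erase.mpr ⟨h0, by simpa using he⟩)).2.2.mono_right ?_
        exact sdiff_subset.trans subset_union_right
      · rw [Function.update_of_ne h0, Function.update_of_ne h0']
        exact hS2 e (mem_erase.mpr ⟨h0, by simpa using he⟩) e'
          (mem_erase.mpr ⟨h0', by simpa using he'⟩) hne
  · intro a b hab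
    by_cases h0 : s(a, b) = s(a₀, b₀)
    · rw [h0, Function.update_self]
      rcases Sym2.eq_iff.mp h0 with ⟨rfl, rfl⟩ | ⟨rfl, rfl⟩
      · rwa [insert_insert_sdiff_pair ha₀ hb₀]
      · rwa [Finset.pair_comm, insert_insert_sdiff_pair hb₀ ha₀]
    · rw [Function.update_of_ne h0]
      exact (hS1 _ (mem_erase.mpr ⟨h0, by simpa using hab⟩)).1 a b rfl

lemma copyIn_of_forall_heavy [Fintype V] {β : Type} [Fintype β] {F : SimpleGraph β}
    {E : Finset (Finset V)} {r M : ℕ}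
    (hE : ∀ e ∈ E, e.card = r) (hM : Fintype.card β + r + Fintype.card (Sym2 β) * r ≤ M)
    (φ : β ↪ V) {a₀ b₀ : β} (h₀ : F.Adj a₀ b₀)
    (h : ∀ a b, F.Adj a b → (heavyGraph E M).Adj (φ a) (φ b)) :
    CopyIn F E univ := by
  obtain ⟨f, hf, h1, h2, h3⟩ := (h a₀ b₀ h₀).2 (univ.image φ \ {φ a₀, φ b₀})
    (((card_le_card sdiff_subset).trans card_image_le).trans (by rw [card_univ]; omega))
      (by simp) (by simp)
  refine copyIn_of_heavy hE hM φ hf h1 h2 (fun c hcf => ?_) fun a b hab _ => h a b hab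
  have := Finset.disjoint_left.mp h3 hcf
  simp only [mem_sdiff, mem_image, mem_univ, true_and, mem_insert, mem_singleton,
    EmbeddingLike.apply_eq_iff_eq, exists_eq, not_not] at this
  exact this

/-- A complete `(k+1)`-partite family of heavy cliques gives a copy. -/
lemma copyIn_of_complete_partite [Fintype V] {E : Finset (Finset V)} {k t r M : ℕ} (hk : 2 ≤ k)
    (ht : 0 < t) (hE : ∀ e ∈ E, e.card = r)
    (hM : Fintype.card (Fin k × Fin t) + r + Fintype.card (Sym2 (Fin k × Fin t)) * r ≤ M)
    (f : Fin (k + 1) → Fin t → V) (hf : ∀ i, Function.Injective (f i))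
    (hfR : ∀ g : Fin (k + 1) → Fin t, (fun i => f i (g i)) ∈
      cliqueTuples (heavyGraph E M) (k + 1)) :
    CopyIn (turanPlusEdge k t) E univ := by
  let c : Fin k × Fin t → Fin (k + 1) := fun p =>
    if p.1.val = 0 ∧ p.2.val = 1 then Fin.last k else p.1.castSucc
  have hadj : ∀ i j a b, i ≠ j → (heavyGraph E M).Adj (f i a) (f j b) := by
    intro i j a b hij
    have := hfR (Function.update (fun _ => b) i a)
    simp only [cliqueTuples, mem_filter, mem_univ, true_and] at this
    have h := this i j hij
    rwa [Function.update_self, Function.update_of_ne hij.symm] at h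
  have hc : ∀ p q : Fin k × Fin t, p.2 = q.2 → c p = c q → p = q := by
    intro p q h2 hpq
    refine Prod.ext ?_ h2
    simp only [c, h2] at hpq
    have hp := p.1.isLt
    have hq := q.1.isLt
    split_ifs at hpq with h3 h4 h4
    · exact Fin.ext (h3.1.trans h4.1.symm)
    · have := congrArg Fin.val hpq
      simp at this; omega
    · have := congrArg Fin.val hpq
      simp at this; omega
    · simpa using hpq
  let φ : Fin k × Fin t ↪ V := ⟨fun p => f (c p) p.2, fun p q hpq => by
    by_cases h : c p = c q
    · simp only [h] at hpq
      exact hc p q (hf _ hpq) h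
    · exact absurd hpq (hadj _ _ _ _ h).ne⟩
  refine copyIn_of_forall_heavy hE hM φ (a₀ := (⟨0, by omega⟩, ⟨0, ht⟩))
    (b₀ := (⟨1, by omega⟩, ⟨0, ht⟩)) (Or.inl (by simp)) fun p q hpq => hadj _ _ _ _ ?_
  intro h
  simp only [c] at h
  have hp := p.1.isLt
  have hq := q.1.isLt
  rcases hpq with hpq | ⟨h1, h2, h3, h4, h5⟩
  · have hpq' : p.1.val ≠ q.1.val := fun h' => hpq (Fin.ext h')
    split_ifs at h with h3 h4 h4
    · omega
    · have := congrArg Fin.val h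
      simp at this; omega
    · have := congrArg Fin.val h
      simp at this; omega
    · have := congrArg Fin.val h
      simp at this; omega
  · have h6 : p.2.val ≠ q.2.val := fun h' => h1 (Prod.ext (Fin.ext (h2.trans h3.symm)) (Fin.ext h'))
    split_ifs at h with h7 h8 h8
    · omega
    · have := congrArg Fin.val h
      simp at this; omega
    · have := congrArg Fin.val h
      simp at this; omega
    · omega

end

/-- The number of vertices that have to be avoided when embedding the expansion of
`turanPlusEdge k t` greedily. -/
def copySize (k t r : ℕ) : ℕ :=
  Fintype.card (Fin k × Fin t) + r + Fintype.card (Sym2 (Fin k × Fin t)) * r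

section
variable {V : Type} [DecidableEq V] [Fintype V]

lemma card_supersets_mul_le (r : ℕ) (T : Finset V) :
    #{e : Finset V | e.card = r ∧ T ⊆ e} * Fintype.card V ^ T.card ≤ Fintype.card V ^ r := by
  rcases le_or_gt T.card r with h | h
  · have h1 : #{e : Finset V | e.card = r ∧ T ⊆ e} ≤ Fintype.card V ^ (r - T.card) := by
      calc _ ≤ (powersetCard (r - T.card) (univ : Finset V)).card := by
            refine card_le_card_of_injOn (fun e => e \ T) ?_ ?_
            · intro e he
              simp only [coe_filter, mem_univ, true_and, Set.mem_ofPred_eq] at he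
              simp [mem_powersetCard, card_sdiff_of_subset he.2, he.1]
            · intro e he e' he' hee
              simp only [coe_filter, mem_univ, true_and, Set.mem_ofPred_eq] at he he' hee
              rw [← sdiff_union_of_subset he.2, ← sdiff_union_of_subset he'.2, hee]
        _ ≤ _ := by
            rw [card_powersetCard, card_univ]
            exact Nat.choose_le_pow _ _
    calc _ ≤ Fintype.card V ^ (r - T.card) * Fintype.card V ^ T.card := Nat.mul_le_mul_right _ h1
      _ = _ := by rw [← pow_add, Nat.sub_add_cancel h]
  · have : ({e : Finset V | e.card = r ∧ T ⊆ e} : Finset (Finset V)) = ∅ := by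
      rw [filter_eq_empty_iff]
      rintro e - ⟨h1, h2⟩
      have := card_le_card h2
      omega
    simp [this]

variable {E : Finset (Finset V)} {r M : ℕ}

lemma codegree_le_of_not_heavy (hE : ∀ e ∈ E, e.card = r) {x y : V} (hxy : x ≠ y)
    (h : ¬ (heavyGraph E M).Adj x y) :
    Fintype.card V ^ 3 * #{e ∈ E | x ∈ e ∧ y ∈ e} ≤ M * Fintype.card V ^ r := by
  have h' : ∃ Y : Finset V, Y.card ≤ M ∧ x ∉ Y ∧ y ∉ Y ∧
      ∀ e ∈ E, x ∈ e → y ∈ e → ¬ Disjoint e Y := by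
    by_contra hcon
    push Not at hcon
    exact h ⟨hxy, fun Y hY hx hy => hcon Y hY hx hy⟩
  obtain ⟨Y, hY, hxY, hyY, hdis⟩ := h'
  have hsub : ({e ∈ E | x ∈ e ∧ y ∈ e} : Finset _) ⊆
      Y.biUnion fun z => {e : Finset V | e.card = r ∧ {x, y, z} ⊆ e} := by
    intro e he
    rw [mem_filter] at he
    obtain ⟨z, hz, hzY⟩ := Finset.not_disjoint_iff.mp (hdis e he.1 he.2.1 he.2.2)
    simp only [mem_biUnion, mem_filter, mem_univ, true_and]
    refine ⟨z, hzY, hE e he.1, ?_⟩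
    simp [insert_subset_iff, he.2.1, he.2.2, hz]
  calc _ ≤ Fintype.card V ^ 3 * ∑ z ∈ Y, #{e : Finset V | e.card = r ∧ {x, y, z} ⊆ e} :=
        Nat.mul_le_mul_left _ ((card_le_card hsub).trans card_biUnion_le)
    _ = ∑ z ∈ Y, #{e : Finset V | e.card = r ∧ {x, y, z} ⊆ e} * Fintype.card V ^ 3 := by
        rw [mul_comm, sum_mul]
    _ ≤ ∑ z ∈ Y, Fintype.card V ^ r := by
        refine sum_le_sum fun z hz => ?_
        have h3 : ({x, y, z} : Finset V).card = 3 :=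
          card_eq_three.mpr ⟨x, y, z, hxy, fun h => hxY (h ▸ hz), fun h => hyY (h ▸ hz), rfl⟩
        have := card_supersets_mul_le r ({x, y, z} : Finset V)
        rwa [h3] at this
    _ ≤ _ := by
        rw [sum_const, smul_eq_mul]
        exact Nat.mul_le_mul_right _ hY

/-- Few hyperedges contain a pair that is not heavy. -/
lemma card_light_edges_le (hE : ∀ e ∈ E, e.card = r) :
    Fintype.card V * #{e ∈ E | ∃ x ∈ e, ∃ y ∈ e, x ≠ y ∧ ¬ (heavyGraph E M).Adj x y} ≤
      M * Fintype.card V ^ r := by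
  rcases Nat.eq_zero_or_pos (Fintype.card V) with h0 | h0
  · simp [h0]
  have hsub : ({e ∈ E | ∃ x ∈ e, ∃ y ∈ e, x ≠ y ∧ ¬ (heavyGraph E M).Adj x y} : Finset _) ⊆
      ({p : V × V | p.1 ≠ p.2 ∧ ¬ (heavyGraph E M).Adj p.1 p.2} : Finset _).biUnion
        fun p => {e ∈ E | p.1 ∈ e ∧ p.2 ∈ e} := by
    intro e he
    simp only [mem_filter] at he
    obtain ⟨he, x, hx, y, hy, h⟩ := he
    simp only [mem_biUnion, mem_filter, mem_univ, true_and]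
    exact ⟨(x, y), h, he, hx, hy⟩
  have h1 : Fintype.card V ^ 3 *
      #{e ∈ E | ∃ x ∈ e, ∃ y ∈ e, x ≠ y ∧ ¬ (heavyGraph E M).Adj x y} ≤
      Fintype.card V ^ 2 * (M * Fintype.card V ^ r) := by
    calc _ ≤ Fintype.card V ^ 3 *
          ∑ p ∈ ({p : V × V | p.1 ≠ p.2 ∧ ¬ (heavyGraph E M).Adj p.1 p.2} : Finset _),
            #{e ∈ E | p.1 ∈ e ∧ p.2 ∈ e} :=
          Nat.mul_le_mul_left _ ((card_le_card hsub).trans card_biUnion_le)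
      _ ≤ ∑ p ∈ ({p : V × V | p.1 ≠ p.2 ∧ ¬ (heavyGraph E M).Adj p.1 p.2} : Finset _),
            M * Fintype.card V ^ r := by
          rw [mul_sum]
          refine sum_le_sum fun p hp => ?_
          simp only [mem_filter, mem_univ, true_and] at hp
          exact codegree_le_of_not_heavy hE hp.1 hp.2
      _ ≤ _ := by
          rw [sum_const, smul_eq_mul]
          refine Nat.mul_le_mul_right _ ((card_le_univ _).trans ?_)
          rw [Fintype.card_prod, sq]
  refine Nat.le_of_mul_le_mul_left ?_ (pow_pos h0 2)
  calc _ = _ := by ring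
    _ ≤ _ := h1

lemma factorial_mul_card_le (H : SimpleGraph V) (hE : ∀ e ∈ E, e.card = r)
    (hH : ∀ e ∈ E, ∀ x ∈ e, ∀ y ∈ e, x ≠ y → H.Adj x y) :
    r.factorial * E.card ≤ (cliqueTuples H r).card := by
  have hq : ∀ e ∈ E, ∃ q : Fin r → V, Function.Injective q ∧ univ.image q = e := by
    intro e he
    let g := e.equivFinOfCardEq (hE e he)
    refine ⟨fun i => (g.symm i : V), Subtype.val_injective.comp g.symm.injective, ?_⟩
    ext x
    simp only [mem_image, mem_univ, true_and]
    constructor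
    · rintro ⟨i, rfl⟩; exact (g.symm i).2
    · intro hx; exact ⟨g ⟨x, hx⟩, by simp⟩
  choose q hq1 hq2 using hq
  calc r.factorial * E.card = ((univ : Finset (Equiv.Perm (Fin r))) ×ˢ E.attach).card := by
        rw [card_product, card_univ, Fintype.card_perm, Fintype.card_fin, card_attach]
    _ ≤ _ := by
        refine card_le_card_of_injOn (fun p => q p.2.1 p.2.2 ∘ p.1) ?_ ?_
        · rintro ⟨σ, e, he⟩ -
          simp only [cliqueTuples, coe_filter, mem_univ, true_and, Set.mem_ofPred_eq,
            Function.comp]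
          intro a b hab
          refine hH e he _ ?_ _ ?_ fun h => hab (σ.injective (hq1 e he h))
          · exact (hq2 e he).subset (mem_image_of_mem _ (mem_univ _))
          · exact (hq2 e he).subset (mem_image_of_mem _ (mem_univ _))
        · rintro ⟨σ, e, he⟩ - ⟨τ, e', he'⟩ - h
          simp only at h
          have h1 : ∀ (e : Finset V) (he : e ∈ E) (σ : Equiv.Perm (Fin r)),
              univ.image (q e he ∘ σ) = e := by
            intro e he σ
            conv_rhs => rw [← hq2 e he]
            rw [← image_image]
            congr 1
            exact image_univ_of_surjective σ.surjective
          have h2 : e = e' := by rw [← h1 e he σ, h, h1]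
          subst h2
          refine Prod.ext (Equiv.ext fun i => hq1 e he (congrFun h i)) rfl

/-- A hypergraph without the basic configuration has few heavy `(k+1)`-cliques. -/
lemma card_heavy_cliques_le {k t r : ℕ} (hk : 2 ≤ k) (ht : 0 < t) {η : ℝ} (hη : 0 < η) :
    ∃ n₀ : ℕ, ∀ (V : Type) [DecidableEq V] [Fintype V] (E : Finset (Finset V)),
      n₀ ≤ Fintype.card V → (∀ e ∈ E, e.card = r) → ¬ CopyIn (turanPlusEdge k t) E univ →
      ((cliqueTuples (heavyGraph E (copySize k t r)) (k + 1)).card : ℝ) ≤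
        η * (Fintype.card V : ℝ) ^ (k + 1) := by
  obtain ⟨n₀, hn₀⟩ := exists_complete_partite t (k + 1) η hη
  refine ⟨n₀, fun V _ _ E hV hE hfree => ?_⟩
  by_contra hcon
  obtain ⟨f, hf, hfR⟩ := hn₀ V hV _ (not_le.mp hcon).le
  exact hfree (copyIn_of_complete_partite hk ht hE le_rfl f hf hfR)

lemma prod_sub_div_eq {k r : ℕ} (hrk : r ≤ k) :
    ∏ a ∈ range r, ((k : ℝ) - a) / k = r.factorial * (k.choose r / (k : ℝ) ^ r) := by
  have h1 : ∏ a ∈ range r, ((k : ℝ) - a) = k.descFactorial r := by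
    rw [Nat.descFactorial_eq_prod_range]
    push_cast
    refine prod_congr rfl fun a ha => ?_
    rw [Nat.cast_sub (by have := mem_range.mp ha; omega)]
  rw [prod_div_distrib, h1, Nat.descFactorial_eq_factorial_mul_choose]
  simp [mul_div_assoc]

/-- A dense hypergraph without the basic configuration has a partition into `k` parts of almost
equal size, almost without heavy pairs inside the parts. -/
theorem exists_heavy_partition {k t r : ℕ} (hr : 2 ≤ r) (hrk : r ≤ k) (ht : 0 < t) {γ : ℝ}
    (hγ : 0 < γ) :
    ∃ ε : ℝ, 0 < ε ∧ ∃ n₀ : ℕ, ∀ (V : Type) [DecidableEq V] [Fintype V] (E : Finset (Finset V)),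
      n₀ ≤ Fintype.card V → (∀ e ∈ E, e.card = r) → ¬ CopyIn (turanPlusEdge k t) E univ →
      (k.choose r / (k : ℝ) ^ r - ε) * (Fintype.card V : ℝ) ^ r ≤ E.card →
      ∃ P : V → Fin k, (∀ j, (1 / (k : ℝ) - γ) * Fintype.card V ≤ (#{v | P v = j} : ℝ)) ∧
        (#{p : V × V | (heavyGraph E (copySize k t r)).Adj p.1 p.2 ∧ P p.1 = P p.2} : ℝ) ≤
          γ * (Fintype.card V : ℝ) ^ 2 := by
  obtain ⟨ε, hε, hstab⟩ := clique_stability hr hrk hγ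
  obtain ⟨n₁, hn₁⟩ := card_heavy_cliques_le (k := k) (r := r) (by omega) ht hε
  set M := copySize k t r with hM
  have hfac : (0 : ℝ) < r.factorial := by exact_mod_cast r.factorial_pos
  obtain ⟨n₂, hn₂⟩ := exists_nat_gt (2 * r.factorial * M / ε)
  refine ⟨ε / (2 * r.factorial), by positivity, max n₁ (n₂ + 1), fun V _ _ E hV hE hfree hcard => ?_⟩
  have hV1 : n₁ ≤ Fintype.card V := (le_max_left _ _).trans hV
  have hV2 : n₂ + 1 ≤ Fintype.card V := (le_max_right _ _).trans hV
  have hV0 : 0 < Fintype.card V := by omega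
  set H := heavyGraph E M with hH
  refine hstab V H hV0 (hn₁ V E hV1 hE hfree) ?_
  have h1 := card_light_edges_le (M := M) hE
  have h2 := factorial_mul_card_le (E := {e ∈ E | ¬ ∃ x ∈ e, ∃ y ∈ e, x ≠ y ∧ ¬ H.Adj x y}) H
    (fun e he => hE e (mem_filter.mp he).1) (fun e he x hx y hy hxy => by
      by_contra hcon
      exact (mem_filter.mp he).2 ⟨x, hx, y, hy, hxy, hcon⟩)
  have h3 := card_filter_add_card_filter_not (s := E)
    (fun e => ∃ x ∈ e, ∃ y ∈ e, x ≠ y ∧ ¬ H.Adj x y)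
  set L := #{e ∈ E | ∃ x ∈ e, ∃ y ∈ e, x ≠ y ∧ ¬ H.Adj x y} with hL
  set L' := #{e ∈ E | ¬ ∃ x ∈ e, ∃ y ∈ e, x ≠ y ∧ ¬ H.Adj x y} with hL'
  rw [prod_sub_div_eq hrk]
  have hn : (0 : ℝ) < Fintype.card V := by exact_mod_cast hV0
  have h1' : (Fintype.card V : ℝ) * L ≤ M * (Fintype.card V : ℝ) ^ r := by exact_mod_cast h1
  have h2' : (r.factorial : ℝ) * L' ≤ (cliqueTuples H r).card := by exact_mod_cast h2
  have h3' : (L : ℝ) + L' = E.card := by exact_mod_cast h3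
  have h4 : 2 * r.factorial * M / ε < (Fintype.card V : ℝ) := hn₂.trans (by exact_mod_cast hV2)
  set n : ℝ := (Fintype.card V : ℝ) with hnd
  rw [div_lt_iff₀ hε] at h4
  have h5 : (r.factorial : ℝ) * L ≤ ε / 2 * n ^ r := by
    have h6 : n * (2 * r.factorial * L) ≤ n * (ε * n ^ r) := by
      calc n * (2 * r.factorial * L) = 2 * r.factorial * (n * L) := by ring
        _ ≤ 2 * r.factorial * (M * n ^ r) := by gcongr
        _ = (2 * r.factorial * M) * n ^ r := by ring
        _ ≤ (n * ε) * n ^ r := by gcongr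
        _ = _ := by ring
    have := le_of_mul_le_mul_left h6 hn
    linarith
  have h7 : r.factorial * ((k.choose r / (k : ℝ) ^ r - ε / (2 * r.factorial)) * n ^ r) ≤
      r.factorial * E.card := by gcongr
  have h8 : r.factorial * ((k.choose r / (k : ℝ) ^ r - ε / (2 * r.factorial)) * n ^ r) =
    r.factorial * (k.choose r / (k : ℝ) ^ r) * n ^ r - ε / 2 * n ^ r := by
    field_simp
  rw [h8, ← h3', mul_add] at h7
  linarith

end

/-- The vertices outside the part of `x` that are not adjacent to `x`. -/
noncomputable def missingNbrs {V : Type} [Fintype V] {k : ℕ} (H : SimpleGraph V) (P : V → Fin k)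
    (x : V) : Finset V :=
  {y | P y ≠ P x ∧ ¬ H.Adj x y}

section
variable {V : Type} [DecidableEq V] [Fintype V]

lemma exists_greedy_vertices {ι : Type} (I : Finset ι) (C : ι → Finset V) (B : V → V → Prop)
    (hB : ∀ x y, B x y → B y x) {N : ℝ} (hN : 0 ≤ N)
    (hbad : ∀ i ∈ I, ∀ x ∈ C i, (#{y | B x y} : ℝ) ≤ N) (hC : ∀ i ∈ I, I.card * N < (C i).card)
    (v₀ : V) :
    ∃ f : ι → V, (∀ i ∈ I, f i ∈ C i) ∧ ∀ i ∈ I, ∀ j ∈ I, i ≠ j → ¬ B (f i) (f j) := by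
  induction I using Finset.induction_on with
  | empty => exact ⟨fun _ => v₀, by simp, by simp⟩
  | insert i I hi ih =>
    rw [card_insert_of_notMem hi] at hC
    push_cast at hC
    obtain ⟨f, hf1, hf2⟩ := ih (fun j hj => hbad j (mem_insert_of_mem hj)) fun j hj => by
      have := hC j (mem_insert_of_mem hj)
      linarith
    have hU : ((I.biUnion fun j => ({y | B (f j) y} : Finset V)).card : ℝ) ≤ I.card * N := by
      have h1 : ((I.biUnion fun j => ({y | B (f j) y} : Finset V)).card : ℝ) ≤
          ∑ j ∈ I, (#{y | B (f j) y} : ℝ) := by exact_mod_cast card_biUnion_le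
      refine h1.trans ((sum_le_card_nsmul _ _ _ fun j hj =>
        hbad j (mem_insert_of_mem hj) _ (hf1 j hj)).trans ?_)
      rw [nsmul_eq_mul]
    have hlt : (I.biUnion fun j => ({y | B (f j) y} : Finset V)).card < (C i).card := by
      have := hC i (mem_insert_self _ _)
      have h2 : ((I.biUnion fun j => ({y | B (f j) y} : Finset V)).card : ℝ) < (C i).card := by
        linarith
      exact_mod_cast h2
    obtain ⟨x, hx, hxn⟩ := exists_mem_notMem_of_card_lt_card hlt
    simp only [mem_biUnion, mem_filter, mem_univ, true_and, not_exists, not_and] at hxn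
    have hne : ∀ j ∈ I, j ≠ i := fun j hj hji => hi (hji ▸ hj)
    refine ⟨Function.update f i x, ?_, ?_⟩
    · intro j hj
      rcases mem_insert.mp hj with rfl | hj
      · simpa using hx
      · rw [Function.update_of_ne (hne j hj)]; exact hf1 j hj
    · intro a ha b hb hab
      rcases mem_insert.mp ha with ha' | ha' <;> rcases mem_insert.mp hb with hb' | hb'
      · exact absurd (ha'.trans hb'.symm) hab
      · rw [ha', Function.update_self, Function.update_of_ne (hne b hb')]
        exact fun h => hxn b hb' (hB _ _ h)
      · rw [hb', Function.update_self, Function.update_of_ne (hne a ha')]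
        exact hxn a ha'
      · rw [Function.update_of_ne (hne a ha'), Function.update_of_ne (hne b hb')]
        exact hf2 a ha' b hb' hab

end

/-- In an almost complete `k`-partite structure, a hyperedge with two vertices that have many
common neighbours in all parts but one creates a copy. -/
theorem exists_copyIn_of_common_nbrs {k t r : ℕ} (hk : 2 ≤ k) (ht : 2 ≤ t) {ρ : ℝ} (hρ : 0 < ρ) :
    ∃ γ : ℝ, 0 < γ ∧ ∃ n₀ : ℕ, ∀ (V : Type) [DecidableEq V] [Fintype V] (E : Finset (Finset V)),
      n₀ ≤ Fintype.card V → (∀ e ∈ E, e.card = r) → ∀ P : V → Fin k,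
      (∀ j, ρ * Fintype.card V ≤ (#{v | P v = j} : ℝ)) →
      (#{x | γ * Fintype.card V <
        ((missingNbrs (heavyGraph E (copySize k t r)) P x).card : ℝ)} : ℝ) ≤
          γ * Fintype.card V →
      ∀ e ∈ E, ∀ y ∈ e, ∀ z ∈ e, y ≠ z → ∀ j₀ : Fin k,
      (∀ j, j ≠ j₀ → ρ * Fintype.card V ≤
        (#{w | P w = j ∧ (heavyGraph E (copySize k t r)).Adj y w ∧
          (heavyGraph E (copySize k t r)).Adj z w} : ℝ)) →
      CopyIn (turanPlusEdge k t) E univ := by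
  set K : ℝ := k * t with hK
  have hK0 : 0 ≤ K := by positivity
  obtain ⟨n₀, hn₀⟩ := exists_nat_gt (4 * (K + r) / ρ)
  refine ⟨ρ / (4 * (K + 1)), by positivity, n₀ + 1,
    fun V _ _ E hV hE P hP hatyp e he y hy z hz hyz j₀ hcom => ?_⟩
  set M := copySize k t r with hM
  set H := heavyGraph E M with hH
  set γ := ρ / (4 * (K + 1)) with hγ
  have hnV : (n₀ : ℝ) < Fintype.card V := by exact_mod_cast hV
  have hn' : 4 * (K + r) / ρ < (Fintype.card V : ℝ) := hn₀.trans hnV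
  have hn : (0 : ℝ) < Fintype.card V := lt_of_le_of_lt (by positivity) hnV
  set n : ℝ := (Fintype.card V : ℝ) with hnd
  rw [div_lt_iff₀ hρ] at hn'
  have hγ1 : (K + 1) * (γ * n) = ρ * n / 4 := by
    rw [hγ]; field_simp
  let o : Fin k := ⟨0, by omega⟩
  let p₀ : Fin k × Fin t := (o, ⟨0, by omega⟩)
  let p₁ : Fin k × Fin t := (o, ⟨1, by omega⟩)
  have hp01 : p₀ ≠ p₁ := by simp [p₀, p₁]
  let σ : Equiv.Perm (Fin k) := Equiv.swap o j₀
  have hσ : ∀ j, j ≠ o → σ j ≠ j₀ := by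
    intro j hj h
    apply hj
    apply σ.injective
    rw [h]; simp [σ]
  set At : Finset V := {x | γ * n < ((missingNbrs H P x).card : ℝ)} with hAt
  let C : Fin k × Fin t → Finset V := fun p =>
    (({w | P w = σ p.1 ∧ (p.1 ≠ o → H.Adj y w ∧ H.Adj z w)} : Finset V) \ At) \ e
  let B : V → V → Prop := fun a b => a = b ∨ (P a ≠ P b ∧ ¬ H.Adj a b)
  have hBsymm : ∀ a b, B a b → B b a := by
    rintro a b (h | ⟨h1, h2⟩)
    · exact Or.inl h.symm
    · exact Or.inr ⟨h1.symm, fun h => h2 h.symm⟩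
  set I : Finset (Fin k × Fin t) := univ \ {p₀, p₁} with hI
  have hIK : (I.card : ℝ) ≤ K := by
    have : I.card ≤ k * t := (card_le_univ _).trans (by simp)
    rw [hK]; exact_mod_cast this
  obtain ⟨f, hf1, hf2⟩ := exists_greedy_vertices I C B hBsymm (N := γ * n + 1) (by positivity)
    (by
      intro p _ x hx
      simp only [C, mem_sdiff, hAt, mem_filter, mem_univ, true_and, not_lt] at hx
      have h1 : #{b | B x b} ≤ 1 + (missingNbrs H P x).card := by
        have : ({b | B x b} : Finset V) ⊆ {x} ∪ missingNbrs H P x := by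
          intro b hb
          simp only [mem_filter, mem_univ, true_and, B] at hb
          rcases hb with rfl | hb
          · simp
          · refine mem_union_right _ ?_
            simp only [missingNbrs, mem_filter, mem_univ, true_and]
            exact ⟨hb.1.symm, hb.2⟩
        refine (card_le_card this).trans ((card_union_le _ _).trans ?_)
        simp
      have h2 : (#{b | B x b} : ℝ) ≤ 1 + (missingNbrs H P x).card := by exact_mod_cast h1
      have h3 : 1 + ((missingNbrs H P x).card : ℝ) ≤ γ * n + 1 := by linarith [hx.1.2]
      exact le_of_eq_of_le (by congr!) (h2.trans h3))
    (by
      intro p _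
      have h1 : ρ * n ≤ (#{w | P w = σ p.1 ∧ (p.1 ≠ o → H.Adj y w ∧ H.Adj z w)} : ℝ) := by
        by_cases hp : p.1 = o
        · simpa [hp] using hP (σ o)
        · simpa [hp] using hcom (σ p.1) (hσ _ hp)
      set A : Finset V := {w | P w = σ p.1 ∧ (p.1 ≠ o → H.Adj y w ∧ H.Adj z w)} with hA
      have h2 : A.card ≤ (C p).card + At.card + r := by
        have h3 := card_le_card_sdiff_add_card (s := A) (t := At)
        have h4 := card_le_card_sdiff_add_card (s := A \ At) (t := e)
        rw [hE e he] at h4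
        have : (C p).card = ((A \ At) \ e).card := rfl
        omega
      have h3 : (A.card : ℝ) ≤ (C p).card + At.card + r := by exact_mod_cast h2
      have h4 : (I.card : ℝ) * (γ * n + 1) ≤ K * (γ * n + 1) := by
        have : 0 ≤ γ * n + 1 := by positivity
        gcongr
      nlinarith) y
  have hIp : ∀ p, p ≠ p₀ → p ≠ p₁ → p ∈ I := by
    intro p h0 h1
    simp [hI, h0, h1]
  have hfe : ∀ p ∈ I, f p ∉ e := fun p hp => by
    have := hf1 p hp
    simp only [C, mem_sdiff] at this
    exact this.2
  let φ' : Fin k × Fin t → V := fun p => if p = p₀ then y else if p = p₁ then z else f p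
  have hφ0 : φ' p₀ = y := by simp [φ']
  have hφ1 : φ' p₁ = z := by simp [φ', hp01.symm]
  have hφI : ∀ p, p ≠ p₀ → p ≠ p₁ → φ' p = f p := by
    intro p h0 h1
    simp [φ', h0, h1]
  have hφe : ∀ p, φ' p ∈ e → p = p₀ ∨ p = p₁ := by
    intro p hp
    by_contra hcon
    push Not at hcon
    rw [hφI p hcon.1 hcon.2] at hp
    exact hfe p (hIp p hcon.1 hcon.2) hp
  have hinj : Function.Injective φ' := by
    intro p q hpq
    by_cases hp : φ' p ∈ e
    · have hq : φ' q ∈ e := hpq ▸ hp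
      rcases hφe p hp with rfl | rfl <;> rcases hφe q hq with rfl | rfl
      · rfl
      · rw [hφ0, hφ1] at hpq; exact absurd hpq hyz
      · rw [hφ0, hφ1] at hpq; exact absurd hpq.symm hyz
      · rfl
    · have hq : φ' q ∉ e := hpq ▸ hp
      have hp0 : p ≠ p₀ := by rintro rfl; rw [hφ0] at hp; exact hp hy
      have hp1 : p ≠ p₁ := by rintro rfl; rw [hφ1] at hp; exact hp hz
      have hq0 : q ≠ p₀ := by rintro rfl; rw [hφ0] at hq; exact hq hy
      have hq1 : q ≠ p₁ := by rintro rfl; rw [hφ1] at hq; exact hq hz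
      by_contra hne
      refine hf2 p (hIp p hp0 hp1) q (hIp q hq0 hq1) hne (Or.inl ?_)
      rw [← hφI p hp0 hp1, ← hφI q hq0 hq1, hpq]
  have hpart : ∀ p : Fin k × Fin t, p.1 = o → p.2.val < 2 → p = p₀ ∨ p = p₁ := by
    intro p h1 h2
    rcases (by omega : p.2.val = 0 ∨ p.2.val = 1) with h | h
    · exact Or.inl (Prod.ext h1 (Fin.ext h))
    · exact Or.inr (Prod.ext h1 (Fin.ext h))
  have hCadj : ∀ q, q ≠ p₀ → q ≠ p₁ → q.1 ≠ o → H.Adj y (φ' q) ∧ H.Adj z (φ' q) := by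
    intro q h0 h1 hq
    have := hf1 q (hIp q h0 h1)
    simp only [C, mem_sdiff, mem_filter, mem_univ, true_and] at this
    rw [hφI q h0 h1]
    exact this.1.1.2 hq
  have key : ∀ p q, (turanPlusEdge k t).Adj p q → s(p, q) ≠ s(p₀, p₁) →
      (q = p₀ ∨ q = p₁ → p = p₀ ∨ p = p₁) → H.Adj (φ' p) (φ' q) := by
    intro p q hpq hne hmin
    by_cases hp : p = p₀ ∨ p = p₁
    · have hpo : p.1 = o := by rcases hp with rfl | rfl <;> rfl
      have hp2 : p.2.val < 2 := by rcases hp with rfl | rfl <;> simp [p₀, p₁]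
      by_cases hq : q = p₀ ∨ q = p₁
      · exfalso
        rcases hp with rfl | rfl <;> rcases hq with rfl | rfl
        · exact hpq.ne rfl
        · exact hne rfl
        · exact hne Sym2.eq_swap
        · exact hpq.ne rfl
      · have hq' := hq
        push Not at hq'
        have hqo : q.1 ≠ o := by
          intro hqo
          rcases hpq with h | ⟨-, -, -, -, h⟩
          · exact h (hpo.trans hqo.symm)
          · exact hq (hpart q hqo h)
        have := hCadj q hq'.1 hq'.2 hqo
        rcases hp with rfl | rfl
        · rw [hφ0]; exact this.1
        · rw [hφ1]; exact this.2
    · have hq : ¬ (q = p₀ ∨ q = p₁) := fun h => hp (hmin h)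
      have hp' := hp
      have hq' := hq
      push Not at hp' hq'
      have hpq1 : p.1 ≠ q.1 := by
        rcases hpq with h | ⟨-, h1, -, h3, -⟩
        · exact h
        · exact absurd (hpart p (Fin.ext h1) h3) hp
      have hB := hf2 p (hIp p hp'.1 hp'.2) q (hIp q hq'.1 hq'.2) hpq.ne
      simp only [B, not_or, not_and, not_not] at hB
      rw [hφI p hp'.1 hp'.2, hφI q hq'.1 hq'.2]
      refine hB.2 ?_
      have h1 := hf1 p (hIp p hp'.1 hp'.2)
      have h2 := hf1 q (hIp q hq'.1 hq'.2)
      simp only [C, mem_sdiff, mem_filter, mem_univ, true_and] at h1 h2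
      rw [h1.1.1.1, h2.1.1.1]
      exact fun h => hpq1 (σ.injective h)
  refine copyIn_of_heavy hE (M := M) le_rfl ⟨φ', hinj⟩ (a₀ := p₀) (b₀ := p₁) he
    (by rw [Function.Embedding.coeFn_mk, hφ0]; exact hy)
    (by rw [Function.Embedding.coeFn_mk, hφ1]; exact hz) hφe fun p q hpq hne => ?_
  by_cases hq : q = p₀ ∨ q = p₁
  · refine (key q p hpq.symm (by rwa [Sym2.eq_swap]) fun _ => hq).symm
  · exact key p q hpq hne fun h => absurd h hq

/-- The `q`-subsets of `W` meeting every part at most once and only parts in `A`. -/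
noncomputable def partite {V : Type} {k : ℕ} (P : V → Fin k) (W : Finset V) (A : Finset (Fin k))
    (q : ℕ) : Finset (Finset V) :=
  {Q ∈ W.powersetCard q | Set.InjOn P (Q : Set V) ∧ ∀ v ∈ Q, P v ∈ A}

lemma mem_partite {V : Type} {k : ℕ} {P : V → Fin k} {W : Finset V} {A : Finset (Fin k)}
    {q : ℕ} {Q : Finset V} : Q ∈ partite P W A q ↔
      (Q ⊆ W ∧ Q.card = q) ∧ Set.InjOn P (Q : Set V) ∧ ∀ v ∈ Q, P v ∈ A := by
  rw [partite, mem_filter, mem_powersetCard]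

section
variable {V : Type} [DecidableEq V] {k : ℕ}

lemma card_transversals (P : V → Fin k) (W : Finset V) (J : Finset (Fin k)) :
    ({Q ∈ W.powersetCard J.card | Set.InjOn P (Q : Set V) ∧ Q.image P = J} :
      Finset (Finset V)).card =
      ∏ j ∈ J, #{v ∈ W | P v = j} := by
  rw [← card_pi]
  symm
  have hval : ∀ f ∈ J.pi (fun j => ({v ∈ W | P v = j} : Finset V)), ∀ j (hj : j ∈ J),
      f j hj ∈ W ∧ P (f j hj) = j := by
    intro f hf j hj
    simpa using (mem_pi.mp hf) j hj
  refine card_bij (fun f _ => J.attach.image fun j => f j.1 j.2) ?_ ?_ ?_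
  · intro f hf
    have h := hval f hf
    have hinj : Function.Injective (fun j : {x // x ∈ J} => f j.1 j.2) := by
      intro a b hab
      have h1 := (h a.1 a.2).2
      have h2 := (h b.1 b.2).2
      simp only at hab
      rw [hab, h2] at h1
      exact Subtype.ext h1.symm
    simp only [mem_filter, mem_powersetCard]
    refine ⟨⟨?_, ?_⟩, ?_, ?_⟩
    · intro v hv
      simp only [mem_image, mem_attach, true_and] at hv
      obtain ⟨j, rfl⟩ := hv
      exact (h _ _).1
    · rw [card_image_of_injective _ hinj, card_attach]
    · intro a ha b hb hab
      simp only [coe_image, Set.mem_image, mem_coe, mem_attach, true_and] at ha hb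
      obtain ⟨i, rfl⟩ := ha
      obtain ⟨j, rfl⟩ := hb
      rw [(h _ _).2, (h _ _).2] at hab
      rw [Subtype.ext hab]
    · ext j
      simp only [mem_image, mem_attach, true_and]
      constructor
      · rintro ⟨v, ⟨i, rfl⟩, rfl⟩
        rw [(h _ _).2]; exact i.2
      · intro hj
        exact ⟨_, ⟨⟨j, hj⟩, rfl⟩, (h _ _).2⟩
  · intro f hf g hg hfg
    funext j hj
    replace hfg : (J.attach.image fun j => f j.1 j.2) = J.attach.image fun j => g j.1 j.2 := hfg
    have h1 : f j hj ∈ J.attach.image fun j => g j.1 j.2 := by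
      rw [← hfg]
      exact mem_image_of_mem (fun j : {x // x ∈ J} => f j.1 j.2) (mem_attach _ ⟨j, hj⟩)
    simp only [mem_image, mem_attach, true_and] at h1
    obtain ⟨i, hi⟩ := h1
    have h2 := (hval g hg i.1 i.2).2
    rw [hi, (hval f hf j hj).2] at h2
    subst h2
    exact hi.symm
  · intro Q hQ
    simp only [mem_filter, mem_powersetCard] at hQ
    obtain ⟨⟨hQW, hQc⟩, hinj, himg⟩ := hQ
    have hex : ∀ j ∈ J, ∃ v ∈ Q, P v = j := by
      intro j hj
      rw [← himg] at hj
      simpa using hj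
    choose! g hg1 hg2 using hex
    refine ⟨g, ?_, ?_⟩
    · rw [mem_pi]
      intro j hj
      simp [hQW (hg1 j hj), hg2 j hj]
    · ext v
      simp only [mem_image, mem_attach, true_and, Subtype.exists]
      constructor
      · rintro ⟨j, hj, rfl⟩
        exact hg1 j hj
      · intro hv
        have hj : P v ∈ J := by rw [← himg]; exact mem_image_of_mem _ hv
        exact ⟨P v, hj, hinj (hg1 _ hj) hv (hg2 _ hj)⟩

lemma card_partite (P : V → Fin k) (W : Finset V) (A : Finset (Fin k)) (q : ℕ) :
    (partite P W A q).card = ∑ J ∈ A.powersetCard q, ∏ j ∈ J, #{v ∈ W | P v = j} := by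
  rw [card_eq_sum_card_fiberwise (f := fun Q => Q.image P) (t := A.powersetCard q)]
  · refine sum_congr rfl fun J hJ => ?_
    obtain ⟨hJA, hJc⟩ := mem_powersetCard.mp hJ
    rw [← card_transversals]
    congr 1
    ext Q
    simp only [mem_filter, mem_partite, mem_powersetCard, hJc]
    constructor
    · rintro ⟨⟨h1, h2, h3⟩, h4⟩
      exact ⟨h1, h2, h4⟩
    · rintro ⟨h1, h2, h4⟩
      exact ⟨⟨h1, h2, fun v hv => hJA (h4 ▸ mem_image_of_mem P hv)⟩, h4⟩
  · intro Q hQ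
    rw [mem_coe, mem_partite] at hQ
    rw [mem_coe, mem_powersetCard]
    refine ⟨fun j hj => ?_, ?_⟩
    · obtain ⟨v, hv, rfl⟩ := mem_image.mp hj
      exact hQ.2.2 v hv
    · rw [card_image_of_injOn hQ.2.1, hQ.1.2]

lemma card_partite_le (P : V → Fin k) (W : Finset V) (A : Finset (Fin k)) (q : ℕ) {a : ℝ}
    (h : ∀ j ∈ A, (#{v ∈ W | P v = j} : ℝ) ≤ a) :
    ((partite P W A q).card : ℝ) ≤ A.card.choose q * a ^ q := by
  rw [card_partite, ← card_powersetCard, ← nsmul_eq_mul]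
  push_cast
  refine sum_le_card_nsmul _ _ _ fun J hJ => ?_
  obtain ⟨hJA, hJc⟩ := mem_powersetCard.mp hJ
  rw [← hJc, ← prod_const]
  exact prod_le_prod (fun _ _ => by positivity) fun j hj => h j (hJA hj)

lemma le_card_partite (P : V → Fin k) (W : Finset V) (A : Finset (Fin k)) (q : ℕ) {a : ℝ}
    (ha : 0 ≤ a) (h : ∀ j ∈ A, a ≤ (#{v ∈ W | P v = j} : ℝ)) :
    A.card.choose q * a ^ q ≤ ((partite P W A q).card : ℝ) := by
  rw [card_partite, ← card_powersetCard, ← nsmul_eq_mul]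
  push_cast
  refine card_nsmul_le_sum _ _ _ fun J hJ => ?_
  obtain ⟨hJA, hJc⟩ := mem_powersetCard.mp hJ
  rw [← hJc, ← prod_const]
  exact prod_le_prod (fun _ _ => ha) fun j hj => h j (hJA hj)

/-- The transversals avoiding part `i` which do not form a hyperedge with `x`. -/
noncomputable def missingLinks [Fintype V] (E : Finset (Finset V)) (P : V → Fin k) (r : ℕ) (x : V)
    (i : Fin k) : Finset (Finset V) :=
  {Q ∈ partite P (univ.erase x) (univ.erase i) (r - 1) | insert x Q ∉ E}


lemma mem_missingLinks [Fintype V] {E : Finset (Finset V)} {P : V → Fin k} {r : ℕ} {x : V}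
    {i : Fin k} {Q : Finset V} : Q ∈ missingLinks E P r x i ↔
      Q ∈ partite P (univ.erase x) (univ.erase i) (r - 1) ∧ insert x Q ∉ E := by
  rw [missingLinks, mem_filter]

end

/-- A vertex with few missing links is heavily adjacent to almost all vertices of the other
parts. -/
theorem card_not_heavy_mul_le {k r : ℕ} (M : ℕ) (hr : 2 ≤ r) (hrk : r ≤ k) {ρ : ℝ} (hρ : 0 < ρ) :
    ∃ C : ℝ, 0 < C ∧ ∃ n₀ : ℕ, ∀ (V : Type) [DecidableEq V] [Fintype V] (E : Finset (Finset V)),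
      n₀ ≤ Fintype.card V → (∀ e ∈ E, e.card = r) → ∀ P : V → Fin k,
      (∀ j, ρ * Fintype.card V ≤ (#{v | P v = j} : ℝ)) → ∀ (x : V) (i : Fin k),
      (#{y | P y ≠ i ∧ y ≠ x ∧ ¬ (heavyGraph E M).Adj x y} : ℝ) *
        (Fintype.card V : ℝ) ^ (r - 2) ≤ C * (missingLinks E P r x i).card := by
  obtain ⟨q, rfl⟩ : ∃ q, r = q + 2 := ⟨r - 2, by omega⟩
  set c : ℝ := (ρ / 2) ^ q with hc
  have hc0 : 0 < c := by positivity
  obtain ⟨n₀, hn₀⟩ := exists_nat_gt (max (2 / ρ) (2 * M / c))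
  refine ⟨(q + 1) * (2 / c), by positivity, n₀ + 1, fun V _ _ E hV hE P hP x i => ?_⟩
  have hnV : (n₀ : ℝ) < Fintype.card V := by exact_mod_cast hV
  have hn' := hn₀.trans hnV
  have hn : (0 : ℝ) < Fintype.card V := lt_of_le_of_lt (by positivity) hnV
  set n : ℝ := (Fintype.card V : ℝ) with hnd
  have hn1 : 2 < ρ * n := by
    have := (le_max_left _ _).trans_lt hn'
    rw [div_lt_iff₀ hρ] at this
    linarith
  have hn2 : 2 * M < c * n := by
    have := (le_max_right _ _).trans_lt hn'
    rw [div_lt_iff₀ hc0] at this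
    linarith
  set H := heavyGraph E M with hH
  set Y : Finset V := {y | P y ≠ i ∧ y ≠ x ∧ ¬ H.Adj x y} with hY
  set B := missingLinks E P (q + 2) x i with hB
  have hdeg : ∀ y ∈ Y, c / 2 * n ^ q ≤ (#{Q ∈ B | y ∈ Q} : ℝ) := by
    intro y hy
    simp only [hY, mem_filter, mem_univ, true_and] at hy
    obtain ⟨hyi, hyx, hyH⟩ := hy
    set A : Finset (Fin k) := (univ.erase i).erase (P y) with hA
    have hAc : q ≤ A.card := by
      rw [hA, card_erase_of_mem (by simp [hyi]), card_erase_of_mem (mem_univ _), card_univ,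
        Fintype.card_fin]
      omega
    have h1 : (ρ / 2 * n) ^ q ≤ ((partite P (univ.erase x) A q).card : ℝ) := by
      have := le_card_partite P (univ.erase x) A q (a := ρ / 2 * n) (by positivity) (by
        intro j _
        have h1 : #{v | P v = j} ≤ #{v ∈ univ.erase x | P v = j} + 1 := by
          have : ({v | P v = j} : Finset V) ⊆ insert x {v ∈ univ.erase x | P v = j} := by
            intro v hv
            simp only [mem_filter, mem_univ, true_and] at hv
            by_cases hvx : v = x <;> simp [hvx, hv]
          exact (card_le_card this).trans (card_insert_le _ _)
        have h2 : (#{v | P v = j} : ℝ) ≤ #{v ∈ univ.erase x | P v = j} + 1 := by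
          exact_mod_cast h1
        linarith [hP j])
      refine le_trans ?_ this
      have : (1 : ℝ) ≤ A.card.choose q := by exact_mod_cast Nat.choose_pos hAc
      have h0 : 0 ≤ (ρ / 2 * n) ^ q := by positivity
      nlinarith
    have h2 : (partite P (univ.erase x) A q).card ≤
        #{Q ∈ B | y ∈ Q} + #{e ∈ E | x ∈ e ∧ y ∈ e} := by
      rw [← card_filter_add_card_filter_not (s := partite P (univ.erase x) A q)
        (fun Q => insert x (insert y Q) ∉ E)]
      have hyQ : ∀ Q ∈ partite P (univ.erase x) A q, y ∉ Q := by
        intro Q hQ hyQ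
        have := (mem_partite.mp hQ).2.2 y hyQ
        simp [hA] at this
      have hxQ : ∀ Q ∈ partite P (univ.erase x) A q, x ∉ insert y Q := by
        intro Q hQ hxQ
        rcases mem_insert.mp hxQ with h | h
        · exact hyx h.symm
        · have := (mem_partite.mp hQ).1.1 h
          simp at this
      refine Nat.add_le_add ?_ ?_
      · refine card_le_card_of_injOn (fun Q => insert y Q) ?_ ?_
        · intro Q hQ
          rw [mem_coe, mem_filter] at hQ
          rw [mem_coe, mem_filter, hB, mem_missingLinks, mem_partite]
          have h3 := mem_partite.mp hQ.1
          refine ⟨⟨⟨⟨?_, ?_⟩, ?_, ?_⟩, hQ.2⟩, mem_insert_self _ _⟩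
          · exact insert_subset (by simp [hyx]) h3.1.1
          · rw [card_insert_of_notMem (hyQ Q hQ.1), h3.1.2]; rfl
          · rw [coe_insert]
            refine (Set.injOn_insert (by simpa using hyQ Q hQ.1)).mpr ⟨h3.2.1, ?_⟩
            rintro ⟨v, hv, hvy⟩
            have := h3.2.2 v hv
            simp [hA, hvy] at this
          · intro v hv
            rcases mem_insert.mp hv with rfl | hv
            · simp [hyi]
            · exact mem_of_mem_erase (h3.2.2 v hv)
        · intro Q hQ Q' hQ' h
          rw [mem_coe, mem_filter] at hQ hQ'
          simp only at h
          rw [← erase_insert (hyQ Q hQ.1), h, erase_insert (hyQ Q' hQ'.1)]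
      · refine card_le_card_of_injOn (fun Q => insert x (insert y Q)) ?_ ?_
        · intro Q hQ
          rw [mem_coe, mem_filter, not_not] at hQ
          simp [hQ.2]
        · intro Q hQ Q' hQ' h
          rw [mem_coe, mem_filter] at hQ hQ'
          simp only at h
          have h4 : insert y Q = insert y Q' := by
            rw [← erase_insert (hxQ Q hQ.1), h, erase_insert (hxQ Q' hQ'.1)]
          rw [← erase_insert (hyQ Q hQ.1), h4, erase_insert (hyQ Q' hQ'.1)]
    have h3 : n ^ 3 * (#{e ∈ E | x ∈ e ∧ y ∈ e} : ℝ) ≤ M * n ^ (q + 2) := by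
      rw [hnd]; exact_mod_cast codegree_le_of_not_heavy hE (Ne.symm hyx) hyH
    have h4 : ((partite P (univ.erase x) A q).card : ℝ) ≤
        (#{Q ∈ B | y ∈ Q} : ℝ) + (#{e ∈ E | x ∈ e ∧ y ∈ e} : ℝ) := by exact_mod_cast h2
    have h5 : (#{e ∈ E | x ∈ e ∧ y ∈ e} : ℝ) ≤ c / 2 * n ^ q := by
      have h6 : n * (#{e ∈ E | x ∈ e ∧ y ∈ e} : ℝ) ≤ M * n ^ q := by
        have : n ^ 2 * (n * (#{e ∈ E | x ∈ e ∧ y ∈ e} : ℝ)) ≤ n ^ 2 * (M * n ^ q) := by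
          calc _ = n ^ 3 * (#{e ∈ E | x ∈ e ∧ y ∈ e} : ℝ) := by ring
            _ ≤ _ := h3
            _ = _ := by ring
        exact le_of_mul_le_mul_left this (by positivity)
      have h7 : M * n ^ q ≤ n * (c / 2 * n ^ q) := by
        have : 0 ≤ n ^ q := by positivity
        nlinarith
      exact le_of_mul_le_mul_left (h6.trans h7) hn
    rw [mul_pow] at h1
    linarith
  have hdc : ∑ y ∈ Y, #{Q ∈ B | y ∈ Q} ≤ (q + 1) * B.card := by
    refine (sum_card_bipartiteAbove_eq_sum_card_bipartiteBelow fun y Q => y ∈ Q).trans_le ?_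
    rw [mul_comm, ← smul_eq_mul]
    refine sum_le_card_nsmul _ _ _ fun Q hQ => ?_
    rw [hB, mem_missingLinks, mem_partite] at hQ
    have : Q.card = q + 1 := hQ.1.1.2
    rw [← this]
    exact card_le_card fun v hv => (mem_filter.mp hv).2
  have h1 : (Y.card : ℝ) * (c / 2 * n ^ q) ≤ ∑ y ∈ Y, (#{Q ∈ B | y ∈ Q} : ℝ) := by
    rw [← nsmul_eq_mul]
    exact card_nsmul_le_sum _ _ _ hdeg
  have h2 : ∑ y ∈ Y, (#{Q ∈ B | y ∈ Q} : ℝ) ≤ (q + 1) * B.card := by exact_mod_cast hdc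
  have h3 : (Y.card : ℝ) * n ^ q = 2 / c * (Y.card * (c / 2 * n ^ q)) := by field_simp
  simp only [Nat.add_sub_cancel]
  rw [h3, mul_right_comm, mul_comm _ (2 / c)]
  exact mul_le_mul_of_nonneg_left (h1.trans h2) (by positivity)

lemma exists_small_perturbation (A : ℝ) (k q : ℕ) {δ b : ℝ} (hδ : 0 < δ) (hb : 0 < b) :
    ∃ g : ℝ, 0 < g ∧ g ≤ b ∧ A * (1 / k + k * g) ^ q + g ≤ A / (k : ℝ) ^ q + δ := by
  have hc : Continuous fun g : ℝ => A * (1 / k + k * g) ^ q + g := by fun_prop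
  have h1 : ∀ᶠ g in nhds (0 : ℝ), A * (1 / k + k * g) ^ q + g < A / (k : ℝ) ^ q + δ := by
    refine (hc.tendsto 0).eventually (gt_mem_nhds ?_)
    simp only [mul_zero, add_zero, one_div_pow, mul_one_div]
    linarith
  have h2 : ∀ᶠ g in nhds (0 : ℝ), g < b := gt_mem_nhds hb
  obtain ⟨g, ⟨hg1, hg2⟩, hg3⟩ :=
    (((h1.and h2).filter_mono nhdsWithin_le_nhds).and
      (self_mem_nhdsWithin : Set.Ioi (0 : ℝ) ∈ nhdsWithin 0 (Set.Ioi 0))).exists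
  exact ⟨g, hg3, hg2.le, hg1.le⟩

lemma card_part_le {V : Type} [Fintype V] {k : ℕ} (P : V → Fin k) {γ : ℝ} (hγ : 0 ≤ γ)
    (h : ∀ j, (1 / (k : ℝ) - γ) * Fintype.card V ≤ (#{v | P v = j} : ℝ)) (j : Fin k) :
    (#{v | P v = j} : ℝ) ≤ (1 / k + k * γ) * Fintype.card V := by
  have hk : (0 : ℝ) < k := by exact_mod_cast j.pos
  have h1 : Fintype.card V = ∑ j, #{v | P v = j} :=
    card_eq_sum_card_fiberwise fun v _ => by simp
  rw [← add_sum_erase _ _ (mem_univ j)] at h1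
  have h2 : (Fintype.card V : ℝ) = #{v | P v = j} + ∑ i ∈ univ.erase j, (#{v | P v = i} : ℝ) := by
    exact_mod_cast h1
  have h3 : ((univ.erase j).card : ℝ) * ((1 / (k : ℝ) - γ) * Fintype.card V) ≤
      ∑ i ∈ univ.erase j, (#{v | P v = i} : ℝ) := by
    rw [← nsmul_eq_mul]
    exact card_nsmul_le_sum _ _ _ fun i _ => h i
  rw [card_erase_of_mem (mem_univ _), card_univ, Fintype.card_fin,
    Nat.cast_sub (Nat.one_le_of_lt j.pos), Nat.cast_one] at h3
  have h4 : ((k : ℝ) - 1) * ((1 / (k : ℝ) - γ) * Fintype.card V) =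
      Fintype.card V - 1 / k * Fintype.card V - (k - 1) * γ * Fintype.card V := by
    field_simp
  have h5 : 0 ≤ γ * Fintype.card V := by positivity
  nlinarith

section
variable {V : Type} [DecidableEq V] [Fintype V]

lemma codegree_le {E : Finset (Finset V)} {q : ℕ} (hE : ∀ e ∈ E, e.card = q + 2) {x y : V}
    (hxy : x ≠ y) : #{e ∈ E | x ∈ e ∧ y ∈ e} ≤ Fintype.card V ^ q := by
  have h0 : 0 < Fintype.card V := Fintype.card_pos_iff.mpr ⟨x⟩
  have h1 := card_supersets_mul_le (V := V) (q + 2) {x, y}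
  rw [card_pair hxy] at h1
  have h2 : #{e ∈ E | x ∈ e ∧ y ∈ e} ≤ #{e : Finset V | e.card = q + 2 ∧ {x, y} ⊆ e} := by
    refine card_le_card fun e he => ?_
    rw [mem_filter] at he
    simp [hE e he.1, insert_subset_iff, he.2]
  have h3 : #{e ∈ E | x ∈ e ∧ y ∈ e} * Fintype.card V ^ 2 ≤
      Fintype.card V ^ q * Fintype.card V ^ 2 := by
    rw [← pow_add]
    exact (Nat.mul_le_mul_right _ h2).trans h1
  exact Nat.le_of_mul_le_mul_right h3 (by positivity)

lemma card_noncrossing_le {E : Finset (Finset V)} {q k : ℕ} (hE : ∀ e ∈ E, e.card = q + 2)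
    (M : ℕ) (P : V → Fin k) :
    (E.filter fun e : Finset V => ¬ Set.InjOn P (e : Set V)).card ≤ M * Fintype.card V ^ (q + 1) +
      #{p : V × V | (heavyGraph E M).Adj p.1 p.2 ∧ P p.1 = P p.2} * Fintype.card V ^ q := by
  rcases isEmpty_or_nonempty V with hV | hV
  · simp
  have h0 : 0 < Fintype.card V := Fintype.card_pos
  set L : Finset (Finset V) := {e ∈ E | ∃ x ∈ e, ∃ y ∈ e, x ≠ y ∧ ¬ (heavyGraph E M).Adj x y}
  set S : Finset (V × V) := {p : V × V | (heavyGraph E M).Adj p.1 p.2 ∧ P p.1 = P p.2} with hS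
  have hsub : (E.filter fun e : Finset V => ¬ Set.InjOn P (e : Set V)) ⊆
      L ∪ S.biUnion fun p => {e ∈ E | p.1 ∈ e ∧ p.2 ∈ e} := by
    intro e he
    obtain ⟨he, hinj⟩ := mem_filter.mp he
    simp only [Set.InjOn, not_forall, mem_coe] at hinj
    obtain ⟨x, hx, y, hy, hP, hxy⟩ := hinj
    by_cases h : (heavyGraph E M).Adj x y
    · refine mem_union_right _ (mem_biUnion.mpr ⟨(x, y), ?_, ?_⟩)
      · simp [hS, h, hP]
      · simp [he, hx, hy]
    · exact mem_union_left _ (mem_filter.mpr ⟨he, x, hx, y, hy, hxy, h⟩)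
  refine (card_le_card hsub).trans ((card_union_le _ _).trans (Nat.add_le_add ?_ ?_))
  · have h1 := card_light_edges_le (M := M) hE
    have h2 : Fintype.card V * L.card ≤ Fintype.card V * (M * Fintype.card V ^ (q + 1)) := by
      refine h1.trans (le_of_eq ?_)
      ring
    exact Nat.le_of_mul_le_mul_left h2 h0
  · refine card_biUnion_le.trans ((sum_le_card_nsmul _ _ (Fintype.card V ^ q) ?_).trans_eq
      (smul_eq_mul ..))
    intro p hp
    rw [hS, mem_filter] at hp
    exact codegree_le hE hp.2.1.1

lemma sum_card_missingLinks_le {E : Finset (Finset V)} {r k : ℕ} (hr : 0 < r) (P : V → Fin k) :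
    ∑ x, (missingLinks E P r x (P x)).card ≤ r * (partite P univ univ r \ E).card := by
  have h1 : ∀ x, (missingLinks E P r x (P x)).card ≤ #{R ∈ partite P univ univ r \ E | x ∈ R} := by
    intro x
    have hx : ∀ Q ∈ missingLinks E P r x (P x), x ∉ Q := by
      intro Q hQ h
      have := (mem_partite.mp (mem_missingLinks.mp hQ).1).1.1 h
      simp at this
    refine card_le_card_of_injOn (fun Q => insert x Q) ?_ ?_
    · intro Q hQ
      rw [mem_coe] at hQ
      have hxQ := hx Q hQ
      rw [mem_missingLinks, mem_partite] at hQ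
      rw [mem_coe, mem_filter, mem_sdiff, mem_partite]
      refine ⟨⟨⟨⟨subset_univ _, ?_⟩, ?_, by simp⟩, hQ.2⟩, mem_insert_self _ _⟩
      · rw [card_insert_of_notMem hxQ, hQ.1.1.2]; omega
      · rw [coe_insert]
        refine (Set.injOn_insert (by simpa using hxQ)).mpr ⟨hQ.1.2.1, ?_⟩
        rintro ⟨v, hv, hvx⟩
        have := hQ.1.2.2 v hv
        simp [hvx] at this
    · intro Q hQ Q' hQ' h
      simp only at h
      rw [← erase_insert (hx Q hQ), h, erase_insert (hx Q' hQ')]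
  refine (sum_le_sum fun x _ => h1 x).trans ?_
  refine (sum_card_bipartiteAbove_eq_sum_card_bipartiteBelow fun y Q => y ∈ Q).trans_le ?_
  rw [mul_comm, ← smul_eq_mul]
  refine sum_le_card_nsmul _ _ _ fun R hR => ?_
  rw [← (mem_partite.mp (mem_sdiff.mp hR).1).1.2]
  exact card_le_card fun v hv => (mem_filter.mp hv).2

end

theorem exists_typical_partition {k t r : ℕ} (hr : 2 ≤ r) (hrk : r ≤ k) (ht : 0 < t) {γ : ℝ}
    (hγ : 0 < γ) :
    ∃ ε : ℝ, 0 < ε ∧ ∃ n₀ : ℕ, ∀ (V : Type) [DecidableEq V] [Fintype V] (E : Finset (Finset V)),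
      n₀ ≤ Fintype.card V → (∀ e ∈ E, e.card = r) → ¬ CopyIn (turanPlusEdge k t) E univ →
      (k.choose r / (k : ℝ) ^ r - ε) * (Fintype.card V : ℝ) ^ r ≤ E.card →
      ∃ P : V → Fin k, (∀ j, (1 / (k : ℝ) - γ) * Fintype.card V ≤ (#{v | P v = j} : ℝ)) ∧
        (#{x | γ * Fintype.card V <
          ((missingNbrs (heavyGraph E (copySize k t r)) P x).card : ℝ)} : ℝ) ≤
            γ * Fintype.card V := by
  have hk : (0 : ℝ) < k := by exact_mod_cast (by omega : 0 < k)
  set M := copySize k t r with hM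
  obtain ⟨C, hC, n₁, hn₁⟩ := card_not_heavy_mul_le (k := k) M hr hrk
    (ρ := 1 / (2 * k)) (by positivity)
  obtain ⟨q, rfl⟩ : ∃ q, r = q + 2 := ⟨r - 2, by omega⟩
  set δ : ℝ := γ ^ 2 / (C * (q + 2)) with hδ
  have hδ0 : 0 < δ := by positivity
  obtain ⟨g, hg, hgb, hgδ⟩ := exists_small_perturbation (k.choose (q + 2)) k (q + 2)
    (δ := δ / 4) (b := min γ (1 / (2 * k))) (by positivity) (by positivity)
  obtain ⟨ε, hε, n₂, hn₂⟩ := exists_heavy_partition hr hrk ht hg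
  obtain ⟨n₃, hn₃⟩ := exists_nat_gt (4 * M / δ)
  refine ⟨min ε (δ / 4), by positivity, max (max n₁ n₂) (n₃ + 1), fun V _ _ E hV hE hfree hcard => ?_⟩
  have hV1 : n₁ ≤ Fintype.card V := le_trans (by simp) hV
  have hV2 : n₂ ≤ Fintype.card V := le_trans (by simp) hV
  have hV3 : n₃ + 1 ≤ Fintype.card V := le_trans (by simp) hV
  have hnV : (n₃ : ℝ) < Fintype.card V := by exact_mod_cast hV3
  have hn : (0 : ℝ) < Fintype.card V := lt_of_le_of_lt (by positivity) hnV
  have hg1 : g ≤ γ := hgb.trans (min_le_left _ _)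
  have hg2 : g ≤ 1 / (2 * k) := hgb.trans (min_le_right _ _)
  set n : ℝ := (Fintype.card V : ℝ) with hnd
  have hnr : (0 : ℝ) < n ^ (q + 2) := by positivity
  obtain ⟨P, hP1, hP2⟩ := hn₂ V E hV2 hE hfree (le_trans
    (mul_le_mul_of_nonneg_right (by linarith [min_le_left ε (δ / 4)]) hnr.le) hcard)
  rw [← hnd] at hP1 hP2
  refine ⟨P, fun j => le_trans (mul_le_mul_of_nonneg_right (by linarith) hn.le) (hP1 j), ?_⟩
  have hsize : ∀ j, 1 / (2 * k) * n ≤ (#{v | P v = j} : ℝ) := fun j => by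
    refine le_trans (mul_le_mul_of_nonneg_right ?_ hn.le) (hP1 j)
    have : 1 / (k : ℝ) = 1 / (2 * k) + 1 / (2 * k) := by field_simp; norm_num
    linarith
  set N := partite P univ univ (q + 2) \ E with hN
  have hNle : (N.card : ℝ) ≤ δ * n ^ (q + 2) := by
    have h1 : N.card + E.card ≤ (partite P univ univ (q + 2)).card +
        (E.filter fun e : Finset V => ¬ Set.InjOn P (e : Set V)).card := by
      have h2 : E.card = (E.filter fun e : Finset V => Set.InjOn P (e : Set V)).card +
          (E.filter fun e : Finset V => ¬ Set.InjOn P (e : Set V)).card := (card_filter_add_card_filter_not _).symm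
      have h3 : N.card + (E.filter fun e : Finset V => Set.InjOn P (e : Set V)).card ≤
          (partite P univ univ (q + 2)).card := by
        rw [← card_union_of_disjoint]
        · refine card_le_card (union_subset sdiff_subset fun e he => ?_)
          rw [mem_filter] at he
          rw [mem_partite]
          exact ⟨⟨subset_univ _, hE e he.1⟩, he.2, by simp⟩
        · exact disjoint_of_subset_right (filter_subset _ _) sdiff_disjoint
      omega
    have h2 : (N.card : ℝ) + E.card ≤ (partite P univ univ (q + 2)).card +
        (E.filter fun e : Finset V => ¬ Set.InjOn P (e : Set V)).card := by exact_mod_cast h1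
    have h3 : ((partite P univ univ (q + 2)).card : ℝ) ≤
        k.choose (q + 2) * (1 / k + k * g) ^ (q + 2) * n ^ (q + 2) := by
      have := card_partite_le P univ univ (q + 2) (a := (1 / k + k * g) * n)
        fun j _ => card_part_le P hg.le hP1 j
      rwa [card_univ, Fintype.card_fin, mul_pow, ← mul_assoc] at this
    have h4 : ((E.filter fun e : Finset V => ¬ Set.InjOn P (e : Set V)).card : ℝ) ≤ M * n ^ (q + 1) +
        (#{p : V × V | (heavyGraph E M).Adj p.1 p.2 ∧ P p.1 = P p.2} : ℝ) * n ^ q := by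
      rw [hnd]; exact_mod_cast card_noncrossing_le hE M P
    have h5 : (#{p : V × V | (heavyGraph E M).Adj p.1 p.2 ∧ P p.1 = P p.2} : ℝ) * n ^ q ≤
        g * n ^ (q + 2) := by
      calc _ ≤ g * n ^ 2 * n ^ q := mul_le_mul_of_nonneg_right hP2 (by positivity)
        _ = _ := by ring
    have h6 : M * n ^ (q + 1) ≤ δ / 4 * n ^ (q + 2) := by
      have : M ≤ δ / 4 * n := by
        have := hn₃.trans hnV
        rw [div_lt_iff₀ hδ0] at this
        linarith
      calc M * n ^ (q + 1) ≤ δ / 4 * n * n ^ (q + 1) :=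
            mul_le_mul_of_nonneg_right this (by positivity)
        _ = _ := by ring
    have h7 := mul_le_mul_of_nonneg_right hgδ hnr.le
    have h8 : (k.choose (q + 2) / (k : ℝ) ^ (q + 2) - δ / 4) * n ^ (q + 2) ≤ E.card :=
      le_trans (mul_le_mul_of_nonneg_right (by linarith [min_le_right ε (δ / 4)]) hnr.le) hcard
    have h9 : 0 < δ * n ^ (q + 2) := by positivity
    linarith
  set A : Finset V := {x | γ * n < ((missingNbrs (heavyGraph E M) P x).card : ℝ)} with hA
  have hAx : ∀ x ∈ A, γ * n * n ^ q ≤ C * ((missingLinks E P (q + 2) x (P x)).card : ℝ) := by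
    intro x hx
    rw [hA, mem_filter] at hx
    refine le_trans ?_ (hn₁ V E hV1 hE P hsize x (P x))
    rw [← hnd, Nat.add_sub_cancel]
    refine mul_le_mul_of_nonneg_right (hx.2.le.trans ?_) (by positivity)
    have : missingNbrs (heavyGraph E M) P x ⊆
        ({y | P y ≠ P x ∧ y ≠ x ∧ ¬ (heavyGraph E M).Adj x y} : Finset V) := by
      intro y hy
      simp only [missingNbrs, mem_filter, mem_univ, true_and] at hy ⊢
      exact ⟨hy.1, fun h => hy.1 (h ▸ rfl), hy.2⟩
    exact_mod_cast card_le_card this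
  have h1 : (A.card : ℝ) * (γ * n * n ^ q) ≤ C * ((q + 2) * N.card) := by
    have h2 : (A.card : ℝ) * (γ * n * n ^ q) ≤
        ∑ x ∈ A, C * ((missingLinks E P (q + 2) x (P x)).card : ℝ) := by
      rw [← nsmul_eq_mul]
      exact card_nsmul_le_sum _ _ _ hAx
    rw [← mul_sum] at h2
    refine h2.trans (mul_le_mul_of_nonneg_left ?_ hC.le)
    have h3 : ∑ x ∈ A, (missingLinks E P (q + 2) x (P x)).card ≤ (q + 2) * N.card :=
      (sum_le_sum_of_subset (subset_univ A)).trans (sum_card_missingLinks_le (by omega) P)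
    exact_mod_cast h3
  have h2 : C * ((q + 2) * N.card) ≤ γ * n * (γ * n * n ^ q) := by
    calc C * ((q + 2) * N.card) ≤ C * ((q + 2) * (δ * n ^ (q + 2))) := by gcongr
      _ = γ * n * (γ * n * n ^ q) := by rw [hδ]; field_simp; ring
  exact le_of_mul_le_mul_right (h1.trans h2) (by positivity)

lemma card_edges_through_le {V : Type} [DecidableEq V] (E : Finset (Finset V)) (x : V) (S : Finset V) {c : ℝ}
    (h : ∀ y ∈ S, (#{e ∈ E | x ∈ e ∧ y ∈ e} : ℝ) ≤ c) :
    (#{e ∈ E | x ∈ e ∧ ∃ y ∈ S, y ∈ e} : ℝ) ≤ S.card * c := by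
  have h1 : #{e ∈ E | x ∈ e ∧ ∃ y ∈ S, y ∈ e} ≤ ∑ y ∈ S, #{e ∈ E | x ∈ e ∧ y ∈ e} := by
    refine (card_le_card fun e he => ?_).trans card_biUnion_le
    simp only [mem_filter, mem_biUnion] at he ⊢
    obtain ⟨he, hx, y, hy, hye⟩ := he
    exact ⟨y, hy, he, hx, hye⟩
  have h2 : (#{e ∈ E | x ∈ e ∧ ∃ y ∈ S, y ∈ e} : ℝ) ≤
      ∑ y ∈ S, (#{e ∈ E | x ∈ e ∧ y ∈ e} : ℝ) := by exact_mod_cast h1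
  rw [← nsmul_eq_mul]
  exact h2.trans (sum_le_card_nsmul _ _ _ h)

section
variable {V : Type} [DecidableEq V] [Fintype V]

lemma card_common_nbrs_ge {k : ℕ} (H : SimpleGraph V) (P : V → Fin k) (x y : V) (j : Fin k)
    (hy : P y ≠ j) :
    #{w | P w = j ∧ H.Adj x w} ≤
      #{w | P w = j ∧ H.Adj x w ∧ H.Adj y w} + (missingNbrs H P y).card := by
  refine (card_le_card fun w hw => ?_).trans (card_union_le _ _)
  simp only [missingNbrs, mem_filter, mem_univ, true_and, mem_union] at hw ⊢
  by_cases h : H.Adj y w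
  · exact Or.inl ⟨hw.1, hw.2, h⟩
  · exact Or.inr ⟨hw.1 ▸ hy.symm, h⟩

lemma card_part_le_nbrs {k : ℕ} (H : SimpleGraph V) (P : V → Fin k) (x : V) (j : Fin k)
    (hx : P x ≠ j) :
    #{w | P w = j} ≤ #{w | P w = j ∧ H.Adj x w} + (missingNbrs H P x).card := by
  refine (card_le_card fun w hw => ?_).trans (card_union_le _ _)
  simp only [missingNbrs, mem_filter, mem_univ, true_and, mem_union] at hw ⊢
  by_cases h : H.Adj x w
  · exact Or.inl ⟨hw, h⟩
  · exact Or.inr ⟨hw ▸ hx.symm, h⟩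

end

theorem exists_partition_link {k t r : ℕ} (hr : 2 ≤ r) (hrk : r ≤ k) (ht : 2 ≤ t) {γ η : ℝ}
    (hγ : 0 < γ) (hη : 0 < η) :
    ∃ ε : ℝ, 0 < ε ∧ ∃ n₀ : ℕ, ∀ (V : Type) [DecidableEq V] [Fintype V] (E : Finset (Finset V)),
      n₀ ≤ Fintype.card V → (∀ e ∈ E, e.card = r) → ¬ CopyIn (turanPlusEdge k t) E univ →
      (k.choose r / (k : ℝ) ^ r - ε) * (Fintype.card V : ℝ) ^ r ≤ E.card →
      ∃ P : V → Fin k, (∀ j, 1 / (2 * (k : ℝ)) * Fintype.card V ≤ (#{v | P v = j} : ℝ)) ∧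
        (#{x | γ * Fintype.card V <
          ((missingNbrs (heavyGraph E (copySize k t r)) P x).card : ℝ)} : ℝ) ≤
            γ * Fintype.card V ∧
        ∀ x, ∃ i, (#{e ∈ E | x ∈ e} : ℝ) + (missingLinks E P r x i).card ≤
          ((k - 1).choose (r - 1) / (k : ℝ) ^ (r - 1) + η) * (Fintype.card V : ℝ) ^ (r - 1) := by
  have hk : (0 : ℝ) < k := by exact_mod_cast (by omega : 0 < k)
  set M := copySize k t r with hM
  set ρ : ℝ := η / 4 with hρ
  obtain ⟨γ₁, hγ₁, n₁, hn₁⟩ := exists_copyIn_of_common_nbrs (k := k) (t := t) (r := r) (by omega) ht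
    (ρ := min (ρ / 2) (1 / (4 * k))) (by positivity)
  obtain ⟨q, rfl⟩ : ∃ q, r = q + 2 := ⟨r - 2, by omega⟩
  obtain ⟨g, hg, hgb, hgη⟩ := exists_small_perturbation ((k - 1).choose (q + 1)) k (q + 1)
    (δ := η / 4) (b := min (min γ γ₁) (min (1 / (8 * k)) (ρ / 2))) (by positivity) (by positivity)
  obtain ⟨ε, hε, n₂, hn₂⟩ := exists_typical_partition hr hrk (t := t) (by omega) hg
  obtain ⟨n₃, hn₃⟩ := exists_nat_gt (4 * M / η)
  refine ⟨ε, hε, max (max n₁ n₂) (n₃ + 1), fun V _ _ E hV hE hfree hcard => ?_⟩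
  have hV1 : n₁ ≤ Fintype.card V := le_trans (by simp) hV
  have hV2 : n₂ ≤ Fintype.card V := le_trans (by simp) hV
  have hV3 : n₃ + 1 ≤ Fintype.card V := le_trans (by simp) hV
  have hnV : (n₃ : ℝ) < Fintype.card V := by exact_mod_cast hV3
  have hn : (0 : ℝ) < Fintype.card V := lt_of_le_of_lt (by positivity) hnV
  obtain ⟨P, hP1, hP2⟩ := hn₂ V E hV2 hE hfree hcard
  have hgγ : g ≤ γ := hgb.trans ((min_le_left _ _).trans (min_le_left _ _))
  have hgγ₁ : g ≤ γ₁ := hgb.trans ((min_le_left _ _).trans (min_le_right _ _))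
  have hgk : g ≤ 1 / (8 * k) := hgb.trans ((min_le_right _ _).trans (min_le_left _ _))
  have hgρ : g ≤ ρ / 2 := hgb.trans ((min_le_right _ _).trans (min_le_right _ _))
  rw [← hM] at hP2
  set H := heavyGraph E M with hH
  have hatyp : ∀ γ', g ≤ γ' → (#{x | γ' * Fintype.card V < ((missingNbrs H P x).card : ℝ)} : ℝ) ≤
      γ' * Fintype.card V := by
    intro γ' hγ'
    have h1 := mul_le_mul_of_nonneg_right hγ' hn.le
    refine le_trans ?_ (hP2.trans h1)
    have : ({x | γ' * Fintype.card V < ((missingNbrs H P x).card : ℝ)} : Finset V) ⊆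
        ({x | g * Fintype.card V < ((missingNbrs H P x).card : ℝ)} : Finset V) :=
      monotone_filter_right _ fun x _ hx => h1.trans_lt hx
    exact_mod_cast card_le_card this
  have hk1 : 1 / (k : ℝ) = 8 * (1 / (8 * k)) := by field_simp
  have hk2 : 1 / (2 * (k : ℝ)) = 4 * (1 / (8 * k)) := by field_simp; norm_num
  have hk4 : 1 / (4 * (k : ℝ)) = 2 * (1 / (8 * k)) := by field_simp; norm_num
  have hk0 : 0 < 1 / (8 * (k : ℝ)) := by positivity
  have hsize : ∀ c, c ≤ 1 / (k : ℝ) - g → ∀ j, c * Fintype.card V ≤ (#{v | P v = j} : ℝ) :=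
    fun c hc j => (mul_le_mul_of_nonneg_right hc hn.le).trans (hP1 j)
  have hcommon := fun e he y hy z hz hyz j₀ => hn₁ V E hV1 hE P
    (hsize _ ((min_le_right _ _).trans (by rw [hk1, hk4]; linarith))) (hatyp γ₁ hgγ₁)
    e he y hy z hz hyz j₀
  rw [← hM, ← hH] at hcommon
  refine ⟨P, hsize _ (by rw [hk1, hk2]; linarith), hatyp γ hgγ, fun x => ?_⟩
  set At : Finset V := {x | g * Fintype.card V < ((missingNbrs H P x).card : ℝ)} with hAt
  set n : ℝ := (Fintype.card V : ℝ) with hnd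
  have hmem : ∀ y, y ∉ At → ((missingNbrs H P y).card : ℝ) ≤ g * n := by
    intro y hy
    simpa [hAt] using hy
  have hcross : ∀ e ∈ E, ∀ y ∈ e, ∀ z ∈ e, y ∉ At → z ∉ At → y ≠ z → P y ≠ P z := by
    intro e he y hy z hz hyA hzA hyz hPyz
    refine hfree (hcommon e he y hy z hz hyz (P y) fun j hj => ?_)
    have h1 : (#{w | P w = j} : ℝ) ≤
        #{w | P w = j ∧ H.Adj y w} + ((missingNbrs H P y).card : ℝ) := by
      exact_mod_cast card_part_le_nbrs H P y j hj.symm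
    have h2 : (#{w | P w = j ∧ H.Adj y w} : ℝ) ≤
        #{w | P w = j ∧ H.Adj y w ∧ H.Adj z w} + ((missingNbrs H P z).card : ℝ) := by
      exact_mod_cast card_common_nbrs_ge H P y z j (hPyz ▸ hj.symm)
    have h3 : (min (ρ / 2) (1 / (4 * k)) + 2 * g) * n ≤ (#{w | P w = j} : ℝ) := by
      refine hsize _ ?_ j
      have := min_le_right (ρ / 2) (1 / (4 * (k : ℝ)))
      rw [hk1]; linarith
    linarith [hmem y hyA, hmem z hzA]
  obtain ⟨i, hi⟩ : ∃ i, (#{y | P y = i ∧ H.Adj x y} : ℝ) ≤ ρ * n := by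
    by_contra! hcon
    let j₀ : Fin k := ⟨0, by omega⟩
    have h1 : (At.card : ℝ) < #{y | P y = j₀ ∧ H.Adj x y} := by
      refine hP2.trans_lt (lt_of_le_of_lt ?_ (hcon j₀))
      exact mul_le_mul_of_nonneg_right (by linarith) hn.le
    obtain ⟨y, hy, hyA⟩ := exists_mem_notMem_of_card_lt_card (by exact_mod_cast h1)
    rw [mem_filter] at hy
    obtain ⟨-, hyj, hxy⟩ := hy
    obtain ⟨e, he, hxe, hye, -⟩ := hxy.2 ∅ (by simp) (by simp) (by simp)
    refine hfree (hcommon e he x hxe y hye hxy.1 j₀ fun j hj => ?_)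
    have h2 : (#{w | P w = j ∧ H.Adj x w} : ℝ) ≤
        #{w | P w = j ∧ H.Adj x w ∧ H.Adj y w} + ((missingNbrs H P y).card : ℝ) := by
      exact_mod_cast card_common_nbrs_ge H P x y j (hyj ▸ hj.symm)
    have h3 : min (ρ / 2) (1 / (4 * k)) * n ≤ (ρ - g) * n := by
      refine mul_le_mul_of_nonneg_right ?_ hn.le
      linarith [min_le_left (ρ / 2) (1 / (4 * (k : ℝ)))]
    linarith [hcon j, hmem y hyA]
  refine ⟨i, ?_⟩
  set S1 : Finset V := At.erase x with hS1
  set S2 : Finset V := ({y | P y = i ∧ H.Adj x y} : Finset V) with hS2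
  set S3 : Finset V := ({y | x ≠ y ∧ ¬ H.Adj x y} : Finset V) with hS3
  have hS2x : ∀ y ∈ S2, x ≠ y := fun y hy => by
    rw [hS2, mem_filter] at hy
    exact hy.2.2.1
  have hcod : ∀ y, x ≠ y → (#{e ∈ E | x ∈ e ∧ y ∈ e} : ℝ) ≤ n ^ q := by
    intro y hxy
    rw [hnd]; exact_mod_cast codegree_le hE hxy
  have hd1 := card_edges_through_le E x S1 (c := n ^ q) fun y hy => hcod y (ne_of_mem_erase hy).symm
  have hd2 := card_edges_through_le E x S2 (c := n ^ q) fun y hy => hcod y (hS2x y hy)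
  have hd3 := card_edges_through_le E x S3 (c := M * n ^ q / n) fun y hy => by
    rw [hS3, mem_filter] at hy
    have h1 : n ^ 3 * (#{e ∈ E | x ∈ e ∧ y ∈ e} : ℝ) ≤ M * n ^ (q + 2) := by
      rw [hnd]; exact_mod_cast codegree_le_of_not_heavy hE hy.2.1 hy.2.2
    rw [le_div_iff₀ hn]
    refine le_of_mul_le_mul_left (a := n ^ 2) ?_ (by positivity)
    calc _ = n ^ 3 * (#{e ∈ E | x ∈ e ∧ y ∈ e} : ℝ) := by ring
      _ ≤ _ := h1
      _ = _ := by ring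
  set D : Finset (Finset V) :=
    {e ∈ E | x ∈ e ∧ e.erase x ∈ partite P (univ.erase x) (univ.erase i) (q + 1)} with hD
  have hdeg : #{e ∈ E | x ∈ e} ≤ D.card + #{e ∈ E | x ∈ e ∧ ∃ y ∈ S1, y ∈ e} +
      #{e ∈ E | x ∈ e ∧ ∃ y ∈ S2, y ∈ e} + #{e ∈ E | x ∈ e ∧ ∃ y ∈ S3, y ∈ e} := by
    have hsub : ({e ∈ E | x ∈ e} : Finset (Finset V)) ⊆
        ((D ∪ ({e ∈ E | x ∈ e ∧ ∃ y ∈ S1, y ∈ e} : Finset (Finset V))) ∪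
          ({e ∈ E | x ∈ e ∧ ∃ y ∈ S2, y ∈ e} : Finset (Finset V))) ∪
          ({e ∈ E | x ∈ e ∧ ∃ y ∈ S3, y ∈ e} : Finset (Finset V)) := by
      intro e he
      obtain ⟨he, hx⟩ := mem_filter.mp he
      by_contra hcon
      simp only [mem_union, mem_filter, he, hx, true_and, not_or, not_exists, not_and] at hcon
      obtain ⟨⟨⟨h0, h1⟩, h2⟩, h3⟩ := hcon
      apply h0
      rw [hD, mem_filter, mem_partite]
      have hA : ∀ y ∈ e, y ≠ x → y ∉ At := fun y hy hyx hyA =>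
        h1 y (mem_erase.mpr ⟨hyx, hyA⟩) hy
      refine ⟨he, hx, ⟨?_, ?_⟩, ?_, ?_⟩
      · exact erase_subset_erase _ (subset_univ _)
      · rw [card_erase_of_mem hx, hE e he]; rfl
      · intro y hy z hz hyz
        rw [mem_coe, mem_erase] at hy hz
        by_contra hne
        exact hcross e he y hy.2 z hz.2 (hA y hy.2 hy.1) (hA z hz.2 hz.1) hne hyz
      · intro y hy
        rw [mem_erase] at hy
        rw [mem_erase]
        refine ⟨fun hyi => ?_, mem_univ _⟩
        by_cases hxy : H.Adj x y
        · exact h2 y (by rw [hS2, mem_filter]; exact ⟨mem_univ _, hyi, hxy⟩) hy.2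
        · exact h3 y (by rw [hS3, mem_filter]; exact ⟨mem_univ _, hy.1.symm, hxy⟩) hy.2
    refine (card_le_card hsub).trans ((card_union_le _ _).trans (Nat.add_le_add_right
      ((card_union_le _ _).trans (Nat.add_le_add_right (card_union_le _ _) _)) _))
  have hDB : D.card + (missingLinks E P (q + 2) x i).card ≤
      (partite P (univ.erase x) (univ.erase i) (q + 1)).card := by
    rw [← card_filter_add_card_filter_not (s := partite P (univ.erase x) (univ.erase i) (q + 1))
      (fun Q => insert x Q ∈ E)]
    refine Nat.add_le_add ?_ ?_
    · refine card_le_card_of_injOn (fun e => e.erase x) ?_ ?_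
      · intro e he
        rw [mem_coe, hD, mem_filter] at he
        rw [mem_coe, mem_filter, insert_erase he.2.1]
        exact ⟨he.2.2, he.1⟩
      · intro e he e' he' h
        rw [mem_coe, hD, mem_filter] at he he'
        simp only at h
        rw [← insert_erase he.2.1, h, insert_erase he'.2.1]
    · refine card_le_card fun Q hQ => ?_
      rw [mem_missingLinks] at hQ
      exact mem_filter.mpr hQ
  have hpar : ((partite P (univ.erase x) (univ.erase i) (q + 1)).card : ℝ) ≤
      (k - 1).choose (q + 1) * (1 / k + k * g) ^ (q + 1) * n ^ (q + 1) := by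
    have := card_partite_le P (univ.erase x) (univ.erase i) (q + 1) (a := (1 / k + k * g) * n)
      fun j _ => le_trans (by
        exact_mod_cast card_le_card (filter_subset_filter _ (subset_univ _)))
        (card_part_le P hg.le hP1 j)
    rwa [card_erase_of_mem (mem_univ _), card_univ, Fintype.card_fin, mul_pow, ← mul_assoc] at this
  have e1 : (#{e ∈ E | x ∈ e} : ℝ) ≤ D.card + #{e ∈ E | x ∈ e ∧ ∃ y ∈ S1, y ∈ e} +
      #{e ∈ E | x ∈ e ∧ ∃ y ∈ S2, y ∈ e} + #{e ∈ E | x ∈ e ∧ ∃ y ∈ S3, y ∈ e} := by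
    exact_mod_cast hdeg
  have e2 : (D.card : ℝ) + (missingLinks E P (q + 2) x i).card ≤
      (partite P (univ.erase x) (univ.erase i) (q + 1)).card := by exact_mod_cast hDB
  have hnq : 0 < n ^ q := by positivity
  have e3 : (S1.card : ℝ) * n ^ q ≤ g * n * n ^ q := by
    refine mul_le_mul_of_nonneg_right (le_trans ?_ hP2) hnq.le
    exact_mod_cast card_le_card (erase_subset _ _)
  have e4 : (S2.card : ℝ) * n ^ q ≤ ρ * n * n ^ q := mul_le_mul_of_nonneg_right hi hnq.le
  have e5 : (S3.card : ℝ) * (M * n ^ q / n) ≤ M * n ^ q := by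
    calc (S3.card : ℝ) * (M * n ^ q / n) ≤ n * (M * n ^ q / n) := by
          refine mul_le_mul_of_nonneg_right ?_ (by positivity)
          rw [hnd]; exact_mod_cast card_le_univ _
      _ = _ := by field_simp
  have e6 : M * n ^ q ≤ ρ * n * n ^ q := by
    refine mul_le_mul_of_nonneg_right ?_ hnq.le
    have := hn₃.trans hnV
    rw [div_lt_iff₀ hη] at this
    rw [hρ]
    linarith
  have e7 := mul_le_mul_of_nonneg_right hgη (by positivity : 0 ≤ n * n ^ q)
  have e8 : n ^ (q + 1) = n * n ^ q := by ring
  simp only [show q + 2 - 1 = q + 1 from rfl]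
  rw [e8] at hpar ⊢
  have e9 : 0 < n * n ^ q := by positivity
  rw [hρ] at e4 e6
  nlinarith

theorem exists_degree_le {k t r : ℕ} (hr : 2 ≤ r) (hrk : r ≤ k) (ht : 2 ≤ t) {η : ℝ}
    (hη : 0 < η) :
    ∃ ε : ℝ, 0 < ε ∧ ∃ n₀ : ℕ, ∀ (V : Type) [DecidableEq V] [Fintype V] (E : Finset (Finset V)),
      n₀ ≤ Fintype.card V → (∀ e ∈ E, e.card = r) → ¬ CopyIn (turanPlusEdge k t) E univ →
      (k.choose r / (k : ℝ) ^ r - ε) * (Fintype.card V : ℝ) ^ r ≤ E.card →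
      ∀ x, (#{e ∈ E | x ∈ e} : ℝ) ≤
          ((k - 1).choose (r - 1) / (k : ℝ) ^ (r - 1) + η) * (Fintype.card V : ℝ) ^ (r - 1) := by
  obtain ⟨ε, hε, n₀, h⟩ := exists_partition_link hr hrk ht one_pos hη
  refine ⟨ε, hε, n₀, fun V _ _ E hV hE hfree hcard x => ?_⟩
  obtain ⟨P, -, -, hP⟩ := h V E hV hE hfree hcard
  obtain ⟨i, hi⟩ := hP x
  have : (0 : ℝ) ≤ (missingLinks E P r x i).card := by positivity
  linarith

/-- A dense hypergraph without copies whose minimum degree is almost maximal is `k`-partite. -/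
theorem exists_partition_of_degree {k t r : ℕ} (hr : 2 ≤ r) (hrk : r ≤ k) (ht : 2 ≤ t) :
    ∃ ε : ℝ, 0 < ε ∧ ∃ η : ℝ, 0 < η ∧ ∃ n₀ : ℕ,
      ∀ (V : Type) [DecidableEq V] [Fintype V] (E : Finset (Finset V)),
      n₀ ≤ Fintype.card V → (∀ e ∈ E, e.card = r) → ¬ CopyIn (turanPlusEdge k t) E univ →
      (k.choose r / (k : ℝ) ^ r - ε) * (Fintype.card V : ℝ) ^ r ≤ E.card →
      (∀ x, ((k - 1).choose (r - 1) / (k : ℝ) ^ (r - 1) - η) * (Fintype.card V : ℝ) ^ (r - 1) ≤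
        (#{e ∈ E | x ∈ e} : ℝ)) →
      ∃ P : V → Fin k, E ⊆ partite P univ univ r := by
  have hk : (0 : ℝ) < k := by exact_mod_cast (by omega : 0 < k)
  obtain ⟨γ, hγ, n₁, hn₁⟩ := exists_copyIn_of_common_nbrs (k := k) (t := t) (r := r) (by omega) ht
    (ρ := 1 / (8 * k)) (by positivity)
  obtain ⟨C, hC, n₂, hn₂⟩ := card_not_heavy_mul_le (k := k) (copySize k t r) hr hrk
    (ρ := 1 / (2 * k)) (by positivity)
  set M := copySize k t r with hM
  set η : ℝ := 1 / (32 * k * C) with hη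
  have hη0 : 0 < η := by positivity
  obtain ⟨ε, hε, n₃, hn₃⟩ := exists_partition_link hr hrk ht hγ hη0
  obtain ⟨q, rfl⟩ : ∃ q, r = q + 2 := ⟨r - 2, by omega⟩
  refine ⟨ε, hε, η, hη0, max (max n₁ n₂) (max n₃ (8 * k)),
    fun V _ _ E hV hE hfree hcard hdeg => ?_⟩
  have hV1 : n₁ ≤ Fintype.card V := le_trans (by simp) hV
  have hV2 : n₂ ≤ Fintype.card V := le_trans (by simp) hV
  have hV3 : n₃ ≤ Fintype.card V := le_trans (by simp) hV
  have hV4 : 8 * k ≤ Fintype.card V := le_trans (by simp) hV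
  have hnk : 8 * (k : ℝ) ≤ Fintype.card V := by exact_mod_cast hV4
  have hn : (0 : ℝ) < Fintype.card V := lt_of_lt_of_le (by positivity) hnk
  obtain ⟨P, hP1, hP2, hP3⟩ := hn₃ V E hV3 hE hfree hcard
  rw [← hM] at hP2
  set H := heavyGraph E M with hH
  have hk0 : 0 < 1 / (16 * (k : ℝ)) := by positivity
  have hk2 : 1 / (2 * (k : ℝ)) = 8 * (1 / (16 * k)) := by field_simp; norm_num
  have hk8 : 1 / (8 * (k : ℝ)) = 2 * (1 / (16 * k)) := by field_simp; norm_num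
  set n : ℝ := (Fintype.card V : ℝ) with hnd
  choose i hi using hP3
  have hY : ∀ x, (#{y | P y ≠ i x ∧ y ≠ x ∧ ¬ H.Adj x y} : ℝ) ≤ 1 / (16 * k) * n := by
    intro x
    have h1 : ((missingLinks E P (q + 2) x (i x)).card : ℝ) ≤ 2 * η * n ^ (q + 1) := by
      have h2 := hi x
      have h3 := hdeg x
      simp only [show q + 2 - 1 = q + 1 from rfl] at h2 h3
      linarith
    have h2 := hn₂ V E hV2 hE P hP1 x (i x)
    rw [← hnd, ← hH, Nat.add_sub_cancel] at h2
    refine le_of_mul_le_mul_right (h2.trans ?_) (by positivity : 0 < n ^ q)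
    calc C * ((missingLinks E P (q + 2) x (i x)).card : ℝ) ≤ C * (2 * η * n ^ (q + 1)) :=
          mul_le_mul_of_nonneg_left h1 hC.le
      _ = 1 / (16 * k) * n * n ^ q := by rw [hη]; field_simp; ring
  refine ⟨i, fun e he => mem_partite.mpr ⟨⟨subset_univ _, hE e he⟩, ?_, by simp⟩⟩
  intro y hy z hz hyz
  rw [mem_coe] at hy hz
  by_contra hne
  refine hfree (hn₁ V E hV1 hE P (fun j => le_trans ?_ (hP1 j)) hP2 e he y hy z hz hne (i y)
    fun j hj => ?_)
  · exact mul_le_mul_of_nonneg_right (by rw [hk2, hk8]; linarith) hn.le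
  rw [← hH, ← hnd]
  set Y1 : Finset V := {w | P w ≠ i y ∧ w ≠ y ∧ ¬ H.Adj y w} with hY1
  set Y2 : Finset V := {w | P w ≠ i z ∧ w ≠ z ∧ ¬ H.Adj z w} with hY2
  have h1 : #{v | P v = j} ≤
      #{w | P w = j ∧ H.Adj y w ∧ H.Adj z w} + Y1.card + Y2.card + 2 := by
    have hsub : ({v | P v = j} : Finset V) ⊆
        (({w | P w = j ∧ H.Adj y w ∧ H.Adj z w} : Finset V) ∪ Y1) ∪ Y2 ∪ {y, z} := by
      intro w hw
      simp only [hY1, hY2, mem_union, mem_filter, mem_univ, true_and, mem_insert,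
        mem_singleton] at hw ⊢
      have h1 : P w ≠ i y := hw ▸ hj
      have h2 : P w ≠ i z := hyz ▸ h1
      tauto
    have := card_le_card hsub
    have h2 := card_union_le ((({w | P w = j ∧ H.Adj y w ∧ H.Adj z w} : Finset V) ∪ Y1) ∪ Y2) {y, z}
    have h3 := card_union_le (({w | P w = j ∧ H.Adj y w ∧ H.Adj z w} : Finset V) ∪ Y1) Y2
    have h4 := card_union_le ({w | P w = j ∧ H.Adj y w ∧ H.Adj z w} : Finset V) Y1
    have h5 : ({y, z} : Finset V).card ≤ 2 := card_le_two
    omega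
  have h2 : (#{v | P v = j} : ℝ) ≤
      #{w | P w = j ∧ H.Adj y w ∧ H.Adj z w} + Y1.card + Y2.card + 2 := by exact_mod_cast h1
  have h3 := hP1 j
  have h4 : (2 : ℝ) ≤ 4 * (1 / (16 * k)) * n := by
    calc (2 : ℝ) = 4 * (1 / (16 * k)) * (8 * k) := by field_simp; norm_num
      _ ≤ _ := mul_le_mul_of_nonneg_left hnk (by positivity)
  rw [hk2] at h3
  rw [hk8]
  linarith [hY y, hY z]

/-- The elementary symmetric polynomial of degree `q` in the numbers `a j`, `j ∈ A`. -/
def elemSymm {k : ℕ} (a : Fin k → ℕ) (A : Finset (Fin k)) (q : ℕ) : ℕ :=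
  ∑ J ∈ A.powersetCard q, ∏ j ∈ J, a j

lemma elemSymm_insert {k : ℕ} (a : Fin k → ℕ) {A : Finset (Fin k)} {i : Fin k} (hi : i ∉ A) (q : ℕ) :
    elemSymm a (insert i A) (q + 1) = elemSymm a A (q + 1) + a i * elemSymm a A q := by
  have hni : ∀ J ∈ A.powersetCard q, i ∉ J := fun J hJ h => hi ((mem_powersetCard.mp hJ).1 h)
  rw [elemSymm, powersetCard_succ_insert hi, sum_union, sum_image, elemSymm, elemSymm, mul_sum]
  · congr 1
    exact sum_congr rfl fun J hJ => prod_insert (hni J hJ)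
  · intro J hJ J' hJ' h
    rw [← erase_insert (hni J hJ), ← erase_insert (hni J' hJ')]
    exact congrArg (fun s => s.erase i) h
  · rw [disjoint_left]
    intro J hJ hJ'
    obtain ⟨J', -, rfl⟩ := mem_image.mp hJ'
    exact hi ((mem_powersetCard.mp hJ).1 (mem_insert_self _ _))

lemma elemSymm_congr {k : ℕ} {a b : Fin k → ℕ} {A : Finset (Fin k)} (h : ∀ i ∈ A, a i = b i) (q : ℕ) :
    elemSymm a A q = elemSymm b A q :=
  sum_congr rfl fun _ hJ => prod_congr rfl fun j hj => h j ((mem_powersetCard.mp hJ).1 hj)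

lemma elemSymm_erase {k : ℕ} (a : Fin k → ℕ) {A : Finset (Fin k)} {i : Fin k} (hi : i ∈ A) (q : ℕ) :
    elemSymm a A (q + 1) = elemSymm a (A.erase i) (q + 1) + a i * elemSymm a (A.erase i) q := by
  conv_lhs => rw [← insert_erase hi]
  exact elemSymm_insert a (notMem_erase _ _) q

lemma elemSymm_pair {k : ℕ} (a : Fin k → ℕ) {i j : Fin k} (hij : i ≠ j) (q : ℕ) :
    elemSymm a univ (q + 2) = elemSymm a ((univ.erase j).erase i) (q + 2) +
      (a i + a j) * elemSymm a ((univ.erase j).erase i) (q + 1) +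
      a i * a j * elemSymm a ((univ.erase j).erase i) q := by
  have hi : i ∈ univ.erase j := by simp [hij]
  rw [elemSymm_erase a (mem_univ j), elemSymm_erase a hi, elemSymm_erase a hi]
  ring

/-- Among vectors of given sum, the elementary symmetric polynomials are largest at balanced ones. -/
theorem elemSymm_le_of_balanced {k : ℕ} {b : Fin k → ℕ} (hb : ∀ i j, b j ≤ b i + 1) (q : ℕ) :
    ∀ (d : ℕ) (a : Fin k → ℕ), ∑ i, a i = ∑ i, b i → ∑ i, (a i - b i) = d →
      elemSymm a univ (q + 2) ≤ elemSymm b univ (q + 2) := by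
  intro d
  induction d with
  | zero =>
    intro a hab h0
    have h1 : ∀ i, a i ≤ b i := by
      intro i
      have := sum_eq_zero_iff.mp h0 i (mem_univ i)
      omega
    have h2 : ∀ i, a i = b i := fun i =>
      (sum_eq_sum_iff_of_le fun i _ => h1 i).mp hab i (mem_univ i)
    exact (elemSymm_congr (fun i _ => h2 i) _).le
  | succ d ih =>
    intro a hab hd
    obtain ⟨i, hi⟩ : ∃ i, b i < a i := by
      by_contra! h
      rw [sum_eq_zero fun i _ => Nat.sub_eq_zero_of_le (h i)] at hd
      omega
    obtain ⟨j, hj⟩ : ∃ j, a j < b j := by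
      by_contra! h
      exact (sum_lt_sum (fun i _ => h i) ⟨i, mem_univ i, hi⟩).ne' hab
    have hij : i ≠ j := by rintro rfl; omega
    have hbij := hb i j
    set a' : Fin k → ℕ := Function.update (Function.update a j (a j + 1)) i (a i - 1) with ha'
    have hai : a' i = a i - 1 := by simp [ha']
    have haj : a' j = a j + 1 := by simp [ha', hij.symm]
    have hae : ∀ l ∈ (univ.erase j).erase i, a' l = a l := by
      intro l hl
      simp only [mem_erase, mem_univ, and_true] at hl
      simp [ha', hl.1, hl.2]
    have hsplit : ∀ f : Fin k → ℕ, ∑ l, f l = f j + (f i + ∑ l ∈ (univ.erase j).erase i, f l) := by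
      intro f
      rw [add_sum_erase _ _ (by simp [hij]), add_sum_erase _ _ (mem_univ _)]
    have hstep : elemSymm a univ (q + 2) ≤ elemSymm a' univ (q + 2) := by
      rw [elemSymm_pair a hij, elemSymm_pair a' hij, hai, haj, elemSymm_congr hae,
        elemSymm_congr hae, elemSymm_congr hae]
      have h1 : a i - 1 + (a j + 1) = a i + a j := by omega
      rw [h1]
      refine Nat.add_le_add_left (Nat.mul_le_mul_right _ ?_) _
      obtain ⟨c, hc⟩ : ∃ c, a i = c + 1 := ⟨a i - 1, by omega⟩
      rw [hc, Nat.add_sub_cancel]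
      have : a j ≤ c := by omega
      nlinarith
    refine hstep.trans (ih a' ?_ ?_)
    · have hs : ∑ l ∈ (univ.erase j).erase i, a' l = ∑ l ∈ (univ.erase j).erase i, a l :=
        sum_congr rfl hae
      rw [← hab, hsplit, hsplit a, hai, haj, hs]
      omega
    · rw [hsplit] at hd ⊢
      rw [hai, haj, sum_congr rfl fun l hl => by rw [hae l hl]]
      omega

/-- The sizes of the parts of the balanced partition of `n` vertices. -/
def balancedSize (k n : ℕ) (j : Fin k) : ℕ := n / k + if j.val < n % k then 1 else 0

lemma card_fin_mod_eq (k n : ℕ) (j : Fin k) :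
    #{v : Fin n | v.val % k = j.val} = balancedSize k n j := by
  have h1 := Nat.count_modEq_card n j.pos j.val
  rw [Nat.mod_eq_of_lt j.isLt] at h1
  rw [balancedSize, ← h1, Nat.count_eq_card_filter_range, ← card_map Fin.valEmbedding]
  congr 1
  ext v
  simp only [mem_map, mem_filter, mem_univ, true_and, Fin.valEmbedding_apply, mem_range, Nat.ModEq,
    Nat.mod_eq_of_lt j.isLt]
  exact ⟨fun ⟨w, h, hw⟩ => hw ▸ ⟨w.isLt, h⟩, fun ⟨h, h'⟩ => ⟨⟨v, h⟩, h', rfl⟩⟩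

lemma balancedSize_succ {k : ℕ} (hk : 0 < k) (n : ℕ) (j : Fin k) :
    balancedSize k (n + 1) j = balancedSize k n j + if n % k = j.val then 1 else 0 := by
  have h := fun m => Nat.count_modEq_card m hk j.val
  simp only [Nat.mod_eq_of_lt j.isLt] at h
  rw [balancedSize, balancedSize, ← h, ← h, Nat.count_succ]
  simp only [Nat.ModEq, Nat.mod_eq_of_lt j.isLt]

lemma le_balancedSize {k : ℕ} (n : ℕ) (j : Fin k) : (n : ℝ) / k - 1 ≤ balancedSize k n j := by
  have h1 : (n : ℝ) / k < (n / k : ℕ) + 1 := by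
    have := Nat.lt_floor_add_one ((n : ℝ) / k)
    rwa [Nat.floor_div_eq_div] at this
  rw [balancedSize]
  push_cast
  split_ifs <;> linarith

lemma balancedSize_le {k : ℕ} (n : ℕ) (j : Fin k) : (balancedSize k n j : ℝ) ≤ n / k + 1 := by
  have h1 : ((n / k : ℕ) : ℝ) ≤ n / k := Nat.cast_div_le
  rw [balancedSize]
  push_cast
  split_ifs <;> linarith

/-- The number of edges of the complete balanced `k`-partite `r`-graph. -/
lemma turanPlusCount_zero {k : ℕ} (hk : 0 < k) (r n : ℕ) :
    turanPlusCount r n k 0 = elemSymm (balancedSize k n) univ r := by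
  have h := card_partite (fun v : Fin n => (⟨v.val % k, Nat.mod_lt _ hk⟩ : Fin k)) univ univ r
  have h2 : ∀ j : Fin k, #{v : Fin n | (⟨v.val % k, Nat.mod_lt _ hk⟩ : Fin k) = j} =
      balancedSize k n j := by
    intro j
    rw [← card_fin_mod_eq]
    congr 1
    ext v
    simp [Fin.ext_iff]
  rw [elemSymm, ← sum_congr rfl fun J _ => prod_congr rfl fun j _ => h2 j, ← h, turanPlusCount,
    Nat.card_eq_fintype_card, Fintype.card_subtype]
  congr 1
  ext e
  simp [mem_partite, Set.InjOn, Fin.ext_iff]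

lemma sum_balancedSize {k : ℕ} (hk : 0 < k) (n : ℕ) : ∑ j, balancedSize k n j = n := by
  induction n with
  | zero => simp [balancedSize]
  | succ n ih =>
    simp only [balancedSize_succ hk, sum_add_distrib, ih]
    congr 1
    rw [sum_eq_single ⟨n % k, Nat.mod_lt _ hk⟩] <;> simp [Fin.ext_iff, eq_comm]

/-- A `k`-partite hypergraph has at most as many edges as the balanced one. -/
theorem card_partite_le_turan {V : Type} [DecidableEq V] [Fintype V] {k r : ℕ} (hk : 0 < k) (hr : 2 ≤ r)
    (P : V → Fin k) : (partite P univ univ r).card ≤ turanPlusCount r (Fintype.card V) k 0 := by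
  obtain ⟨q, rfl⟩ : ∃ q, r = q + 2 := ⟨r - 2, by omega⟩
  rw [card_partite, turanPlusCount_zero hk]
  refine elemSymm_le_of_balanced (fun i j => ?_) q _ (fun j => #{v | P v = j}) ?_ rfl
  · unfold balancedSize
    split_ifs <;> omega
  · rw [sum_balancedSize hk]
    exact (card_eq_sum_card_fiberwise fun v _ => by simp).symm

lemma turanPlusCount_zero_succ {k : ℕ} (hk : 0 < k) (r n : ℕ) :
    turanPlusCount (r + 1) (n + 1) k 0 = turanPlusCount (r + 1) n k 0 +
      elemSymm (balancedSize k n) (univ.erase ⟨n % k, Nat.mod_lt _ hk⟩) r := by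
  set i : Fin k := ⟨n % k, Nat.mod_lt _ hk⟩ with hi
  have h3 : ∀ j ∈ univ.erase i, balancedSize k (n + 1) j = balancedSize k n j := by
    intro j hj
    rw [balancedSize_succ hk, if_neg, add_zero]
    intro h
    exact (mem_erase.mp hj).1 (Fin.ext h.symm)
  have h4 : balancedSize k (n + 1) i = balancedSize k n i + 1 := by
    rw [balancedSize_succ hk, if_pos rfl]
  rw [turanPlusCount_zero hk, turanPlusCount_zero hk, elemSymm_erase _ (mem_univ i),
    elemSymm_erase (balancedSize k n) (mem_univ i), elemSymm_congr h3, elemSymm_congr h3, h4]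
  ring

lemma elemSymm_le {k : ℕ} (a : Fin k → ℕ) (A : Finset (Fin k)) (q : ℕ) {c : ℝ}
    (h : ∀ j ∈ A, (a j : ℝ) ≤ c) : (elemSymm a A q : ℝ) ≤ A.card.choose q * c ^ q := by
  rw [elemSymm, ← card_powersetCard, ← nsmul_eq_mul]
  push_cast
  refine sum_le_card_nsmul _ _ _ fun J hJ => ?_
  obtain ⟨hJA, hJc⟩ := mem_powersetCard.mp hJ
  rw [← hJc, ← prod_const]
  exact prod_le_prod (fun _ _ => by positivity) fun j hj => h j (hJA hj)

lemma le_elemSymm {k : ℕ} (a : Fin k → ℕ) (A : Finset (Fin k)) (q : ℕ) {c : ℝ} (hc : 0 ≤ c)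
    (h : ∀ j ∈ A, c ≤ (a j : ℝ)) : A.card.choose q * c ^ q ≤ (elemSymm a A q : ℝ) := by
  rw [elemSymm, ← card_powersetCard, ← nsmul_eq_mul]
  push_cast
  refine card_nsmul_le_sum _ _ _ fun J hJ => ?_
  obtain ⟨hJA, hJc⟩ := mem_powersetCard.mp hJ
  rw [← hJc, ← prod_const]
  exact prod_le_prod (fun _ _ => hc) fun j hj => h j (hJA hj)

/-- The edges of `T_r(n, k, i)`. -/
noncomputable def turanPlusEdges (r n k i : ℕ) : Finset (Finset (Fin n)) :=
  {e | e.card = r ∧ ((∃ v ∈ e, v.val < i) ∨ Set.InjOn (fun v : Fin n => (v.val - i) % k) ↑e)}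

lemma card_turanPlusEdges (r n k i : ℕ) : (turanPlusEdges r n k i).card = turanPlusCount r n k i := by
  rw [turanPlusCount, Nat.card_eq_fintype_card, Fintype.card_subtype, turanPlusEdges]

lemma turanPlusCount_le_succ (r n k i : ℕ) : turanPlusCount r n k i ≤ turanPlusCount r n k (i + 1) := by
  rw [← card_turanPlusEdges, ← card_turanPlusEdges]
  refine card_le_card fun e he => ?_
  simp only [turanPlusEdges, mem_filter, mem_univ, true_and] at he ⊢
  refine ⟨he.1, ?_⟩
  rcases he.2 with ⟨v, hv, h⟩ | h
  · exact Or.inl ⟨v, hv, by omega⟩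
  by_cases h0 : ∃ v ∈ e, v.val < i + 1
  · exact Or.inl h0
  push Not at h0
  refine Or.inr fun v hv w hw hvw => h hv hw ?_
  have h1 := h0 v hv
  have h2 := h0 w hw
  have h3 : (v.val - (i + 1)) + 1 ≡ (w.val - (i + 1)) + 1 [MOD k] := Nat.ModEq.add_right 1 hvw
  have h4 : v.val - (i + 1) + 1 = v.val - i := by omega
  have h5 : w.val - (i + 1) + 1 = w.val - i := by omega
  rwa [h4, h5] at h3

lemma turanPlusCount_mono (r n k : ℕ) {i j : ℕ} (hij : i ≤ j) :
    turanPlusCount r n k i ≤ turanPlusCount r n k j :=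
  monotone_nat_of_le_succ (fun i => turanPlusCount_le_succ r n k i) hij

lemma turanPlusCount_succ (r n k i : ℕ) :
    turanPlusCount (r + 1) (n + 1) k (i + 1) = n.choose r + turanPlusCount (r + 1) n k i := by
  rw [← card_turanPlusEdges, ← card_turanPlusEdges,
    ← card_filter_add_card_filter_not (s := turanPlusEdges _ _ _ _) fun e => (0 : Fin (n + 1)) ∈ e]
  congr 1
  · have h1 : ((univ : Finset (Fin (n + 1))).erase 0).card = n := by simp
    have h2 : n.choose r = (((univ : Finset (Fin (n + 1))).erase 0).powersetCard r).card := by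
      rw [card_powersetCard, h1]
    rw [h2]
    refine card_bij' (fun e _ => e.erase 0) (fun e _ => insert 0 e) ?_ ?_ ?_ ?_
    · intro e he
      simp only [turanPlusEdges, mem_filter, mem_univ, true_and] at he
      rw [mem_powersetCard, card_erase_of_mem he.2, he.1.1]
      exact ⟨erase_subset_erase _ (subset_univ _), rfl⟩
    · intro e he
      rw [mem_powersetCard] at he
      have h0 : (0 : Fin (n + 1)) ∉ e := fun h => by simpa using he.1 h
      simp only [turanPlusEdges, mem_filter, mem_univ, true_and]
      exact ⟨⟨by rw [card_insert_of_notMem h0, he.2],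
        Or.inl ⟨0, mem_insert_self _ _, Nat.succ_pos i⟩⟩, mem_insert_self _ _⟩
    · intro e he
      exact insert_erase (mem_filter.mp he).2
    · intro e he
      rw [mem_powersetCard] at he
      exact erase_insert fun h => (mem_erase.mp (he.1 h)).1 rfl
  · refine Eq.symm (card_bij (fun e _ => e.map (Fin.succEmb n)) ?_ ?_ ?_)
    · intro e he
      simp only [turanPlusEdges, mem_filter, mem_univ, true_and] at he ⊢
      refine ⟨⟨by rw [card_map, he.1], ?_⟩, by simp⟩
      rcases he.2 with ⟨v, hv, h⟩ | h
      · exact Or.inl ⟨v.succ, by simpa using hv, by simpa using h⟩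
      · refine Or.inr ?_
        intro v hv w hw hvw
        simp only [coe_map, Set.mem_image, mem_coe] at hv hw
        obtain ⟨v, hv, rfl⟩ := hv
        obtain ⟨w, hw, rfl⟩ := hw
        simp only [Fin.coe_succEmb, Fin.val_succ, Nat.add_sub_add_right] at hvw
        rw [h hv hw hvw]
    · intro e _ e' _ h
      exact map_injective _ h
    · intro e he
      simp only [turanPlusEdges, mem_filter, mem_univ, true_and] at he
      obtain ⟨⟨h1, h2⟩, h0⟩ := he
      have he : ({v | v.succ ∈ e} : Finset (Fin n)).map (Fin.succEmb n) = e := by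
        ext v
        simp only [mem_map, mem_filter, mem_univ, true_and, Fin.coe_succEmb]
        constructor
        · rintro ⟨w, hw, rfl⟩
          exact hw
        · intro hv
          obtain ⟨w, rfl⟩ := Fin.exists_succ_eq.mpr (fun h : v = 0 => h0 (h ▸ hv))
          exact ⟨w, hv, rfl⟩
      refine ⟨({v | v.succ ∈ e} : Finset (Fin n)), ?_, he⟩
      simp only [turanPlusEdges, mem_filter, mem_univ, true_and]
      refine ⟨by rw [← h1, ← he, card_map, he], ?_⟩
      rcases h2 with ⟨v, hv, h⟩ | h
      · obtain ⟨w, rfl⟩ := Fin.exists_succ_eq.mpr (fun h : v = 0 => h0 (h ▸ hv))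
        exact Or.inl ⟨w, hv, by simpa using h⟩
      · refine Or.inr fun v hv w hw hvw => ?_
        simp only [coe_filter, mem_univ, true_and, Set.mem_ofPred_eq] at hv hw
        exact Fin.succ_injective _ (h hv hw (by simpa using hvw))

lemma exists_mul_pow_bounds (A a b : ℝ) (q : ℕ) {ε : ℝ} (hε : 0 < ε) :
    ∃ n₀ : ℕ, ∀ n : ℕ, n₀ ≤ n → (A * a ^ q - ε) * (n : ℝ) ^ q ≤ A * (a * n + b) ^ q ∧
      A * (a * n + b) ^ q ≤ (A * a ^ q + ε) * (n : ℝ) ^ q ∧ 0 < n := by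
  have h1 : Filter.Tendsto (fun n : ℕ => A * (a + b / (n : ℝ)) ^ q) Filter.atTop
      (nhds (A * (a + 0) ^ q)) :=
    ((tendsto_const_nhds.add (tendsto_const_div_atTop_nhds_zero_nat b)).pow q).const_mul A
  rw [add_zero] at h1
  have h2 := (h1.eventually (lt_mem_nhds (by linarith : A * a ^ q - ε < A * a ^ q))).and
    (h1.eventually (gt_mem_nhds (by linarith : A * a ^ q < A * a ^ q + ε)))
  obtain ⟨n₀, hn₀⟩ := Filter.eventually_atTop.mp (h2.and (Filter.eventually_gt_atTop 0))
  refine ⟨n₀, fun n hn => ?_⟩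
  obtain ⟨⟨h3, h4⟩, h5⟩ := hn₀ n hn
  have hn0 : (0 : ℝ) < n := by exact_mod_cast h5
  have h6 : A * (a * n + b) ^ q = A * (a + b / n) ^ q * (n : ℝ) ^ q := by
    rw [mul_assoc, ← mul_pow]
    congr 2
    field_simp
  rw [h6]
  exact ⟨mul_le_mul_of_nonneg_right h3.le (by positivity),
    mul_le_mul_of_nonneg_right h4.le (by positivity), h5⟩

lemma exists_le_turanPlusCount {k : ℕ} (hk : 0 < k) (r : ℕ) {ε : ℝ} (hε : 0 < ε) :
    ∃ n₀ : ℕ, ∀ n : ℕ, n₀ ≤ n →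
      (k.choose r / (k : ℝ) ^ r - ε) * (n : ℝ) ^ r ≤ turanPlusCount r n k 0 := by
  obtain ⟨n₀, h⟩ := exists_mul_pow_bounds (k.choose r) (1 / k) (-1) r hε
  refine ⟨max n₀ k, fun n hn => ?_⟩
  have h1 := (h n (le_trans (by simp) hn)).1
  have hkn : (k : ℝ) ≤ n := by exact_mod_cast (le_max_right _ _).trans hn
  have hk0 : (0 : ℝ) < k := by exact_mod_cast hk
  rw [turanPlusCount_zero hk]
  have h2 := le_elemSymm (balancedSize k n) univ r (c := 1 / k * n + -1)
    (by rw [one_div_mul_eq_div]; have := (one_le_div hk0).mpr hkn; linarith)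
    (fun j _ => by rw [one_div_mul_eq_div]; exact le_balancedSize n j)
  rw [card_univ, Fintype.card_fin] at h2
  rw [one_div_pow, mul_one_div] at h1
  exact h1.trans h2

lemma exists_turanPlusCount_succ_ge {k : ℕ} (hk : 0 < k) (q K : ℕ) {η : ℝ} (hη : 0 < η) :
    ∃ n₀ : ℕ, ∀ n m : ℕ, n₀ ≤ n → m ≤ n → n ≤ m + K →
      ((k - 1).choose q / (k : ℝ) ^ q - η) * (n : ℝ) ^ q + turanPlusCount (q + 1) m k 0 ≤
        turanPlusCount (q + 1) (m + 1) k 0 := by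
  obtain ⟨n₀, h⟩ := exists_mul_pow_bounds ((k - 1).choose q) (1 / k) (-(K / k + 1)) q hη
  refine ⟨max n₀ (K + k), fun n m hn hm hK => ?_⟩
  have h1 := (h n (le_trans (by simp) hn)).1
  have hkn : (K + k : ℝ) ≤ n := by exact_mod_cast (le_max_right _ _).trans hn
  have hk0 : (0 : ℝ) < k := by exact_mod_cast hk
  have hK' : (n : ℝ) ≤ m + K := by exact_mod_cast hK
  rw [one_div_pow, mul_one_div] at h1
  have h3 : (1 : ℝ) / k * n + -(K / k + 1) = (n - K) / k - 1 := by ring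
  have h2 := le_elemSymm (balancedSize k m) (univ.erase ⟨m % k, Nat.mod_lt _ hk⟩) q
    (c := 1 / k * n + -(K / k + 1))
    (by rw [h3]; have := (one_le_div hk0).mpr (by linarith : (k : ℝ) ≤ n - K); linarith)
    (fun j _ => by
      rw [h3]
      refine le_trans ?_ (le_balancedSize m j)
      have : ((n : ℝ) - K) / k ≤ m / k := div_le_div_of_nonneg_right (by linarith) hk0.le
      linarith)
  rw [card_erase_of_mem (mem_univ _), card_univ, Fintype.card_fin] at h2
  rw [turanPlusCount_zero_succ hk]
  push_cast
  linarith

lemma exists_turanPlusCount_sub_le {k : ℕ} (hk : 0 < k) (q K : ℕ) {η : ℝ} (hη : 0 < η) :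
    ∃ n₀ : ℕ, ∀ n c : ℕ, n₀ ≤ n → c ≤ K →
      c * ((k - 1).choose q / (k : ℝ) ^ q - η) * (n : ℝ) ^ q + turanPlusCount (q + 1) (n - c) k 0 ≤
        turanPlusCount (q + 1) n k 0 := by
  obtain ⟨n₀, h⟩ := exists_turanPlusCount_succ_ge hk q K hη
  refine ⟨max n₀ K, fun n c hn => ?_⟩
  have hKn := (le_max_right _ _).trans hn
  induction c with
  | zero => simp
  | succ c ih =>
    intro hc
    have h1 := h n (n - (c + 1)) ((le_max_left _ _).trans hn) (by omega) (by omega)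
    have h2 := ih (by omega)
    rw [show n - (c + 1) + 1 = n - c by omega] at h1
    push_cast
    linarith

lemma exists_turanPlusCount_one_ge {k q : ℕ} (hk : 0 < k) (hq : 0 < q) :
    ∃ κ : ℝ, 0 < κ ∧ ∃ n₀ : ℕ, ∀ n : ℕ, n₀ ≤ n →
      κ * (n : ℝ) ^ q + turanPlusCount (q + 1) n k 0 ≤ turanPlusCount (q + 1) n k 1 := by
  have hk0 : (0 : ℝ) < k := by exact_mod_cast hk
  have hlt : ((k - 1).choose q : ℝ) / (k : ℝ) ^ q < 1 / q.factorial := by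
    rw [div_lt_div_iff₀ (by positivity) (by positivity), one_mul]
    have h1 : (k - 1).choose q * q.factorial < k ^ q := by
      rw [mul_comm, ← Nat.descFactorial_eq_factorial_mul_choose]
      exact (Nat.descFactorial_le_pow _ _).trans_lt (Nat.pow_lt_pow_left (by omega) hq.ne')
    exact_mod_cast h1
  set κ : ℝ := (1 / q.factorial - (k - 1).choose q / (k : ℝ) ^ q) / 3 with hκ
  have hκ0 : 0 < κ := by rw [hκ]; linarith
  obtain ⟨n₁, h1⟩ := exists_mul_pow_bounds (1 / q.factorial) 1 (-q) q hκ0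
  obtain ⟨n₂, h2⟩ := exists_mul_pow_bounds ((k - 1).choose q) (1 / k) 1 q hκ0
  refine ⟨κ, hκ0, max (max n₁ n₂) (q + 1), fun n hn => ?_⟩
  have h3 := (h1 n (le_trans (by simp) hn)).1
  have h4 := (h2 n (le_trans (by simp) hn)).2.1
  obtain ⟨m, rfl⟩ : ∃ m, n = m + 1 := ⟨n - 1, by have := (le_max_right _ _).trans hn; omega⟩
  have hm : q ≤ m := by have := (le_max_right _ _).trans hn; omega
  have h5 := elemSymm_le (balancedSize k m) (univ.erase ⟨m % k, Nat.mod_lt _ hk⟩) q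
    (c := 1 / k * ((m + 1 : ℕ) : ℝ) + 1)
    (fun j _ => by
      refine (balancedSize_le m j).trans ?_
      rw [one_div_mul_eq_div]
      have : (m : ℝ) / k ≤ ((m + 1 : ℕ) : ℝ) / k :=
        div_le_div_of_nonneg_right (by push_cast; linarith) hk0.le
      linarith)
  rw [card_erase_of_mem (mem_univ _), card_univ, Fintype.card_fin] at h5
  have h6 : 1 / (q.factorial : ℝ) * (1 * ((m + 1 : ℕ) : ℝ) + -q) ^ q ≤ m.choose q := by
    have h7 : ((m + 1 - q : ℕ) : ℝ) ^ q / q.factorial ≤ m.choose q := Nat.pow_le_choose q m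
    rw [Nat.cast_sub (by omega)] at h7
    rw [one_div_mul_eq_div, one_mul, ← sub_eq_add_neg]
    exact h7
  rw [turanPlusCount_succ, turanPlusCount_zero_succ hk]
  rw [one_pow, mul_one] at h3
  rw [one_div_pow, mul_one_div] at h4
  have h8 : κ * ((m + 1 : ℕ) : ℝ) ^ q = (1 / q.factorial - κ) * ((m + 1 : ℕ) : ℝ) ^ q -
      ((k - 1).choose q / (k : ℝ) ^ q + κ) * ((m + 1 : ℕ) : ℝ) ^ q := by
    rw [← sub_mul]
    congr 1
    rw [hκ]
    ring
  push_cast at *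
  linarith

/-- The edges of `E` inside `W`, as sets of elements of the subtype `W`. -/
noncomputable def restrictTo {V : Type} (E : Finset (Finset V)) (W : Finset V) : Finset (Finset W) :=
  {e | e.map (Function.Embedding.subtype _) ∈ E}

lemma mem_restrictTo {V : Type} {E : Finset (Finset V)} {W : Finset V} {e : Finset W} :
    e ∈ restrictTo E W ↔ e.map (Function.Embedding.subtype _) ∈ E := by
  simp [restrictTo]

lemma card_of_mem_restrictTo {V : Type} {E : Finset (Finset V)} {W : Finset V} {r : ℕ} (hE : ∀ e ∈ E, e.card = r) :
    ∀ e ∈ restrictTo E W, e.card = r := by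
  intro e he
  rw [← hE _ (mem_restrictTo.mp he), card_map]

section
variable {V : Type} [DecidableEq V]

lemma card_restrictTo (E : Finset (Finset V)) (W : Finset V) :
    (restrictTo E W).card = #{e ∈ E | e ⊆ W} := by
  refine card_bij (fun e _ => e.map (Function.Embedding.subtype _)) ?_ ?_ ?_
  · intro e he
    rw [mem_filter]
    exact ⟨mem_restrictTo.mp he, map_subtype_subset e⟩
  · intro e _ e' _ h
    exact map_injective _ h
  · intro e he
    rw [mem_filter] at he
    have h : (e.subtype (· ∈ W)).map (Function.Embedding.subtype _) = e :=
      subtype_map_of_mem fun x hx => he.2 hx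
    exact ⟨e.subtype (· ∈ W), mem_restrictTo.mpr (h.symm ▸ he.1), h⟩

lemma card_restrictTo_mem (E : Finset (Finset V)) (W : Finset V) (x : W) :
    #{e ∈ restrictTo E W | x ∈ e} = #{e ∈ E | e ⊆ W ∧ x.1 ∈ e} := by
  have h1 : ({e ∈ restrictTo E W | x ∈ e} : Finset (Finset W)) =
      restrictTo (E.filter fun e => x.1 ∈ e) W := by
    ext e
    simp [mem_restrictTo]
  rw [h1, card_restrictTo, filter_filter]
  congr 1
  ext e
  simp [and_comm]

lemma CopyIn.of_restrictTo {β : Type} {F : SimpleGraph β} {E : Finset (Finset V)} {W : Finset V}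
    (h : CopyIn F (restrictTo E W) univ) : CopyIn F E W := by
  obtain ⟨φ, S, -, -, h3, h4, h5⟩ := h
  refine ⟨φ.trans (Function.Embedding.subtype _),
    fun e => (S e).map (Function.Embedding.subtype _), fun a => (φ a).2,
    fun e _ => map_subtype_subset _, ?_, ?_, ?_⟩
  · intro e he a ha
    simp only [Function.Embedding.trans_apply, mem_map'] at ha
    exact h3 e he a ha
  · intro e he e' he' hne
    exact (disjoint_map _).mpr (h4 e he e' he' hne)
  · intro a b hab
    have := mem_restrictTo.mp (h5 a b hab)
    rw [map_insert, map_insert] at this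
    exact this

end

/-- A copy-free hypergraph with more edges than the Turán hypergraph has a vertex of small degree. -/
theorem exists_small_degree {k t r : ℕ} (hr : 2 ≤ r) (hrk : r ≤ k) (ht : 2 ≤ t) :
    ∃ m₀ : ℕ, ∀ (V : Type) [DecidableEq V] (E : Finset (Finset V)) (W : Finset V),
      m₀ ≤ W.card → (∀ e ∈ E, e.card = r) → ¬ CopyIn (turanPlusEdge k t) E W →
      turanPlusCount r W.card k 0 < #{e ∈ E | e ⊆ W} →
      ∃ x ∈ W, #{e ∈ E | e ⊆ W ∧ x ∈ e} + turanPlusCount r (W.card - 1) k 0 <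
        turanPlusCount r W.card k 0 := by
  have hk : 0 < k := by omega
  obtain ⟨ε, hε, η, hη, n₁, h1⟩ := exists_partition_of_degree hr hrk ht
  obtain ⟨n₂, h2⟩ := exists_le_turanPlusCount hk r hε
  obtain ⟨n₃, h3⟩ := exists_turanPlusCount_succ_ge hk (r - 1) 1 hη
  refine ⟨max (max n₁ n₂) (max n₃ 1), fun V _ E W hW hE hfree hcard => ?_⟩
  by_contra! hdeg
  have hW1 : 1 ≤ W.card := le_trans (by simp) hW
  have h2' := h2 W.card (le_trans (by simp) hW)
  have h3' := h3 W.card (W.card - 1) (le_trans (by simp) hW) (by omega) (by omega)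
  rw [show r - 1 + 1 = r by omega, show W.card - 1 + 1 = W.card by omega] at h3'
  obtain ⟨P, hP⟩ := h1 W (restrictTo E W) (by rw [Fintype.card_coe]; exact le_trans (by simp) hW)
    (card_of_mem_restrictTo hE) (fun h => hfree h.of_restrictTo)
    (by
      rw [Fintype.card_coe, card_restrictTo]
      exact h2'.trans (by exact_mod_cast hcard.le))
    (fun x => by
      rw [Fintype.card_coe, card_restrictTo_mem]
      have h4 : (turanPlusCount r W.card k 0 : ℝ) ≤
          #{e ∈ E | e ⊆ W ∧ x.1 ∈ e} + turanPlusCount r (W.card - 1) k 0 := by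
        exact_mod_cast hdeg x.1 x.2
      linarith)
  have h5 := (card_le_card hP).trans (card_partite_le_turan hk hr P)
  rw [Fintype.card_coe, card_restrictTo] at h5
  omega

/-- The Turán number of the expansion of a complete `k`-partite graph plus an edge. -/
theorem exists_card_le_turan {k t r : ℕ} (hr : 2 ≤ r) (hrk : r ≤ k) (ht : 2 ≤ t) :
    ∃ n₀ : ℕ, ∀ (V : Type) [DecidableEq V] (E : Finset (Finset V)) (W : Finset V),
      n₀ ≤ W.card → (∀ e ∈ E, e.card = r) → ¬ CopyIn (turanPlusEdge k t) E W →
      #{e ∈ E | e ⊆ W} ≤ turanPlusCount r W.card k 0 := by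
  obtain ⟨m₀, h⟩ := exists_small_degree hr hrk ht
  have key : ∀ (V : Type) [DecidableEq V] (E : Finset (Finset V)), (∀ e ∈ E, e.card = r) →
      ∀ (d : ℕ) (W : Finset V), W.card = m₀ + d → ¬ CopyIn (turanPlusEdge k t) E W →
      turanPlusCount r W.card k 0 < #{e ∈ E | e ⊆ W} →
      #{e ∈ E | e ⊆ W} + d ≤ turanPlusCount r W.card k 0 + 2 ^ m₀ := by
    intro V _ E hE d
    induction d with
    | zero =>
      intro W hW _ _
      have h1 : #{e ∈ E | e ⊆ W} ≤ W.powerset.card :=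
        card_le_card fun e he => mem_powerset.mpr (mem_filter.mp he).2
      rw [card_powerset, hW] at h1
      rw [add_zero] at h1 ⊢
      omega
    | succ d ih =>
      intro W hW hfree hcard
      obtain ⟨x, hx, hdeg⟩ := h V E W (by omega) hE hfree hcard
      have hc : (W.erase x).card = W.card - 1 := card_erase_of_mem hx
      have h1 : #{e ∈ E | e ⊆ W} = #{e ∈ E | e ⊆ W ∧ x ∈ e} + #{e ∈ E | e ⊆ W.erase x} := by
        rw [← card_filter_add_card_filter_not (s := {e ∈ E | e ⊆ W}) fun e => x ∈ e,
          filter_filter, filter_filter]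
        congr 2
        ext e
        simp [subset_erase]
      have h2 := ih (W.erase x) (by omega)
        (fun hcopy => hfree (hcopy.mono (Subset.refl _) (erase_subset _ _))) (by rw [hc]; omega)
      rw [hc] at h2
      omega
  refine ⟨m₀ + 2 ^ m₀, fun V _ E W hW hE hfree => ?_⟩
  by_contra! hcard
  have hW' : m₀ ≤ W.card := (Nat.le_add_right _ _).trans hW
  have := key V E hE (W.card - m₀) W (by omega) hfree hcard
  omega

/-- `E` contains `s` pairwise disjoint expansions of `F` inside `W`. -/
def DisjointCopiesIn {V β : Type} [DecidableEq V] (F : SimpleGraph β) (E : Finset (Finset V)) :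
    ℕ → Finset V → Prop
  | 0, _ => True
  | s + 1, W => ∃ X ⊆ W, CopyIn F E X ∧ DisjointCopiesIn F E s (W \ X)

section
variable {V β : Type} [DecidableEq V] {F : SimpleGraph β} {E : Finset (Finset V)}

lemma DisjointCopiesIn.mono {s : ℕ} {W W' : Finset V} (hW : W ⊆ W') (h : DisjointCopiesIn F E s W) :
    DisjointCopiesIn F E s W' := by
  induction s generalizing W W' with
  | zero => trivial
  | succ s ih =>
    obtain ⟨X, hX, h1, h2⟩ := h
    exact ⟨X, hX.trans hW, h1, ih (sdiff_subset_sdiff hW (Subset.refl _)) h2⟩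

lemma DisjointCopiesIn.exists_small [Fintype β] {r : ℕ} (hE : ∀ e ∈ E, e.card = r) {s : ℕ}
    {W : Finset V} (h : DisjointCopiesIn F E s W) :
    ∃ Y ⊆ W, Y.card ≤ s * (Fintype.card β + Fintype.card (Sym2 β) * r) ∧
      DisjointCopiesIn F E s Y := by
  induction s generalizing W with
  | zero => exact ⟨∅, empty_subset _, by simp, trivial⟩
  | succ s ih =>
    obtain ⟨X, hX, h1, h2⟩ := h
    obtain ⟨X', hX', hc, h3⟩ := h1.exists_small hE
    obtain ⟨Y, hY, hcY, h4⟩ := ih h2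
    refine ⟨X' ∪ Y, union_subset (hX'.trans hX) (hY.trans sdiff_subset), ?_, X', subset_union_left,
      h3, h4.mono fun y hy => ?_⟩
    · refine (card_union_le _ _).trans ?_
      rw [add_mul, one_mul]
      omega
    · exact mem_sdiff.mpr ⟨mem_union_right _ hy, fun h => (mem_sdiff.mp (hY hy)).2 (hX' h)⟩

/-- Without many disjoint copies, a bounded set of vertices meets all copies. -/
lemma exists_cover_of_not_disjointCopiesIn [Fintype β] {r : ℕ} (hE : ∀ e ∈ E, e.card = r) {s : ℕ}
    {W : Finset V} (h : ¬ DisjointCopiesIn F E s W) :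
    ∃ X ⊆ W, X.card ≤ s * (Fintype.card β + Fintype.card (Sym2 β) * r) ∧ ¬ CopyIn F E (W \ X) := by
  induction s generalizing W with
  | zero => exact absurd trivial h
  | succ s ih =>
    by_cases hcopy : CopyIn F E W
    · obtain ⟨X, hX, hc, h1⟩ := hcopy.exists_small hE
      obtain ⟨Y, hY, hcY, h2⟩ := ih (W := W \ X) fun h3 => h ⟨X, hX, h1, h3⟩
      refine ⟨X ∪ Y, union_subset hX (hY.trans sdiff_subset), ?_, ?_⟩
      · refine (card_union_le _ _).trans ?_
        rw [add_mul, one_mul]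
        omega
      · have h3 : W \ (X ∪ Y) = (W \ X) \ Y := by
          ext
          simp only [mem_sdiff, mem_union]
          tauto
        rwa [h3]
    · exact ⟨∅, empty_subset _, by simp, by simpa using hcopy⟩

lemma card_edges_superset_le {r : ℕ} (hE : ∀ e ∈ E, e.card = r) {S W : Finset V} (hS : S ⊆ W) :
    #{e ∈ E | e ⊆ W ∧ S ⊆ e} ≤ (W.card - S.card).choose (r - S.card) := by
  rw [← card_sdiff_of_subset hS, ← card_powersetCard]
  refine card_le_card_of_injOn (fun e => e \ S) ?_ ?_
  · intro e he
    rw [mem_coe, mem_filter] at he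
    rw [mem_coe, mem_powersetCard, card_sdiff_of_subset he.2.2, hE e he.1]
    exact ⟨sdiff_subset_sdiff he.2.1 (Subset.refl _), rfl⟩
  · intro e he e' he' h
    rw [mem_coe, mem_filter] at he he'
    rw [← sdiff_union_of_subset he.2.2, ← sdiff_union_of_subset he'.2.2]
    exact congrArg (· ∪ S) h

lemma card_edges_le_of_cover (E : Finset (Finset V)) {W Y : Finset V} :
    #{e ∈ E | e ⊆ W} ≤ #{e ∈ E | e ⊆ W \ Y} +
      ∑ y ∈ Y, #{e ∈ E | e ⊆ insert y (W \ Y) ∧ y ∈ e} +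
      ∑ p ∈ Y.offDiag, #{e ∈ E | e ⊆ W ∧ p.1 ∈ e ∧ p.2 ∈ e} := by
  have h1 : ({e ∈ E | e ⊆ W} : Finset (Finset V)) ⊆ {e ∈ E | e ⊆ W \ Y} ∪
      Y.biUnion (fun y => {e ∈ E | e ⊆ insert y (W \ Y) ∧ y ∈ e}) ∪
      Y.offDiag.biUnion (fun p => {e ∈ E | e ⊆ W ∧ p.1 ∈ e ∧ p.2 ∈ e}) := by
    intro e he
    rw [mem_filter] at he
    simp only [mem_union, mem_biUnion, mem_filter, mem_offDiag, Prod.exists]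
    by_cases h0 : ∃ y ∈ Y, y ∈ e
    · obtain ⟨y, hy, hye⟩ := h0
      by_cases h2 : ∃ z ∈ Y, z ∈ e ∧ y ≠ z
      · obtain ⟨z, hz, hze, hyz⟩ := h2
        exact Or.inr ⟨y, z, ⟨hy, hz, hyz⟩, he.1, he.2, hye, hze⟩
      · push Not at h2
        refine Or.inl (Or.inr ⟨y, hy, he.1, fun z hz => ?_, hye⟩)
        by_cases hzY : z ∈ Y
        · exact (h2 z hzY hz) ▸ mem_insert_self _ _
        · exact mem_insert_of_mem (mem_sdiff.mpr ⟨he.2 hz, hzY⟩)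
    · push Not at h0
      exact Or.inl (Or.inl ⟨he.1, fun z hz => mem_sdiff.mpr ⟨he.2 hz, fun h => h0 z h hz⟩⟩)
  refine (card_le_card h1).trans ((card_union_le _ _).trans ?_)
  exact Nat.add_le_add ((card_union_le _ _).trans (Nat.add_le_add_left card_biUnion_le _))
    card_biUnion_le

lemma card_edges_le_of_deletion (E : Finset (Finset V)) {W Y : Finset V} :
    #{e ∈ E | e ⊆ W} ≤ #{e ∈ E | e ⊆ W \ Y} + ∑ y ∈ Y, #{e ∈ E | e ⊆ W ∧ {y} ⊆ e} := by
  have h1 : ({e ∈ E | e ⊆ W} : Finset (Finset V)) ⊆ {e ∈ E | e ⊆ W \ Y} ∪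
      Y.biUnion (fun y => {e ∈ E | e ⊆ W ∧ {y} ⊆ e}) := by
    intro e he
    rw [mem_filter] at he
    simp only [mem_union, mem_biUnion, mem_filter, singleton_subset_iff]
    by_cases h0 : ∃ y ∈ Y, y ∈ e
    · obtain ⟨y, hy, hye⟩ := h0
      exact Or.inr ⟨y, hy, he.1, he.2, hye⟩
    · push Not at h0
      exact Or.inl ⟨he.1, fun z hz => mem_sdiff.mpr ⟨he.2 hz, fun h => h0 z h hz⟩⟩
  exact (card_le_card h1).trans ((card_union_le _ _).trans (Nat.add_le_add_left card_biUnion_le _))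

end

/-- A hypergraph in which each vertex of a bounded set `Y` creates no copy with the vertices outside
`Y` has at most `T_r(n, k, 1)` edges. -/
theorem exists_card_le_of_cover {k t r : ℕ} (hr : 2 ≤ r) (hrk : r ≤ k) (ht : 2 ≤ t) (K : ℕ) :
    ∃ n₀ : ℕ, ∀ (V : Type) [DecidableEq V] (E : Finset (Finset V)) (W Y : Finset V),
      n₀ ≤ W.card → (∀ e ∈ E, e.card = r) → Y ⊆ W → Y.card ≤ K →
      ¬ CopyIn (turanPlusEdge k t) E (W \ Y) →
      (∀ y ∈ Y, ¬ CopyIn (turanPlusEdge k t) E (insert y (W \ Y))) →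
      #{e ∈ E | e ⊆ W} ≤ turanPlusCount r W.card k 1 := by
  have hk : 0 < k := by omega
  obtain ⟨q, rfl⟩ : ∃ q, r = q + 2 := ⟨r - 2, by omega⟩
  obtain ⟨κ, hκ, n₁, h1⟩ := exists_turanPlusCount_one_ge (k := k) (q := q + 1) hk (by omega)
  set η : ℝ := κ / (4 * (K + 1)) with hη
  have hη0 : 0 < η := by positivity
  obtain ⟨ε, hε, n₂, h2⟩ := exists_degree_le hr hrk ht hη0
  obtain ⟨n₃, h3⟩ := exists_turanPlusCount_sub_le hk (q + 1) K hη0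
  obtain ⟨n₄, h4⟩ := exists_le_turanPlusCount hk (q + 2) (half_pos hε)
  obtain ⟨n₅, h5⟩ := exists_card_le_turan hr hrk ht
  obtain ⟨n₆, h6⟩ := exists_nat_gt (max (2 * (K : ℝ) / ε) (2 * (K : ℝ) ^ 2 / κ))
  refine ⟨n₁ + n₂ + n₃ + n₄ + n₅ + n₆ + K, fun V _ E W Y hW hE hY hYK hfree hfreeY => ?_⟩
  set n := W.card with hn
  set c := Y.card with hc
  have hcn : c ≤ n := card_le_card hY
  have hsd : (W \ Y).card = n - c := card_sdiff_of_subset hY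
  have hn6 : (n₆ : ℝ) ≤ n := by exact_mod_cast (by omega : n₆ ≤ n)
  have hn0 : (0 : ℝ) < n := lt_of_le_of_lt (le_max_of_le_left (by positivity)) (h6.trans_le hn6)
  have hcK : (c : ℝ) ≤ K := by exact_mod_cast hYK
  by_contra! hcon
  set D : ℝ := (k - 1).choose (q + 1) / (k : ℝ) ^ (q + 1) with hD
  have hD0 : 0 ≤ D := by positivity
  have hdel : (#{e ∈ E | e ⊆ W} : ℝ) ≤ #{e ∈ E | e ⊆ W \ Y} + K * (n : ℝ) ^ (q + 1) := by
    have h7 := card_edges_le_of_deletion E (W := W) (Y := Y)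
    have h8 : ∑ y ∈ Y, #{e ∈ E | e ⊆ W ∧ {y} ⊆ e} ≤ c * n ^ (q + 1) := by
      rw [hc, ← smul_eq_mul]
      refine sum_le_card_nsmul _ _ _ fun y hy => ?_
      refine (card_edges_superset_le hE (singleton_subset_iff.mpr (hY hy))).trans ?_
      rw [card_singleton, ← hn]
      exact (Nat.choose_le_pow _ _).trans (Nat.pow_le_pow_left (by omega) _)
    have h9 : #{e ∈ E | e ⊆ W} ≤ #{e ∈ E | e ⊆ W \ Y} + K * n ^ (q + 1) :=
      h7.trans (Nat.add_le_add_left (h8.trans (Nat.mul_le_mul_right _ hYK)) _)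
    exact_mod_cast h9
  have hdense : (k.choose (q + 2) / (k : ℝ) ^ (q + 2) - ε) * (n : ℝ) ^ (q + 2) ≤
      #{e ∈ E | e ⊆ W \ Y} := by
    have h7 := h4 n (by omega)
    have h8 : (turanPlusCount (q + 2) n k 0 : ℝ) ≤ #{e ∈ E | e ⊆ W} := by
      exact_mod_cast ((turanPlusCount_mono _ _ _ (Nat.zero_le 1)).trans hcon.le)
    have h9 : K * (n : ℝ) ^ (q + 1) ≤ ε / 2 * (n : ℝ) ^ (q + 2) := by
      rw [pow_succ _ (q + 1), ← mul_assoc, mul_comm _ (n : ℝ), ← mul_assoc]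
      refine mul_le_mul_of_nonneg_right ?_ (by positivity)
      have h10 : 2 * (K : ℝ) / ε ≤ n := ((le_max_left _ _).trans h6.le).trans hn6
      rw [div_le_iff₀ hε] at h10
      linarith
    linarith
  have hdeg : ∀ y ∈ Y, (#{e ∈ E | e ⊆ insert y (W \ Y) ∧ y ∈ e} : ℝ) ≤
      (D + η) * (n : ℝ) ^ (q + 1) := by
    intro y hy
    set U := insert y (W \ Y) with hU
    have hUc : U.card = n - c + 1 := by
      rw [hU, card_insert_of_notMem (fun h => (mem_sdiff.mp h).2 hy), hsd]
    have hc1 : 0 < c := card_pos.mpr ⟨y, hy⟩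
    have hUn : U.card ≤ n := by omega
    have hUn' : (U.card : ℝ) ≤ n := by exact_mod_cast hUn
    have h7 := h2 U (restrictTo E U) (by rw [Fintype.card_coe]; omega)
      (card_of_mem_restrictTo hE) (fun h => hfreeY y hy h.of_restrictTo)
      (by
        rw [Fintype.card_coe, card_restrictTo]
        have h8 : (#{e ∈ E | e ⊆ W \ Y} : ℝ) ≤ #{e ∈ E | e ⊆ U} := by
          exact_mod_cast card_le_card (monotone_filter_right _
            fun (e : Finset V) _ (he : e ⊆ W \ Y) => he.trans (subset_insert _ _))
        by_cases h9 : 0 ≤ (k.choose (q + 2) / (k : ℝ) ^ (q + 2) - ε)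
        · exact (mul_le_mul_of_nonneg_left (pow_le_pow_left₀ (by positivity) hUn' _) h9).trans
            (hdense.trans h8)
        · exact (mul_nonpos_of_nonpos_of_nonneg (not_le.mp h9).le (by positivity)).trans
            (by positivity))
      ⟨y, mem_insert_self _ _⟩
    rw [card_restrictTo_mem, Fintype.card_coe] at h7
    exact h7.trans (mul_le_mul_of_nonneg_left (pow_le_pow_left₀ (by positivity) hUn' _)
      (by positivity))
  have hpair : (∑ p ∈ Y.offDiag, #{e ∈ E | e ⊆ W ∧ p.1 ∈ e ∧ p.2 ∈ e} : ℝ) ≤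
      (K : ℝ) ^ 2 * (n : ℝ) ^ q := by
    have h7 : ∑ p ∈ Y.offDiag, #{e ∈ E | e ⊆ W ∧ p.1 ∈ e ∧ p.2 ∈ e} ≤ Y.offDiag.card * n ^ q := by
      rw [← smul_eq_mul]
      refine sum_le_card_nsmul _ _ _ fun p hp => ?_
      obtain ⟨h8, h9, h10⟩ := mem_offDiag.mp hp
      have h11 := card_edges_superset_le hE (S := {p.1, p.2}) (W := W)
        (insert_subset (hY h8) (singleton_subset_iff.mpr (hY h9)))
      rw [card_pair h10] at h11
      have h12 : #{e ∈ E | e ⊆ W ∧ p.1 ∈ e ∧ p.2 ∈ e} ≤ #{e ∈ E | e ⊆ W ∧ {p.1, p.2} ⊆ e} :=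
        card_le_card (monotone_filter_right _ fun e _ he =>
          ⟨he.1, insert_subset he.2.1 (singleton_subset_iff.mpr he.2.2)⟩)
      exact (h12.trans h11).trans ((Nat.choose_le_pow _ _).trans (Nat.pow_le_pow_left (by omega) _))
    have h8 : Y.offDiag.card ≤ K ^ 2 := by
      rw [offDiag_card, sq]
      exact (Nat.sub_le _ _).trans (Nat.mul_le_mul hYK hYK)
    exact_mod_cast h7.trans (Nat.mul_le_mul_right _ h8)
  have hfin : (#{e ∈ E | e ⊆ W} : ℝ) ≤ turanPlusCount (q + 2) (n - c) k 0 +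
      c * ((D + η) * (n : ℝ) ^ (q + 1)) + (K : ℝ) ^ 2 * (n : ℝ) ^ q := by
    have h7 := card_edges_le_of_cover E (W := W) (Y := Y)
    have h8 : (#{e ∈ E | e ⊆ W} : ℝ) ≤ #{e ∈ E | e ⊆ W \ Y} +
      ∑ y ∈ Y, (#{e ∈ E | e ⊆ insert y (W \ Y) ∧ y ∈ e} : ℝ) +
      ∑ p ∈ Y.offDiag, (#{e ∈ E | e ⊆ W ∧ p.1 ∈ e ∧ p.2 ∈ e} : ℝ) := by exact_mod_cast h7
    have h9 := h5 V E (W \ Y) (by rw [hsd]; omega) hE hfree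
    rw [hsd] at h9
    have h10 : (#{e ∈ E | e ⊆ W \ Y} : ℝ) ≤ turanPlusCount (q + 2) (n - c) k 0 := by
      exact_mod_cast h9
    have h11 := sum_le_card_nsmul _ _ _ hdeg
    rw [nsmul_eq_mul, ← hc] at h11
    linarith
  have h7 := h3 n c (by omega) hYK
  have h8 := h1 n (by omega)
  have h9 : (turanPlusCount (q + 2) n k 1 : ℝ) < #{e ∈ E | e ⊆ W} := by exact_mod_cast hcon
  have h10 : (c : ℝ) * (2 * η) * (n : ℝ) ^ (q + 1) ≤ κ / 2 * (n : ℝ) ^ (q + 1) := by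
    refine mul_le_mul_of_nonneg_right ?_ (by positivity)
    calc (c : ℝ) * (2 * η) ≤ (K + 1) * (2 * η) :=
          mul_le_mul_of_nonneg_right (by linarith) (by positivity)
      _ = κ / 2 := by rw [hη]; field_simp; norm_num
  have h11 : (K : ℝ) ^ 2 * (n : ℝ) ^ q ≤ κ / 2 * (n : ℝ) ^ (q + 1) := by
    rw [pow_succ _ q, mul_comm _ (n : ℝ), ← mul_assoc]
    refine mul_le_mul_of_nonneg_right ?_ (by positivity)
    have h12 : 2 * (K : ℝ) ^ 2 / κ ≤ n := ((le_max_right _ _).trans h6.le).trans hn6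
    rw [div_le_iff₀ hκ] at h12
    linarith
  rw [show q + 1 + 1 = q + 2 from rfl] at h7 h8
  have h12 : (c : ℝ) * ((D + η) * (n : ℝ) ^ (q + 1)) =
      c * (D - η) * (n : ℝ) ^ (q + 1) + c * (2 * η) * (n : ℝ) ^ (q + 1) := by ring
  linarith

/-- The Turán bound for disjoint expansions of a complete `k`-partite graph plus an edge. -/
theorem exists_card_le_of_not_disjointCopiesIn {k t r : ℕ} (hr : 2 ≤ r) (hrk : r ≤ k) (ht : 2 ≤ t)
    (s : ℕ) :
    ∃ n₀ : ℕ, ∀ (V : Type) [DecidableEq V] (E : Finset (Finset V)) (W : Finset V),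
      n₀ ≤ W.card → (∀ e ∈ E, e.card = r) →
      ¬ DisjointCopiesIn (turanPlusEdge k t) E (s + 1) W →
      #{e ∈ E | e ⊆ W} ≤ turanPlusCount r W.card k s := by
  induction s with
  | zero =>
    obtain ⟨n₀, h⟩ := exists_card_le_turan hr hrk ht
    exact ⟨n₀, fun V _ E W hW hE hfree => h V E W hW hE fun hcopy =>
      hfree ⟨W, Subset.refl _, hcopy, trivial⟩⟩
  | succ s ih =>
    obtain ⟨n₁, h1⟩ := ih
    set N := Fintype.card (Fin k × Fin t) + Fintype.card (Sym2 (Fin k × Fin t)) * r with hN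
    set K := (s + 2) * N + (s + 2) * N * ((s + 1) * N) with hK
    obtain ⟨n₂, h2⟩ := exists_card_le_of_cover hr hrk ht K
    refine ⟨n₁ + n₂ + 1, fun V _ E W hW hE hfree => ?_⟩
    by_cases hrich : ∃ x ∈ W, ∀ Y : Finset V, x ∉ Y → Y.card ≤ (s + 1) * N →
        CopyIn (turanPlusEdge k t) E (W \ Y)
    · obtain ⟨x, hx, hrich⟩ := hrich
      have hc : (W.erase x).card = W.card - 1 := card_erase_of_mem hx
      have h3 := h1 V E (W.erase x) (by omega) hE fun hcopies => by
        obtain ⟨Y, hY, hcY, h4⟩ := hcopies.exists_small hE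
        refine hfree ⟨W \ Y, sdiff_subset,
          hrich Y (fun h => notMem_erase _ _ (hY h)) hcY, h4.mono ?_⟩
        rw [sdiff_sdiff_right_self]
        exact subset_inter (hY.trans (erase_subset _ _)) (Subset.refl _)
      have h4 := card_edges_le_of_deletion E (W := W) (Y := {x})
      have h5 := card_edges_superset_le hE (singleton_subset_iff.mpr hx)
      rw [sum_singleton, sdiff_singleton_eq_erase] at h4
      rw [card_singleton] at h5
      obtain ⟨m, hm⟩ : ∃ m, W.card = m + 1 := ⟨W.card - 1, by omega⟩
      obtain ⟨q, rfl⟩ : ∃ q, r = q + 1 := ⟨r - 1, by omega⟩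
      rw [hc, hm] at h3
      rw [hm] at h5 ⊢
      rw [turanPlusCount_succ]
      simp only [Nat.add_sub_cancel] at h3 h5
      omega
    · push Not at hrich
      obtain ⟨X, hX, hcX, hXfree⟩ := exists_cover_of_not_disjointCopiesIn hE hfree
      choose! Z hZ1 hZ2 hZ3 using hrich
      set Y := X ∪ X.biUnion (fun x => Z x ∩ W) with hY
      have hYW : Y ⊆ W := union_subset hX (biUnion_subset.mpr fun x _ => inter_subset_right)
      have hYc : Y.card ≤ K := by
        refine (card_union_le _ _).trans (Nat.add_le_add hcX ?_)
        refine (card_biUnion_le_card_mul _ _ ((s + 1) * N) fun x hx => ?_).trans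
          (Nat.mul_le_mul_right _ hcX)
        exact (card_le_card inter_subset_left).trans (hZ2 x (hX hx))
      refine (h2 V E W Y (by omega) hE hYW hYc ?_ ?_).trans
        (turanPlusCount_mono _ _ _ (by omega))
      · exact fun h => hXfree (h.mono (Subset.refl _)
          (sdiff_subset_sdiff (Subset.refl _) subset_union_left))
      · intro y hy h
        by_cases hyX : y ∈ X
        · refine hZ3 y (hX hyX) (h.mono (Subset.refl _) (insert_subset ?_ fun z hz => ?_))
          · exact mem_sdiff.mpr ⟨hX hyX, hZ1 y (hX hyX)⟩
          · rw [mem_sdiff] at hz ⊢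
            exact ⟨hz.1, fun hzZ => hz.2 (mem_union_right _ (mem_biUnion.mpr
              ⟨y, hyX, mem_inter.mpr ⟨hzZ, hz.1⟩⟩))⟩
        · refine hXfree (h.mono (Subset.refl _) (insert_subset ?_ ?_))
          · exact mem_sdiff.mpr ⟨hYW hy, hyX⟩
          · exact sdiff_subset_sdiff (Subset.refl _) subset_union_left

lemma DisjointCopiesIn.exists_family {V β : Type} [DecidableEq V] {F : SimpleGraph β}
    {E : Finset (Finset V)} {s : ℕ} {W : Finset V} (h : DisjointCopiesIn F E s W) :
    ∃ X : Fin s → Finset V, (∀ i, X i ⊆ W) ∧ (∀ i, CopyIn F E (X i)) ∧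
      ∀ i j, i ≠ j → Disjoint (X i) (X j) := by
  induction s generalizing W with
  | zero => exact ⟨fun _ => ∅, fun i => i.elim0, fun i => i.elim0, fun i => i.elim0⟩
  | succ s ih =>
    obtain ⟨Y, hY, h1, h2⟩ := h
    obtain ⟨X, hX, h3, h4⟩ := ih h2
    refine ⟨Fin.cons Y X, ?_, ?_, ?_⟩
    · refine Fin.cases (by simpa using hY) fun i => ?_
      simpa using (hX i).trans sdiff_subset
    · exact Fin.cases (by simpa using h1) fun i => by simpa using h3 i
    · have h5 : ∀ i, Disjoint Y (X i) := fun i => disjoint_sdiff.mono_right (hX i)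
      refine Fin.cases (Fin.cases (fun h => absurd rfl h) fun j _ => by simpa using h5 j) fun i => ?_
      refine Fin.cases (fun _ => by simpa using (h5 i).symm) fun j hij => ?_
      simpa using h4 i j fun h => hij (h ▸ rfl)

/-- Disjoint expansions of `H` contain an expansion of every graph embedded in disjoint
copies of `H`. -/
lemma containsExpansion_of_embedding {α : Type*} {V β : Type} [DecidableEq V] {r s : ℕ}
    {F : SimpleGraph α} {H : SimpleGraph β} {G : HyperGraph V r} {W : Finset V}
    (h : DisjointCopiesIn H G.edges s W) (i : α → Fin s) (g : α → β)
    (hinj : ∀ a b, i a = i b → g a = g b → a = b)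
    (hadj : ∀ a b, F.Adj a b → i a = i b ∧ H.Adj (g a) (g b)) : G.ContainsExpansion F := by
  obtain ⟨X, -, hX, hdisj⟩ := h.exists_family
  choose φ S h1 h2 h3 h4 h5 using hX
  set idx : Sym2 α → Fin s := fun e => i (Quot.out e).1 with hidx
  have hidx' : ∀ a b, F.Adj a b → idx s(a, b) = i a := by
    intro a b hab
    have h6 : (Quot.out s(a, b)).1 ∈ s(a, b) := Sym2.out_fst_mem _
    rcases Sym2.mem_iff.mp h6 with h7 | h7
    · rw [hidx]; exact congrArg i h7
    · rw [hidx, (hadj a b hab).1]; exact congrArg i h7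
  have hX : ∀ {j j' x}, x ∈ X j → x ∈ X j' → j = j' := by
    intro j j' x hx hx'
    by_contra hne
    exact disjoint_left.mp (hdisj j j' hne) hx hx'
  have hφ : Function.Injective fun a => φ (i a) (g a) := by
    intro a b hab
    have hab : φ (i a) (g a) = φ (i b) (g b) := hab
    have h6 : i a = i b := hX (h1 (i a) (g a)) (hab ▸ h1 (i b) (g b))
    rw [h6] at hab
    exact hinj a b h6 ((φ (i b)).injective hab)
  obtain ⟨T, hT⟩ : ∃ T : Sym2 α → Finset V, ∀ e, T e = S (idx e) (e.map g) := ⟨_, fun _ => rfl⟩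
  have hS : ∀ a b, F.Adj a b → T s(a, b) = S (i a) s(g a, g b) := by
    intro a b hab
    rw [hT, hidx' a b hab, Sym2.map_mk]
  have hmem : ∀ a b, F.Adj a b →
      insert (φ (i a) (g a)) (insert (φ (i b) (g b)) (S (i a) s(g a, g b))) ∈ G.edges := by
    intro a b hab
    rw [← (hadj a b hab).1]
    exact h5 _ _ _ (hadj a b hab).2
  have havoid : ∀ a b, F.Adj a b → ∀ c, φ (i c) (g c) ∉ S (i a) s(g a, g b) := by
    intro a b hab c hc
    have hab' := (hadj a b hab).2
    have h6 : i c = i a := hX (h1 _ _) (h2 _ _ hab' hc)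
    rw [h6] at hc
    exact h3 _ _ hab' _ hc
  refine ⟨⟨_, hφ⟩, T, ?_, ?_, ?_, ?_⟩
  · intro a b hab
    have h6 := G.uniform _ (hmem a b hab)
    rw [card_insert_of_notMem, card_insert_of_notMem (havoid a b hab b)] at h6
    · rw [hS a b hab]
      omega
    · rw [mem_insert]
      rintro (h7 | h7)
      · exact hab.ne (hφ h7)
      · exact havoid a b hab a h7
  · rintro a b hab x hx ⟨c, rfl⟩
    rw [hS a b hab] at hx
    exact havoid a b hab c hx
  · intro e he e' he' hne
    induction e with | _ a b
    induction e' with | _ c d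
    rw [SimpleGraph.mem_edgeSet] at he he'
    rw [hS a b he, hS c d he']
    obtain ⟨h6, h7⟩ := hadj a b he
    obtain ⟨h8, h9⟩ := hadj c d he'
    by_cases hac : i a = i c
    · rw [hac]
      refine h4 (i c) _ h7 _ h9 fun h10 => hne ?_
      rw [Sym2.eq_iff] at h10 ⊢
      rcases h10 with ⟨h10, h11⟩ | ⟨h10, h11⟩
      · exact Or.inl ⟨hinj _ _ hac h10, hinj _ _ (h6.symm.trans (hac.trans h8)) h11⟩
      · exact Or.inr ⟨hinj _ _ (hac.trans h8) h10, hinj _ _ (h6.symm.trans hac) h11⟩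
    · exact (hdisj _ _ hac).mono (h2 _ _ h7) (h2 _ _ h9)
  · intro a b hab
    rw [hS a b hab]
    exact hmem a b hab

/-- A graph with a color-critical edge is `k`-colorable up to one edge inside the first class. -/
lemma exists_coloring_of_critical {β : Type*} {G : SimpleGraph β} {k : ℕ} (hk : 0 < k)
    (hG : G.chromaticNumber = (k : ℕ∞) + 1) (hcrit : HasColorCriticalEdge G) :
    ∃ (a b : β) (c : β → Fin k), a ≠ b ∧ c a = ⟨0, hk⟩ ∧ c b = ⟨0, hk⟩ ∧
      ∀ x y, G.Adj x y → c x ≠ c y ∨ s(x, y) = s(a, b) := by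
  obtain ⟨a, b, hab, hlt⟩ := hcrit
  rw [hG] at hlt
  have hcol : (G.deleteEdges {s(a, b)}).Colorable k :=
    SimpleGraph.chromaticNumber_le_iff_colorable.mp 
      ((ENat.lt_add_one_iff (ENat.natCast_ne_top k)).mp hlt)
  obtain ⟨c⟩ := hcol
  have hc : ∀ x y, G.Adj x y → c x ≠ c y ∨ s(x, y) = s(a, b) := by
    intro x y hxy
    by_cases h : s(x, y) = s(a, b)
    · exact Or.inr h
    · exact Or.inl (c.valid (by simp [SimpleGraph.deleteEdges_adj, hxy, h]))
  have hcab : c a = c b := by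
    by_contra hne
    have hGk : G.Colorable k := by
      refine ⟨SimpleGraph.Coloring.mk c fun {x y} hxy => ?_⟩
      rcases hc x y hxy with h | h
      · exact h
      · rcases Sym2.eq_iff.mp h with ⟨rfl, rfl⟩ | ⟨rfl, rfl⟩
        · exact hne
        · exact Ne.symm hne
    have h1 := SimpleGraph.chromaticNumber_le_iff_colorable.mpr hGk
    rw [hG] at h1
    exact absurd h1 (not_le.mpr (by exact_mod_cast Nat.lt_succ_self k))
  refine ⟨a, b, fun x => Equiv.swap (c a) ⟨0, hk⟩ (c x), hab.ne, by simp, by simp [hcab], ?_⟩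
  intro x y hxy
  rcases hc x y hxy with h | h
  · exact Or.inl fun h' => h ((Equiv.swap _ _).injective h')
  · exact Or.inr h

lemma exists_labelling {α : Type*} {m : ℕ} (ι : α ≃ Fin m) {a b : α} (hab : a ≠ b) :
    ∃ p : α → Fin (m + 2), Function.Injective p ∧
      (∀ x, (p x).val = (ι x).val + 2 ∨ (p x).val < 2) ∧ (p a).val < 2 ∧ (p b).val < 2 := by
  refine ⟨fun x => if x = a then ⟨0, by omega⟩ else if x = b then ⟨1, by omega⟩ else
    ⟨(ι x).val + 2, by omega⟩, fun x y hxy => ?_, fun x => ?_, by simp, by simp [hab.symm]⟩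
  · dsimp only at hxy
    split_ifs at hxy with h1 h2 h3 h4 h5 h6 h7 <;>
      simp only [Fin.mk.injEq] at hxy
    all_goals first
      | omega
      | (subst_vars; rfl)
      | exact ι.injective (Fin.ext (by omega))
  · dsimp only
    split_ifs <;> simp

lemma containsExpansion_of_disjointCopiesIn {α : Type*} [Fintype α] {V : Type} [DecidableEq V]
    {F : SimpleGraph α} {k r s : ℕ} (hs : 1 ≤ s) (hk : 0 < k)
    (hcomp : ∀ C : F.ConnectedComponent,
      ((F.induce C.supp).chromaticNumber = (k : ℕ∞) + 1 ∧
        HasColorCriticalEdge (F.induce C.supp)) ∨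
      (F.induce C.supp).chromaticNumber ≤ (k : ℕ∞))
    (hcount : Nat.card {C : F.ConnectedComponent //
        (F.induce C.supp).chromaticNumber = (k : ℕ∞) + 1} = s)
    {G : HyperGraph V r} {W : Finset V}
    (h : DisjointCopiesIn (turanPlusEdge k (Fintype.card α + 2)) G.edges s W) :
    G.ContainsExpansion F := by
  set crit : F.ConnectedComponent → Prop := fun C =>
    (F.induce C.supp).chromaticNumber = (k : ℕ∞) + 1 with hcrit
  set ι := Fintype.equivFin α with hι
  have hlocal : ∀ C : F.ConnectedComponent, ∃ (c : α → Fin k) (p : α → Fin (Fintype.card α + 2)),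
      Function.Injective p ∧ (∀ x, (p x).val = (ι x).val + 2 ∨ (p x).val < 2 ∧ crit C) ∧
      ∀ x ∈ C.supp, ∀ y ∈ C.supp, F.Adj x y → c x ≠ c y ∨
        ((c x).val = 0 ∧ (c y).val = 0 ∧ (p x).val < 2 ∧ (p y).val < 2) := by
    intro C
    by_cases hC : crit C
    · have h1 : HasColorCriticalEdge (F.induce C.supp) := by
        rcases hcomp C with h1 | h1
        · exact h1.2
        · rw [hcrit] at hC
          rw [hC] at h1
          exact absurd h1 (not_le.mpr (by exact_mod_cast Nat.lt_succ_self k))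
      obtain ⟨a, b, c, hab, hca, hcb, hc⟩ := exists_coloring_of_critical hk hC h1
      have hab' : a.1 ≠ b.1 := fun h => hab (Subtype.ext h)
      obtain ⟨p, hp, hpι, hpa, hpb⟩ := exists_labelling ι hab'
      refine ⟨fun x => if hx : x ∈ C.supp then c ⟨x, hx⟩ else ⟨0, hk⟩, p, hp,
        fun x => (hpι x).imp_right fun h2 => ⟨h2, hC⟩, ?_⟩
      · intro x hx y hy hxy
        simp only [hx, hy, dif_pos]
        rcases hc ⟨x, hx⟩ ⟨y, hy⟩ hxy with h2 | h2
        · exact Or.inl h2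
        · right
          rcases Sym2.eq_iff.mp h2 with ⟨rfl, rfl⟩ | ⟨rfl, rfl⟩
          · exact ⟨congrArg Fin.val hca, congrArg Fin.val hcb, hpa, hpb⟩
          · exact ⟨congrArg Fin.val hcb, congrArg Fin.val hca, hpb, hpa⟩
    · have h1 : (F.induce C.supp).Colorable k := by
        rcases hcomp C with h1 | h1
        · exact absurd h1.1 hC
        · exact SimpleGraph.chromaticNumber_le_iff_colorable.mp h1
      obtain ⟨c⟩ := h1
      refine ⟨fun x => if hx : x ∈ C.supp then c ⟨x, hx⟩ else ⟨0, hk⟩,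
        fun x => ⟨(ι x).val + 2, by omega⟩, ?_, fun x => Or.inl rfl, ?_⟩
      · intro x y hxy
        simp only [Fin.mk.injEq, Nat.add_right_cancel_iff] at hxy
        exact ι.injective (Fin.ext hxy)
      · intro x hx y hy hxy
        simp only [hx, hy, dif_pos]
        exact Or.inl (c.valid hxy)
  choose c p hp1 hp2 hp3 using hlocal
  have e : {C : F.ConnectedComponent // crit C} ≃ Fin s := Finite.equivFinOfCardEq hcount
  set i : F.ConnectedComponent → Fin s := fun C =>
    if hC : crit C then e ⟨C, hC⟩ else ⟨0, hs⟩ with hi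
  have hicrit : ∀ C C', crit C → crit C' → i C = i C' → C = C' := by
    intro C C' hC hC' h1
    simp only [hi, hC, hC', dif_pos] at h1
    exact congrArg Subtype.val (e.injective h1)
  set K : α → F.ConnectedComponent := F.connectedComponentMk with hK
  have hinj : ∀ a b, i (K a) = i (K b) → p (K a) a = p (K b) b → a = b := by
    intro a b h1 h2
    rcases hp2 (K a) a with h3 | ⟨h3, h4⟩ <;> rcases hp2 (K b) b with h5 | ⟨h5, h6⟩
    · rw [h2, h5] at h3
      exact ι.injective (Fin.ext (by omega))
    · rw [h2] at h3; omega
    · rw [h2] at h3; omega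
    · rw [hicrit _ _ h4 h6 h1] at h2
      exact hp1 _ h2
  refine containsExpansion_of_embedding h (fun a => i (K a)) (fun a => (c (K a) a, p (K a) a))
    (fun a b h1 h2 => hinj a b h1 (Prod.ext_iff.mp h2).2) fun a b hab => ?_
  have hKab : K a = K b := SimpleGraph.ConnectedComponent.sound hab.reachable
  refine ⟨congrArg i hKab, ?_⟩
  have h1 := hp3 (K a) a rfl b hKab.symm hab
  rw [← hKab]
  rcases h1 with h1 | ⟨h1, h2, h3, h4⟩
  · exact Or.inl h1
  · exact Or.inr ⟨fun h5 => hab.ne (hp1 _ (Prod.ext_iff.mp h5).2), h1, h2, h3, h4⟩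

/-- A component whose expansion avoids the first `i` vertices is properly coloured by the parts. -/
lemma colorable_component_of_avoids {α : Type*} {F : SimpleGraph α} {r n k i : ℕ} (hk : 0 < k)
    {G : HyperGraph (Fin n) r} (hG : G.edges = turanPlusEdges r n k i)
    {φ : α ↪ Fin n} {S : Sym2 α → Finset (Fin n)}
    (h : ∀ a b, F.Adj a b → insert (φ a) (insert (φ b) (S s(a, b))) ∈ G.edges)
    {C : F.ConnectedComponent} (hC : ∀ a ∈ C.supp, i ≤ (φ a).val)
    (hCS : ∀ a ∈ C.supp, ∀ b ∈ C.supp, F.Adj a b → ∀ v ∈ S s(a, b), i ≤ v.val) :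
    (F.induce C.supp).Colorable k := by
  refine ⟨SimpleGraph.Coloring.mk
    (fun x => (⟨((φ x.1).val - i) % k, Nat.mod_lt _ hk⟩ : Fin k)) ?_⟩
  rintro ⟨a, ha⟩ ⟨b, hb⟩ hab hcol
  have hab : F.Adj a b := hab
  have h1 := h a b hab
  rw [hG, turanPlusEdges, mem_filter] at h1
  rcases h1.2.2 with ⟨v, hv, hlt⟩ | hinj
  · rw [mem_insert, mem_insert] at hv
    rcases hv with rfl | rfl | hv
    · exact absurd (hC a ha) (not_le.mpr hlt)
    · exact absurd (hC b hb) (not_le.mpr hlt)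
    · exact absurd (hCS a ha b hb hab v hv) (not_le.mpr hlt)
  · refine hab.ne (φ.injective (hinj (by simp) (by simp) ?_))
    exact congrArg Fin.val hcol

/-- The Turán graph with `i` universal vertices has no expansion of a graph having more than `i`
components that are not `k`-colorable. -/
lemma not_containsExpansion_turanPlusEdges {α : Type*} [Fintype α] {F : SimpleGraph α}
    {r n k i : ℕ} (hk : 0 < k) {G : HyperGraph (Fin n) r}
    (hG : G.edges = turanPlusEdges r n k i)
    (hcount : i < Nat.card {C : F.ConnectedComponent //
        (F.induce C.supp).chromaticNumber = (k : ℕ∞) + 1}) : ¬ G.ContainsExpansion F := by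
  rintro ⟨φ, S, -, h2, h3, h4⟩
  have key : ∀ C : {C : F.ConnectedComponent //
        (F.induce C.supp).chromaticNumber = (k : ℕ∞) + 1}, ∃ v : Fin n, v.val < i ∧
      ((∃ a ∈ C.1.supp, φ a = v) ∨
        ∃ a ∈ C.1.supp, ∃ b ∈ C.1.supp, F.Adj a b ∧ v ∈ S s(a, b)) := by
    rintro ⟨C, hC⟩
    by_contra hcon
    push Not at hcon
    have h5 : (F.induce C.supp).Colorable k := by
      refine colorable_component_of_avoids hk hG h4 (fun a ha => ?_) fun a ha b hb hab v hv => ?_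
      · by_contra hlt
        exact (hcon _ (not_le.mp hlt)).1 a ha rfl
      · by_contra hlt
        exact (hcon v (not_le.mp hlt)).2 a ha b hb hab hv
    have h6 := SimpleGraph.chromaticNumber_le_iff_colorable.mpr h5
    rw [hC] at h6
    exact absurd h6 (not_le.mpr (by exact_mod_cast Nat.lt_succ_self k))
  choose v hv hv' using key
  have hinj : Function.Injective fun C => (⟨(v C).val, hv C⟩ : Fin i) := by
    intro C D hCD
    have hCD : v C = v D := Fin.ext (congrArg (fun x : Fin i => x.val) hCD)
    refine Subtype.ext ?_
    have h5 := hv' C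
    rw [hCD] at h5
    rcases h5 with ⟨a, ha, hav⟩ | ⟨a, ha, b, hb, hab, hv1⟩ <;>
      rcases hv' D with ⟨x, hx, hxv⟩ | ⟨x, hx, y, hy, hxy, hv2⟩
    · have h6 : a = x := φ.injective (hav.trans hxv.symm)
      rw [← ha, ← hx, h6]
    · exact absurd ⟨a, hav⟩ (h2 x y hxy _ hv2)
    · exact absurd ⟨x, hxv⟩ (h2 a b hab _ hv1)
    · by_cases h6 : s(a, b) = s(x, y)
      · rcases Sym2.eq_iff.mp h6 with ⟨h7, -⟩ | ⟨h7, -⟩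
        · rw [← ha, ← hx, h7]
        · rw [← ha, ← hy, h7]
      · exact absurd hv2 (disjoint_left.mp (h3 _ hab _ hxy h6) hv1)
  have h5 := Nat.card_le_card_of_injective _ hinj
  rw [Nat.card_fin] at h5
  omega

/-- If `s ≥ 1`, `2 ≤ r ≤ k` and `F` has exactly `s` components of chromatic
number `k+1`, each with a color-critical edge, all other components having chromatic number
at most `k`, then for large `n`, `ex_r(n, F^{(r)+}) = |E(T_r(n,k,s-1))|`. -/
theorem statement_3 {α : Type*} [Fintype α] [DecidableEq α] (F : SimpleGraph α) (k r s : ℕ)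
    (hs : 1 ≤ s) (hr : 2 ≤ r) (hrk : r ≤ k)
    (hcomp : ∀ C : F.ConnectedComponent,
      ((F.induce C.supp).chromaticNumber = (k : ℕ∞) + 1 ∧
        HasColorCriticalEdge (F.induce C.supp)) ∨
      (F.induce C.supp).chromaticNumber ≤ (k : ℕ∞))
    (hcount :
      Nat.card {C : F.ConnectedComponent //
        (F.induce C.supp).chromaticNumber = (k : ℕ∞) + 1} = s) :
    ∃ n₀ : ℕ, ∀ n ≥ n₀, exExpansion r n F = turanPlusCount r n k (s - 1) := by
  obtain ⟨n₀, hn₀⟩ := exists_card_le_of_not_disjointCopiesIn hr hrk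
    (show 2 ≤ Fintype.card α + 2 by omega) (s - 1)
  have hk : 0 < k := by omega
  refine ⟨n₀, fun n hn => ?_⟩
  have hupper : ∀ G : HyperGraph (Fin n) r, ¬ G.ContainsExpansion F →
      G.edges.card ≤ turanPlusCount r n k (s - 1) := by
    intro G hG
    have h := hn₀ (Fin n) G.edges univ (by simpa using hn) G.uniform fun h => by
      rw [Nat.sub_add_cancel hs] at h
      exact hG (containsExpansion_of_disjointCopiesIn hs hk hcomp hcount h)
    simpa using h
  have hmem : turanPlusCount r n k (s - 1) ∈
      {m | ∃ G : HyperGraph (Fin n) r, ¬ G.ContainsExpansion F ∧ G.edges.card = m} :=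
    ⟨⟨turanPlusEdges r n k (s - 1), fun e he => (mem_filter.mp he).2.1⟩,
      not_containsExpansion_turanPlusEdges hk rfl (by rw [hcount]; omega),
      card_turanPlusEdges ..⟩
  refine le_antisymm (csSup_le ⟨_, hmem⟩ ?_) (le_csSup ⟨turanPlusCount r n k (s - 1), ?_⟩ hmem) <;>
  · rintro m ⟨G, hG, rfl⟩
    exact hupper G hG
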